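/- Let K be a number field and G a finite group. Then there exist a finitely generated field extension F of K of transcendence degree 2 over K and a finite Galois field extension E of F with Galois group isomorphic to G, such that for every finite field extension K' of K there exists a finite set T' of primes of K' with the following property: for every prime v' of K' not in T' and every finite Galois field extension L of the completion K'_{v'} whose Galois group is isomorphic to a subgroup of G, the extension L of K'_{v'} is a specialization of E/F over K'_{v'}. -/

import Mathlib

open scoped TensorProduct
open IsDedekindDomain NumberField

set_option synthInstance.maxHeartbeats 1000000
set_option maxHeartbeats 2000000

/-- `M/Ω` is a specialization of the finite Galois field extension `E/F` over `Ω`. -/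
def IsSpecialization (K F E Ω M : Type) [Field K] [Field F] [Field E] [Field Ω] [Field M]
    [Algebra K F] [Algebra F E] [Algebra K Ω] [Algebra Ω M] : Prop :=
  ∃ A : Subalgebra K F, A.FG ∧ (∀ x : F, IsIntegral A x → x ∈ A) ∧ IsFractionRing A F ∧
    ∃ ψ : A →ₐ[K] Ω,
      letI : Algebra A E := ((algebraMap F E).comp (algebraMap A F)).toAlgebra
      letI : Algebra A Ω := ψ.toRingHom.toAlgebra
      IsReduced (Ω ⊗[A] (integralClosure A E)) ∧
      ∃ m : Ideal (Ω ⊗[A] (integralClosure A E)), m.IsMaximal ∧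
        Nonempty (((Ω ⊗[A] (integralClosure A E)) ⧸ m) ≃ₐ[Ω] M)

namespace Stepanov

open Polynomial

variable {k : Type*} [Field k]

/-- `G` divides `m ^ l` times its `l`-th Hasse derivative, with a cofactor of degree at
most `l * d`. -/
def HasControlledDerivs (m : k[X]) (d : ℕ) (G : k[X]) : Prop :=
  ∃ u : ℕ → k[X], ∀ l, m ^ l * hasseDeriv l G = G * u l ∧ (u l).natDegree ≤ l * d

theorem HasControlledDerivs.one (m : k[X]) (d : ℕ) : HasControlledDerivs m d 1 := by
  refine ⟨fun l => if l = 0 then 1 else 0, fun l => ?_⟩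
  by_cases h : l = 0
  · subst h; simp
  · have : hasseDeriv l (1 : k[X]) = 0 := by
      rw [← C_1]; exact hasseDeriv_C l 1 (Nat.pos_of_ne_zero h)
    simp [h, this]

theorem HasControlledDerivs.mul {m : k[X]} {d : ℕ} {G H : k[X]}
    (hG : HasControlledDerivs m d G) (hH : HasControlledDerivs m d H) :
    HasControlledDerivs m d (G * H) := by
  obtain ⟨u, hu⟩ := hG
  obtain ⟨w, hw⟩ := hH
  refine ⟨fun l => ∑ ab ∈ Finset.HasAntidiagonal.antidiagonal l, u ab.1 * w ab.2, fun l => ⟨?_, ?_⟩⟩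
  · rw [hasseDeriv_mul, Finset.mul_sum, Finset.mul_sum]
    refine Finset.sum_congr rfl fun ab hab => ?_
    rw [Finset.HasAntidiagonal.mem_antidiagonal] at hab
    calc _ = (m ^ ab.1 * hasseDeriv ab.1 G) * (m ^ ab.2 * hasseDeriv ab.2 H) := by
          rw [← hab, pow_add]; ring
      _ = _ := by rw [(hu _).1, (hw _).1]; ring
  · refine natDegree_sum_le_of_forall_le _ _ fun ab hab => ?_
    rw [Finset.HasAntidiagonal.mem_antidiagonal] at hab
    refine natDegree_mul_le.trans ?_
    rw [← hab, add_mul]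
    exact add_le_add (hu _).2 (hw _).2

theorem HasControlledDerivs.pow {m : k[X]} {d : ℕ} {G : k[X]}
    (hG : HasControlledDerivs m d G) (j : ℕ) : HasControlledDerivs m d (G ^ j) := by
  induction j with
  | zero => simpa using HasControlledDerivs.one m d
  | succ j ih => rw [pow_succ]; exact ih.mul hG

theorem HasControlledDerivs.prod {ι : Type*} {m : k[X]} {d : ℕ} (s : Finset ι) (G : ι → k[X])
    (hG : ∀ i ∈ s, HasControlledDerivs m d (G i)) : HasControlledDerivs m d (∏ i ∈ s, G i) :=
  Finset.prod_induction _ _ (fun _ _ => HasControlledDerivs.mul) (HasControlledDerivs.one m d) hG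

theorem HasControlledDerivs.X_sub_C (m : k[X]) (a : k) (d : ℕ) (hd : m.natDegree ≤ d)
    (hm : Polynomial.X - C a ∣ m) : HasControlledDerivs m d (Polynomial.X - C a) := by
  obtain ⟨m', rfl⟩ := hm
  refine ⟨fun l => if l = 0 then 1 else if l = 1 then m' else 0, fun l => ?_⟩
  rcases Nat.lt_trichotomy l 1 with h | rfl | h
  · obtain rfl : l = 0 := by omega
    simp
  · refine ⟨by simp [hasseDeriv_one], ?_⟩
    by_cases h0 : m' = 0
    · simp [h0]
    · rw [natDegree_mul (X_sub_C_ne_zero a) h0] at hd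
      simp; omega
  · have h2 : hasseDeriv l (Polynomial.X - C a) = 0 := by
      apply hasseDeriv_eq_zero_of_lt_natDegree
      simpa using h
    simp [h2, show l ≠ 0 by omega, show l ≠ 1 by omega]

theorem eq_zero_of_sum_eq_zero {ι : Type*} (s : Finset ι) (f : ι → k[X]) (a : k)
    (h : ∀ i ∈ s, ∀ j ∈ s, f i ≠ 0 → f j ≠ 0 → (f i).rootMultiplicity a = (f j).rootMultiplicity a
      → i = j) (h0 : ∑ i ∈ s, f i = 0) : ∀ i ∈ s, f i = 0 := by
  classical
  by_contra! hne
  obtain ⟨i0, hi0, hfi0⟩ := hne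
  obtain ⟨i, hi, hmin⟩ := Finset.exists_min_image (s.filter (fun i => f i ≠ 0))
    (fun i => (f i).rootMultiplicity a) ⟨i0, by simp [hi0, hfi0]⟩
  rw [Finset.mem_filter] at hi
  have hdvd : (X - C a) ^ ((f i).rootMultiplicity a + 1) ∣ f i := by
    rw [← Finset.add_sum_erase s f hi.1] at h0
    have hfi := eq_neg_of_add_eq_zero_left h0
    generalize hr : (f i).rootMultiplicity a = r at hmin ⊢
    rw [hfi]
    refine (Finset.dvd_sum fun j hj => ?_).neg_right
    rw [Finset.mem_erase] at hj
    by_cases hfj : f j = 0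
    · simp [hfj]
    · refine (le_rootMultiplicity_iff hfj).1 ?_
      have := hmin j (by simp [hj.2, hfj])
      rcases this.lt_or_eq with h' | h'
      · omega
      · exact absurd (h i hi.1 j hj.2 hi.2 hfj (hr.trans h')).symm hj.1
  have := (le_rootMultiplicity_iff hi.2).2 hdvd
  omega

theorem rootMultiplicity_pow_prod {d : ℕ} (hd : 0 < d) (z : ℕ → k) (c : ℕ → ℕ)
    (hz : ∀ i, 0 < i → i < d → z i ≠ z 0) :
    (∏ i ∈ Finset.range d, (X - C (z i)) ^ c i).rootMultiplicity (z 0) = c 0 := by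
  obtain ⟨d, rfl⟩ : ∃ e, d = e + 1 := ⟨d - 1, by omega⟩
  rw [Finset.prod_range_succ', mul_comm]
  have h0 : (∏ i ∈ Finset.range d, (X - C (z (i + 1))) ^ c (i + 1)) ≠ 0 :=
    Finset.prod_ne_zero_iff.2 fun i _ => pow_ne_zero _ (X_sub_C_ne_zero _)
  have h1 : (X - C (z 0)) ^ c 0 ≠ 0 := pow_ne_zero _ (X_sub_C_ne_zero _)
  rw [rootMultiplicity_mul (mul_ne_zero h1 h0), rootMultiplicity_X_sub_C_pow,
    rootMultiplicity_eq_zero, add_zero]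
  rw [IsRoot, eval_prod, Finset.prod_eq_zero_iff]
  rintro ⟨i, hi, h⟩
  rw [Finset.mem_range] at hi
  rw [eval_pow] at h
  have h := eq_zero_of_pow_eq_zero h
  simp [sub_eq_zero] at h
  exact hz (i + 1) (by omega) (by omega) h.symm

theorem stepanov_index_unique {q n A c0 : ℕ} (hnA : n * A ≤ q) (hc : q ∣ n * c0 + 1)
    {j j' l l' v v' : ℕ} (hj : j < n) (hj' : j' < n) (hv : v < A) (hv' : v' < A)
    (h : q * l + j * c0 + v = q * l' + j' * c0 + v') : j = j' ∧ l = l' := by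
  have hq : 0 < q := lt_of_lt_of_le (Nat.mul_pos (by omega) (by omega)) hnA
  obtain ⟨t, ht⟩ := hc
  zify at *
  have key : (n * v - j : ℤ) - (n * v' - j') = q * (n * (l' - l) + t * (j' - j)) := by
    linear_combination (n : ℤ) * h + (j' - j) * ht
  set w : ℤ := n * (l' - l) + t * (j' - j)
  have hb1 : (n * v - j : ℤ) - (n * v' - j') < q := by nlinarith
  have hb2 : -q < (n * v - j : ℤ) - (n * v' - j') := by nlinarith
  have hw : w = 0 := by
    rw [key] at hb1 hb2
    have : w < 1 := by by_contra hh; nlinarith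
    have : -1 < w := by by_contra hh; nlinarith
    omega
  rw [hw, mul_zero] at key
  have hvv : (v : ℤ) = v' := by
    have h1 : n * (v - v' : ℤ) = j - j' := by linarith
    have : (v - v' : ℤ) < 1 := by by_contra hh; nlinarith
    have : -1 < (v - v' : ℤ) := by by_contra hh; nlinarith
    omega
  have hjj : (j : ℤ) = j' := by rw [hvv] at key; linarith
  refine ⟨hjj, ?_⟩
  rw [hvv, hjj] at h
  have : (q : ℤ) * l = q * l' := by linarith
  exact mul_left_cancel₀ hq.ne' this

theorem card_mul_le_of_pow_dvd (S : Finset k) (H : k[X]) (h0 : H ≠ 0) (M : ℕ)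
    (h : ∀ s ∈ S, (X - C s) ^ M ∣ H) : M * S.card ≤ H.natDegree := by
  have : ∏ s ∈ S, (X - C s) ^ M ∣ H := by
    refine Finset.prod_dvd_of_coprime (fun s _ t _ hst => ?_) h
    exact (pairwise_coprime_X_sub_C Function.injective_id hst).pow
  have := natDegree_le_of_dvd this h0
  rw [Finset.prod_pow, natDegree_pow, natDegree_prod _ _ (fun i _ => X_sub_C_ne_zero i)] at this
  simpa using this

theorem exists_ne_zero_forall_eq_zero {ι κ : Type*} [Fintype ι] [Fintype κ] (A D : ℕ)
    (T : (ι → degreeLT k A) →ₗ[k] (κ → k[X])) (hT : ∀ x y, (T x y) ∈ degreeLT k D)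
    (h : Fintype.card κ * D < Fintype.card ι * A) : ∃ x ≠ 0, T x = 0 := by
  let T' : (ι → degreeLT k A) →ₗ[k] (κ → degreeLT k D) :=
    LinearMap.pi fun y => (LinearMap.proj y ∘ₗ T).codRestrict _ (fun x => hT x y)
  have e1 : Module.finrank k (degreeLT k D) = D := by
    rw [(degreeLTEquiv k D).finrank_eq]; simp
  have e2 : Module.finrank k (degreeLT k A) = A := by
    rw [(degreeLTEquiv k A).finrank_eq]; simp
  have : FiniteDimensional k (degreeLT k D) := (degreeLTEquiv k D).symm.finiteDimensional
  have : FiniteDimensional k (degreeLT k A) := (degreeLTEquiv k A).symm.finiteDimensional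
  have hk := LinearMap.ker_ne_bot_of_finrank_lt (f := T') (by
    rw [Module.finrank_pi_fintype, Module.finrank_pi_fintype]
    simpa [e1, e2] using h)
  obtain ⟨x, hx, hx0⟩ := Submodule.exists_mem_ne_zero_of_ne_bot hk
  refine ⟨x, hx0, funext fun y => ?_⟩
  have := congrFun (LinearMap.mem_ker.1 hx) y
  exact congrArg Subtype.val this

theorem taylor_coeff_pow_mul {p a q : ℕ} [Fact p.Prime] [CharP k p] (hq : q = p ^ a) {s ζ : k}
    (hs : s ^ q = s) (l l' : ℕ) (hl : l < q) (F : k[X]) :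
    (taylor s ((X - C ζ) ^ (q * l') * F)).coeff l =
      (s - ζ ^ q) ^ l' * (hasseDeriv l F).eval s := by
  have h1 : taylor s ((X - C ζ) ^ q) = X ^ q + C (s - ζ ^ q) := by
    subst hq
    rw [sub_pow_char_pow, map_sub, taylor_X_pow, ← C_pow, taylor_C, add_pow_char_pow, ← C_pow, hs]
    simp; ring
  have h2 : X ^ q ∣ taylor s ((X - C ζ) ^ (q * l')) - C ((s - ζ ^ q) ^ l') := by
    rw [pow_mul, taylor_pow, h1, C_pow]
    refine Dvd.dvd.trans ?_ (sub_dvd_pow_sub_pow _ _ l')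
    simp
  obtain ⟨Q, hQ⟩ := h2
  rw [taylor_mul, sub_eq_iff_eq_add.1 hQ, add_mul, coeff_add, mul_assoc, coeff_X_pow_mul',
    if_neg (by omega), zero_add, coeff_C_mul, taylor_coeff]

theorem stepanov_bound {p a q n d A B M : ℕ} [Fact p.Prime] [CharP k p] (hq : q = p ^ a)
    (hd : 0 < d) (hnA : n * A ≤ q) (hM : M ≤ q)
    (hcount : M * (A + B + M * d) < n * B * A) (c : ℕ → ℕ) (hc0 : q ∣ n * c 0 + 1)
    (hc : ∀ i, c i ≤ q) (ζ : k) (hζ : ∀ i, 0 < i → i < d → ζ ^ q ^ i ≠ ζ) (γ : k)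
    (S : Finset k) (hS : ∀ s ∈ S, s ^ q = s ∧
      ∏ i ∈ Finset.range d, (s - ζ ^ q ^ i) ^ c i = γ ∧ ∀ i < d, s ≠ ζ ^ q ^ i) :
    M * S.card ≤ q * (B + 1 + n * d) := by
  classical
  set z : ℕ → k := fun i => ζ ^ q ^ i with hz
  set g : k[X] := ∏ i ∈ Finset.range d, (X - C (z i)) ^ c i with hg
  set m : k[X] := ∏ i ∈ Finset.range d, (X - C (z i)) with hm
  have hmdeg : m.natDegree ≤ d := by
    rw [hm, natDegree_prod _ _ (fun i _ => X_sub_C_ne_zero _)]; simp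
  have hg0 : g ≠ 0 := Finset.prod_ne_zero_iff.2 fun i _ => pow_ne_zero _ (X_sub_C_ne_zero _)
  have hgdeg : g.natDegree ≤ q * d := by
    rw [hg, natDegree_prod _ _ (fun i _ => pow_ne_zero _ (X_sub_C_ne_zero _))]
    calc _ ≤ ∑ i ∈ Finset.range d, q := Finset.sum_le_sum fun i _ => by simpa using hc i
      _ = _ := by simp [mul_comm]
  have hctrl : ∀ j, HasControlledDerivs m d (g ^ j) := fun j => by
    refine HasControlledDerivs.pow (HasControlledDerivs.prod _ _ fun i hi => ?_) j
    exact (HasControlledDerivs.X_sub_C m _ d hmdeg (Finset.dvd_prod_of_mem _ hi)).pow _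
  choose u hu using hctrl
  let wL : ℕ → ℕ → k[X] →ₗ[k] k[X] := fun j l => ∑ ab ∈ Finset.HasAntidiagonal.antidiagonal l,
    LinearMap.mulLeft k (m ^ ab.1 * u j ab.2) ∘ₗ hasseDeriv ab.1
  have hwL : ∀ j l F, m ^ l * hasseDeriv l (F * g ^ j) = g ^ j * wL j l F := by
    intro j l F
    simp only [wL, LinearMap.sum_apply, LinearMap.comp_apply, LinearMap.mulLeft_apply]
    rw [hasseDeriv_mul, Finset.mul_sum, Finset.mul_sum]
    refine Finset.sum_congr rfl fun ab hab => ?_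
    rw [Finset.HasAntidiagonal.mem_antidiagonal] at hab
    calc _ = (m ^ ab.1 * hasseDeriv ab.1 F) * (m ^ ab.2 * hasseDeriv ab.2 (g ^ j)) := by
          rw [← hab, pow_add]; ring
      _ = _ := by rw [(hu _ _).1]; ring
  have hA : 0 < A := Nat.pos_of_ne_zero (by rintro rfl; simp at hcount)
  have hB : 0 < B := Nat.pos_of_ne_zero (by rintro rfl; simp at hcount)
  have hwdeg : ∀ j l F, F ∈ degreeLT k A → (wL j l F).natDegree ≤ (A - 1) + l * d := by
    intro j l F hF
    have hF' : F.natDegree ≤ A - 1 := by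
      by_cases h0 : F = 0
      · simp [h0]
      · have := (natDegree_lt_iff_degree_lt h0).2 (mem_degreeLT.1 hF); omega
    simp only [wL, LinearMap.sum_apply, LinearMap.comp_apply, LinearMap.mulLeft_apply]
    refine natDegree_sum_le_of_forall_le _ _ fun ab hab => ?_
    rw [Finset.HasAntidiagonal.mem_antidiagonal] at hab
    refine natDegree_mul_le.trans ?_
    have h1 := natDegree_hasseDeriv_le F ab.1
    have h2 := (hu j ab.2).2
    have h3 : (m ^ ab.1 * u j ab.2).natDegree ≤ ab.1 * d + ab.2 * d :=
      natDegree_mul_le.trans (add_le_add (natDegree_pow_le.trans (Nat.mul_le_mul_left _ hmdeg)) h2)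
    rw [← hab, add_mul]
    omega
  let Λ : ℕ → (Fin n × Fin B → degreeLT k A) →ₗ[k] k[X] := fun l =>
    ∑ x : Fin n × Fin B, LinearMap.mulLeft k ((X - C (ζ ^ q)) ^ (x.2 : ℕ) * C (γ ^ (x.1 : ℕ))) ∘ₗ
      wL x.1 l ∘ₗ (degreeLT k A).subtype ∘ₗ LinearMap.proj x
  have hΛ : ∀ l κ, Λ l κ = ∑ x : Fin n × Fin B,
      (X - C (ζ ^ q)) ^ (x.2 : ℕ) * C (γ ^ (x.1 : ℕ)) * wL x.1 l (κ x) := by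
    intro l κ
    simp only [Λ, LinearMap.sum_apply]
    rfl
  obtain ⟨κ, hκ0, hκ⟩ := exists_ne_zero_forall_eq_zero (κ := Fin M) A (A + B + M * d)
    (LinearMap.pi fun l : Fin M => Λ l) (by
      intro κ l
      have : (Λ l κ).natDegree < A + B + M * d := by
        rw [hΛ]
        refine lt_of_le_of_lt (natDegree_sum_le_of_forall_le (n := (B - 1) + 0 + (A - 1 + l * d))
          _ _ fun x _ => ?_) ?_
        · refine natDegree_mul_le.trans (add_le_add (natDegree_mul_le.trans (add_le_add
            ?_ (natDegree_C _).le)) (hwdeg _ _ _ (κ x).2))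
          rw [natDegree_pow, natDegree_X_sub_C]
          have := x.2.2; omega
        · have : (l : ℕ) * d ≤ M * d := Nat.mul_le_mul_right _ l.2.le
          omega
      exact mem_degreeLT.2 ((degree_le_natDegree).trans_lt (by exact_mod_cast this)))
    (by simpa using hcount)
  have hκ' : ∀ l < M, Λ l κ = 0 := fun l hl => congrFun hκ ⟨l, hl⟩
  let t : Fin n × Fin B → k[X] := fun x => (X - C ζ) ^ (q * (x.2 : ℕ)) * ((κ x : k[X]) * g ^ (x.1 : ℕ))
  have ht0 : ∀ x, t x ≠ 0 → (κ x : k[X]) ≠ 0 := fun x hx h => hx (by simp [t, h])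
  have hq0 : 0 < q := by rw [hq]; exact pow_pos (Fact.out : p.Prime).pos _
  have hz0 : z 0 = ζ := by simp [hz]
  have hgmult : g.rootMultiplicity ζ = c 0 := by
    have := rootMultiplicity_pow_prod hd z c (fun i h1 h2 => by rw [hz0]; exact hζ i h1 h2)
    rwa [hz0] at this
  have hmult : ∀ x, t x ≠ 0 → (t x).rootMultiplicity ζ =
      q * x.2 + x.1 * c 0 + (κ x : k[X]).rootMultiplicity ζ := by
    intro x hx
    have h1 : (X - C ζ) ^ (q * (x.2 : ℕ)) ≠ 0 := pow_ne_zero _ (X_sub_C_ne_zero _)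
    have h2 := ht0 x hx
    rw [rootMultiplicity_mul hx, rootMultiplicity_X_sub_C_pow,
      rootMultiplicity_mul (mul_ne_zero h2 (pow_ne_zero _ hg0))]
    have h3 : ∀ j, (g ^ j).rootMultiplicity ζ = j * c 0 := by
      intro j
      induction j with
      | zero => rw [pow_zero, zero_mul, ← C_1, rootMultiplicity_C]
      | succ j ih =>
        rw [pow_succ, rootMultiplicity_mul (mul_ne_zero (pow_ne_zero _ hg0) hg0), ih, hgmult]; ring
    rw [h3]; ring
  have hmultlt : ∀ x, t x ≠ 0 → (κ x : k[X]).rootMultiplicity ζ < A := by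
    intro x hx
    have := (natDegree_lt_iff_degree_lt (ht0 x hx)).2 (mem_degreeLT.1 (κ x).2)
    refine lt_of_le_of_lt ?_ this
    have h := natDegree_le_of_dvd (pow_rootMultiplicity_dvd (κ x : k[X]) ζ) (ht0 x hx)
    rwa [natDegree_pow, natDegree_X_sub_C, mul_one] at h
  set H : k[X] := ∑ x, t x with hH
  have hH0 : H ≠ 0 := by
    intro h0
    have := eq_zero_of_sum_eq_zero Finset.univ t ζ (by
      intro x _ y _ hx hy hxy
      rw [hmult x hx, hmult y hy] at hxy
      have := stepanov_index_unique hnA hc0 x.1.2 y.1.2 (hmultlt x hx) (hmultlt y hy) hxy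
      exact Prod.ext (Fin.ext this.1) (Fin.ext this.2)) h0
    apply hκ0
    funext x
    have hx := this x (Finset.mem_univ _)
    have h1 : (X - C ζ) ^ (q * (x.2 : ℕ)) ≠ 0 := pow_ne_zero _ (X_sub_C_ne_zero _)
    exact Subtype.ext (((mul_eq_zero.1 ((mul_eq_zero.1 hx).resolve_left h1)).resolve_right
      (pow_ne_zero _ hg0)))
  have hdvd : ∀ s ∈ S, (X - C s) ^ M ∣ H := by
    intro s hs
    obtain ⟨hs1, hs2, hs3⟩ := hS s hs
    rw [X_sub_C_pow_dvd_iff, X_pow_dvd_iff]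
    intro l hl
    have hms : m.eval s ≠ 0 := by
      rw [hm, eval_prod, Finset.prod_ne_zero_iff]
      intro i hi
      simpa [sub_eq_zero] using hs3 i (Finset.mem_range.1 hi)
    have hgs : g.eval s = γ := by
      rw [hg, eval_prod, ← hs2]; simp [hz]
    have h1 : (taylor s H).coeff l * m.eval s ^ l = (Λ l κ).eval s := by
      rw [hΛ, hH, map_sum, finsetSum_coeff, Finset.sum_mul, eval_finsetSum]
      refine Finset.sum_congr rfl fun x _ => ?_
      rw [taylor_coeff_pow_mul hq hs1 l _ (by omega)]
      have := congrArg (eval s) (hwL x.1 l (κ x))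
      rw [eval_mul, eval_mul, eval_pow, eval_pow, hgs] at this
      simp only [eval_mul, eval_pow, eval_sub, eval_X, eval_C]
      rw [mul_assoc ((s - ζ ^ q) ^ (x.2 : ℕ)), mul_assoc, ← this]; ring
    rw [hκ' l hl, eval_zero] at h1
    exact (mul_eq_zero.1 h1).resolve_right (pow_ne_zero _ hms)
  refine (card_mul_le_of_pow_dvd S H hH0 M hdvd).trans ?_
  refine natDegree_sum_le_of_forall_le _ _ fun x _ => ?_
  have h1 : (κ x : k[X]).natDegree ≤ A := by
      by_cases h0 : (κ x : k[X]) = 0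
      · simp [h0]
      · have := (natDegree_lt_iff_degree_lt h0).2 (mem_degreeLT.1 (κ x).2); omega
  have h2 : (g ^ (x.1 : ℕ)).natDegree ≤ n * (q * d) :=
    natDegree_pow_le.trans (Nat.mul_le_mul x.1.2.le hgdeg)
  have h3 : ((X - C ζ) ^ (q * (x.2 : ℕ))).natDegree ≤ q * B := by
    rw [natDegree_pow, natDegree_X_sub_C, mul_one]
    exact Nat.mul_le_mul_left _ x.2.2.le
  have hn : 0 < n := x.1.pos
  have hAq : A ≤ q := le_trans (Nat.le_mul_of_pos_left _ hn) hnA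
  calc (t x).natDegree ≤ q * B + (A + n * (q * d)) :=
        natDegree_mul_le.trans (add_le_add h3 (natDegree_mul_le.trans (add_le_add h1 h2)))
    _ ≤ q * B + (q + n * (q * d)) := by omega
    _ = _ := by ring

theorem sum_digits (q E d : ℕ) (h : E < q ^ d) :
    ∑ i ∈ Finset.range d, q ^ i * (E / q ^ i % q) = E := by
  have : ∀ d, ∑ i ∈ Finset.range d, q ^ i * (E / q ^ i % q) = E % q ^ d := by
    intro d
    induction d with
    | zero => simp [Nat.mod_one]
    | succ d ih => rw [Finset.sum_range_succ, ih, Nat.mod_pow_succ]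
  rw [this, Nat.mod_eq_of_lt h]

theorem stepanov_parameters {n d M q : ℕ} (hn : 0 < n) (hM : M * M ≤ q)
    (hbig : (d + 4) * (n + 1) ≤ M) :
    M * (q / n + (M / n + d + 4) + M * d) < n * (M / n + d + 4) * (q / n) := by
  have h1 := Nat.div_add_mod q n
  have h2 := Nat.div_add_mod M n
  have h3 := Nat.mod_lt q hn
  have h4 := Nat.mod_lt M hn
  have h5 : M / n ≤ M := Nat.div_le_self _ _
  generalize q / n = A at *
  generalize M / n = b at *
  have e1 : (M + n * (d + 3)) * A ≤ n * (b + d + 4) * A :=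
    Nat.mul_le_mul_right _ (by nlinarith)
  have e2 : M * (b + d + 4) ≤ q + (d + 4) * M := by nlinarith
  have e3 : M * (M * d) ≤ q * d := by nlinarith
  have e4 : (d + 3) * q ≤ n * (d + 3) * A + (d + 3) * n := by nlinarith
  have e5 : (d + 4) * M + (d + 3) * n < 2 * q := by nlinarith
  nlinarith

/-- A lower bound for the number of elements `s` of a finite field of `q` elements such that
`s - ζ` has a prescribed image under the `n`-th power residue symbol of the field of `q ^ d`
elements generated by `ζ`. -/
theorem exists_lt_card_residueSymbol (n d C₀ : ℕ) (hn : 0 < n) (hd : 0 < d) :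
    ∃ q₀ : ℕ, ∀ (k : Type) [Field k] [DecidableEq k] (p a q : ℕ) [Fact p.Prime] [CharP k p],
      q = p ^ a → q₀ ≤ q → n ∣ q ^ d - 1 → ∀ R : Finset k, (∀ s ∈ R, s ^ q = s) → q ≤ R.card →
      ∀ ζ γ : k, ζ ^ q ^ d = ζ → (∀ i, 0 < i → i < d → ζ ^ q ^ i ≠ ζ) → γ ^ n = 1 →
      C₀ < (R.filter fun s => (s - ζ) ^ ((q ^ d - 1) / n) = γ).card := by
  set c1 := n * (d + 5 + n * d) with hc1
  set M₀ := (d + 4) * (n + 1) + 2 * n * c1 + 2 * n * (C₀ + 1) + 1 with hM₀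
  refine ⟨(M₀ + 1) * (M₀ + 1), ?_⟩
  intro k _ _ p a q _ _ hq hq0 hnd R hR hRc ζ γ hζ hζ' hγ
  set M := Nat.sqrt q with hM
  have hMq : M * M ≤ q := Nat.sqrt_le q
  have hMM : M₀ ≤ M := Nat.le_sqrt.2 (by nlinarith)
  have hqpos : 1 < q := by nlinarith
  set E := (q ^ d - 1) / n with hE
  have hnE : n * E + 1 = q ^ d := by
    have h1 : n * E = q ^ d - 1 := Nat.mul_div_cancel' hnd
    have h2 : 1 ≤ q ^ d := Nat.one_le_pow d q (by omega)
    rw [h1, Nat.sub_add_cancel h2]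
  have hEpos : 0 < E := by
    rcases Nat.eq_zero_or_pos E with h | h
    · rw [h] at hnE
      have : 1 < q ^ d := Nat.one_lt_pow hd.ne' hqpos
      omega
    · exact h
  have hbound : ∀ γ' : k, γ' ^ n = 1 →
      n * M * (R.filter fun s => (s - ζ) ^ E = γ').card ≤ q * (M + c1) := by
    intro γ' hγ'
    have h := stepanov_bound (k := k) (p := p) (a := a) (q := q) (n := n) (d := d) (A := q / n)
      (B := M / n + d + 4) (M := M) hq hd (Nat.mul_div_le _ _) (by nlinarith)
      (stepanov_parameters hn hMq (by omega)) (fun i => E / q ^ i % q) (by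
        have h1 : q ∣ n * E + 1 := hnE ▸ dvd_pow_self q hd.ne'
        have h2 := Nat.div_add_mod E q
        simp only [pow_zero, Nat.div_one]
        have h3 : n * E + 1 = q * (n * (E / q)) + (n * (E % q) + 1) := by
          conv_lhs => rw [← h2]
          ring
        rw [h3] at h1
        exact (Nat.dvd_add_right (Dvd.intro _ rfl)).1 h1)
      (fun i => (Nat.mod_lt _ (by omega)).le) ζ hζ' γ' (R.filter fun s => (s - ζ) ^ E = γ') (by
        intro s hs
        rw [Finset.mem_filter] at hs
        have hs1 := hR s hs.1
        have hsi : ∀ i, s ^ q ^ i = s := by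
          intro i
          induction i with
          | zero => simp
          | succ i ih => rw [pow_succ, pow_mul, ih, hs1]
        refine ⟨hs1, ?_, ?_⟩
        · rw [← hs.2]
          conv_rhs => rw [← sum_digits q E d (by nlinarith)]
          rw [← Finset.prod_pow_eq_pow_sum]
          refine Finset.prod_congr rfl fun i _ => ?_
          rw [pow_mul]
          congr 1
          rw [hq, ← pow_mul, sub_pow_char_pow, pow_mul, ← hq, hsi]
        · intro i hi hsz
          have h1 : s = ζ := by
            have h2 := congrArg (fun x => x ^ q ^ (d - i)) hsz
            simp only [hsi, ← pow_mul, ← pow_add] at h2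
            rwa [show i + (d - i) = d by omega, hζ] at h2
          have h2 := hs.2
          rw [h1, sub_self, zero_pow hEpos.ne'] at h2
          rw [← h2, zero_pow hn.ne'] at hγ'
          exact zero_ne_one hγ')
    have h2 : n * (M / n) ≤ M := Nat.mul_div_le _ _
    calc _ = n * (M * (R.filter fun s => (s - ζ) ^ E = γ').card) := by ring
      _ ≤ n * (q * (M / n + d + 4 + 1 + n * d)) := Nat.mul_le_mul_left _ h
      _ = q * (n * (M / n) + c1) := by rw [hc1]; ring
      _ ≤ _ := Nat.mul_le_mul_left _ (by omega)
  by_contra! hcon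
  set Γ := (nthRootsFinset n (1 : k)) with hΓ
  have hΓc : Γ.card ≤ n := by
    rw [hΓ, nthRootsFinset]
    exact (@Multiset.toFinset_card_le _ (_) _).trans (card_nthRoots n 1)
  have hmem : ∀ x, x ∈ Γ ↔ x ^ n = 1 := fun x => mem_nthRootsFinset hn 1
  have hsum : q ≤ 1 + ∑ γ' ∈ Γ, (R.filter fun s => (s - ζ) ^ E = γ').card := by
    have h1 : R ⊆ insert ζ (Γ.biUnion fun γ' => R.filter fun s => (s - ζ) ^ E = γ') := by
      intro s hs
      by_cases hsz : s = ζ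
      · simp [hsz]
      · refine Finset.mem_insert_of_mem (Finset.mem_biUnion.2 ⟨(s - ζ) ^ E, ?_, by simp [hs]⟩)
        have hsi : ∀ i, s ^ q ^ i = s := by
          intro i
          induction i with
          | zero => simp
          | succ i ih => rw [pow_succ, pow_mul, ih, hR s hs]
        rw [hmem, ← pow_mul, mul_comm]
        have h2 : (s - ζ) ^ (n * E + 1) = s - ζ := by
          rw [hnE, hq, ← pow_mul, sub_pow_char_pow, pow_mul, ← hq, hsi, hζ]
        rw [pow_succ] at h2
        exact (mul_eq_right₀ (sub_ne_zero.2 hsz)).1 h2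
    have h2 := Finset.card_le_card h1
    have h3 := Finset.card_insert_le ζ (Γ.biUnion fun γ' => R.filter fun s => (s - ζ) ^ E = γ')
    have h4 := Finset.card_biUnion_le (s := Γ) (t := fun γ' => R.filter fun s => (s - ζ) ^ E = γ')
    omega
  have hγΓ : γ ∈ Γ := (hmem γ).2 hγ
  rw [← Finset.add_sum_erase _ _ hγΓ] at hsum
  have h5 : n * M * ∑ γ' ∈ Γ.erase γ, (R.filter fun s => (s - ζ) ^ E = γ').card
      ≤ (n - 1) * (q * (M + c1)) := by
    rw [Finset.mul_sum]
    refine (Finset.sum_le_card_nsmul _ _ (q * (M + c1)) fun γ' h => hbound γ'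
      ((hmem _).1 (Finset.mem_of_mem_erase h))).trans ?_
    rw [smul_eq_mul, Finset.card_erase_of_mem hγΓ]
    exact Nat.mul_le_mul_right _ (by omega)
  obtain ⟨n', rfl⟩ : ∃ n', n = n' + 1 := ⟨n - 1, by omega⟩
  simp only [Nat.add_sub_cancel] at h5
  have h6 : (n' + 1) * M * q ≤ (n' + 1) * M * (1 + C₀) + n' * (q * (M + c1)) := by
    refine (Nat.mul_le_mul_left _ (hsum.trans (Nat.add_le_add_left (Nat.add_le_add_right hcon _)
      _))).trans ?_
    rw [← add_assoc, mul_add]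
    exact Nat.add_le_add_left h5 _
  have h7 : M * q ≤ (n' + 1) * M * (1 + C₀) + n' * q * c1 := by nlinarith
  have h8 : 2 * (n' + 1) * c1 < M := by omega
  have h9 : 2 * (n' + 1) * (C₀ + 1) < M := by omega
  have h10 : 2 * ((n' + 1) * M * (1 + C₀)) < M * q := by
    have : 2 * (n' + 1) * (C₀ + 1) < q := by nlinarith
    have hM0 : 0 < M := by omega
    nlinarith
  have h11 : 2 * (n' * q * c1) ≤ M * q := by
    have : q * (2 * (n' + 1) * c1) ≤ q * M := Nat.mul_le_mul_left _ h8.le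
    have h0 : 0 ≤ q * c1 := Nat.zero_le _
    nlinarith
  omega

end Stepanov

namespace Specialization

open Polynomial

section Transitivity

variable {G B D : Type*} [Group G] [Finite G] [CommRing B] [MulSemiringAction G B]
  [CommRing D] [IsDomain D]

theorem exists_eq_apply_smul (x x' : B →+* D)
    (h : ∀ b, (∀ g : G, g • b = b) → x b = x' b) (b : B) : ∃ g : G, x' b = x (g • b) := by
  classical
  cases nonempty_fintype G
  have h1 : (MulSemiringAction.charpoly G b).map x' = (MulSemiringAction.charpoly G b).map x := by
    ext n
    rw [coeff_map, coeff_map]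
    exact (h _ fun g => MulSemiringAction.smul_coeff_charpoly b n g).symm
  have h2 : ((MulSemiringAction.charpoly G b).map x').eval (x' b) = 0 := by
    rw [eval_map, eval₂_hom, MulSemiringAction.eval_charpoly, map_zero]
  rw [h1, MulSemiringAction.charpoly_eq, Polynomial.map_prod, eval_prod,
    Finset.prod_eq_zero_iff] at h2
  obtain ⟨g, _, hg⟩ := h2
  exact ⟨g, by simpa [sub_eq_zero] using hg⟩

/-- Two homomorphisms to a domain which agree on the invariants of a finite group of
automorphisms differ by an element of the group. -/
theorem exists_forall_eq_apply_smul (x x' : B →+* D)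
    (h : ∀ b, (∀ g : G, g • b = b) → x b = x' b) : ∃ g : G, ∀ b, x' b = x (g • b) := by
  classical
  cases nonempty_fintype G
  by_contra! hne
  choose b hb using hne
  let e := Fintype.equivFin G
  let p : B[X] := ∑ g : G, C (b g) * X ^ (e g : ℕ)
  have hp : ∀ g, p.coeff (e g : ℕ) = b g := by
    intro g
    simp only [p, finsetSum_coeff, coeff_C_mul, coeff_X_pow, mul_ite, mul_one, mul_zero]
    rw [Finset.sum_eq_single g]
    · simp
    · intro g' _ hg'
      rw [if_neg]
      intro h
      exact hg' (e.injective (Fin.ext h)).symm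
    · simp
  obtain ⟨g, hg⟩ := exists_eq_apply_smul (G := G) (mapRingHom x) (mapRingHom x') (by
    intro q hq
    ext n
    simp only [coe_mapRingHom, coeff_map]
    refine h _ fun g => ?_
    rw [← coeff_smul, hq]) p
  have := congrArg (fun q => q.coeff (e g : ℕ)) hg
  simp only [coe_mapRingHom, coeff_map, coeff_smul, hp] at this
  exact hb g this

/-- A version of `exists_forall_eq_apply_smul` for a stable subring of a field on which a finite
group acts. -/
theorem exists_forall_eq_apply_of_stable {E : Type*} [Field E] [MulSemiringAction G E]
    (R : Subring E) (hR : ∀ (g : G), ∀ b ∈ R, g • b ∈ R) (x x' : R →+* D)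
    (h : ∀ b : R, (∀ g : G, g • (b : E) = b) → x b = x' b) :
    ∃ g : G, ∀ b : R, x' b = x ⟨g • (b : E), hR g b b.2⟩ := by
  let _ : MulSemiringAction G R :=
    { smul := fun g b => ⟨g • (b : E), hR g b b.2⟩
      one_smul := fun b => Subtype.ext (one_smul G (b : E))
      mul_smul := fun g g' b => Subtype.ext (mul_smul g g' (b : E))
      smul_zero := fun g => Subtype.ext (smul_zero g)
      smul_add := fun g a b => Subtype.ext (smul_add g (a : E) b)
      smul_one := fun g => Subtype.ext (smul_one g)
      smul_mul := fun g a b => Subtype.ext (smul_mul' g (a : E) b) }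
  exact exists_forall_eq_apply_smul (G := G) x x' fun b hb => h b fun g =>
    congrArg Subtype.val (hb g)

end Transitivity

/-- Homomorphisms to an algebraically closed field extend along integral extensions. -/
theorem exists_extension_of_isIntegral {A B Ω : Type*} [CommRing A] [CommRing B] [IsDomain B]
    [Field Ω] [IsAlgClosed Ω] [Algebra A B] [Algebra.IsIntegral A B]
    (hAB : Function.Injective (algebraMap A B)) (φ : A →+* Ω) :
    ∃ x : B →+* Ω, ∀ a, x (algebraMap A B a) = φ a := by
  set p := RingHom.ker φ with hp
  have hpp : p.IsPrime := RingHom.ker_isPrime φ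
  obtain ⟨Q, hQ, hQp⟩ := Ideal.exists_ideal_over_prime_of_isIntegral_of_isDomain
    (S := B) p (by rw [(RingHom.injective_iff_ker_eq_bot _).1 hAB]; exact bot_le)
  have : Q.LiesOver p := ⟨hQp.symm⟩
  let _ : Algebra (A ⧸ p) Ω := (RingHom.kerLift φ).toAlgebra
  have hinj : Function.Injective (algebraMap (A ⧸ p) Ω) := RingHom.kerLift_injective φ
  have : Module.IsTorsionFree (A ⧸ p) Ω := Module.isTorsionFree_iff_algebraMap_injective.2 hinj
  let f : (B ⧸ Q) →ₐ[A ⧸ p] Ω := IsAlgClosed.lift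
  refine ⟨f.toRingHom.comp (Ideal.Quotient.mk Q), fun a => ?_⟩
  exact f.commutes (Ideal.Quotient.mk p a)

section Core

variable {A F E Ω L : Type} [CommRing A] [Field F] [Field E] [Field Ω] [Field L]
  [Algebra A F] [Algebra F E] [Algebra A E] [IsScalarTower A F E] [Algebra A Ω] [Algebra Ω L]

theorem isIntegral_apply (g : E ≃ₐ[F] E) {b : E} (hb : IsIntegral A b) : IsIntegral A (g b) :=
  hb.map (g.restrictScalars A)

variable [FiniteDimensional F E] [IsGalois F E]

theorem exists_lift_of_invariant (hic : ∀ y : F, IsIntegral A y → ∃ a, algebraMap A F a = y)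
    {Q : E[X]} (hQ : ∀ n, IsIntegral A (Q.coeff n))
    (hinv : ∀ g : E ≃ₐ[F] E, Q.map (g : E →+* E) = Q) :
    ∃ q : A[X], q.map (algebraMap A E) = Q := by
  rw [← mem_lifts, lifts_iff_coeff_lifts]
  intro n
  have h1 : ∀ g : E ≃ₐ[F] E, g (Q.coeff n) = Q.coeff n := fun g => by
    conv_rhs => rw [← hinv g]
    simp
  obtain ⟨y, hy⟩ := (IsGalois.mem_range_algebraMap_iff_fixed (F := F) (Q.coeff n)).2 h1
  have h2 : IsIntegral A y := by
    have := hQ n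
    rw [← hy] at this
    exact (isIntegral_algebraMap_iff (algebraMap F E).injective).1 this
  obtain ⟨a, ha⟩ := hic y h2
  refine ⟨a, ?_⟩
  rw [IsScalarTower.algebraMap_apply A F E, ha, hy]

theorem coeff_mem_of_lifts (R : Subring E) {Q : E[X]} (hQ : Q ∈ lifts R.subtype) (n : ℕ) :
    Q.coeff n ∈ R := by
  obtain ⟨q, rfl⟩ := (mem_lifts _).1 hQ
  simp

/-- If the differences of the conjugates of an integral element are units, then it generates
the integral closure. -/
theorem exists_aeval_eq (hic : ∀ y : F, IsIntegral A y → ∃ a, algebraMap A F a = y)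
    {Θ : E} (hΘ : IsIntegral A Θ)
    (hu : ∀ g : E ≃ₐ[F] E, g ≠ 1 → g Θ ≠ Θ ∧ IsIntegral A (g Θ - Θ)⁻¹) {b : E}
    (hb : IsIntegral A b) : ∃ q : A[X], aeval Θ q = b := by
  classical
  have hinj : Set.InjOn (fun g : E ≃ₐ[F] E => g Θ) (Finset.univ : Finset (E ≃ₐ[F] E)) := by
    intro g _ g' _ h
    by_contra hne
    refine (hu (g'⁻¹ * g) fun h' => hne (inv_mul_eq_one.1 h').symm).1 ?_
    change g'.symm (g Θ) = Θ
    rw [show g Θ = g' Θ from h]; simp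
  set Q := Lagrange.interpolate Finset.univ (fun g : E ≃ₐ[F] E => g Θ) (fun g => g b) with hQ
  have hu' : ∀ g g' : E ≃ₐ[F] E, g ≠ g' → IsIntegral A (g Θ - g' Θ)⁻¹ := by
    intro g g' hne
    have := isIntegral_apply g' (hu (g'⁻¹ * g) fun h' => hne (inv_mul_eq_one.1 h').symm).2
    rw [map_inv₀, map_sub] at this
    change IsIntegral A (g' (g'.symm (g Θ)) - g' Θ)⁻¹ at this
    simpa using this
  have hlift : Q ∈ lifts (integralClosure A E).toSubring.subtype := by
    rw [hQ, Lagrange.interpolate_apply]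
    rw [lifts_iff_liftsRing]
    refine sum_mem fun g _ => mul_mem ?_ (prod_mem fun g' hg' => ?_)
    · exact (lifts_iff_liftsRing _ _).1 (C_mem_lifts (integralClosure A E).toSubring.subtype ⟨g b, isIntegral_apply g hb⟩)
    · refine mul_mem ((lifts_iff_liftsRing _ _).1 (C_mem_lifts
          (integralClosure A E).toSubring.subtype ⟨_, hu' g g' ?_⟩))
        (sub_mem ((lifts_iff_liftsRing _ _).1 (X_mem_lifts _)) ((lifts_iff_liftsRing _ _).1
          (C_mem_lifts (integralClosure A E).toSubring.subtype
            ⟨g' Θ, isIntegral_apply g' hΘ⟩)))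
      exact (Finset.ne_of_mem_erase hg').symm
  obtain ⟨q, hq⟩ := exists_lift_of_invariant hic (Q := Q)
    (fun n => coeff_mem_of_lifts (integralClosure A E).toSubring hlift n) (by
      intro h
      rw [hQ]
      refine Lagrange.eq_interpolate_of_eval_eq (fun g : E ≃ₐ[F] E => g b) hinj ?_ ?_
      · exact (degree_map_le).trans_lt (Lagrange.degree_interpolate_lt _ hinj)
      · intro g _
        have h1 := Lagrange.eval_interpolate_at_node (fun g : E ≃ₐ[F] E => g b) hinj
          (Finset.mem_univ (h⁻¹ * g))
        have h2 := congrArg h h1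
        have h3 : ∀ z, h ((h⁻¹ * g) z) = g z := fun z => by
          change h (h.symm (g z)) = g z
          simp
        rw [h3] at h2
        rw [← h2, eval_map]
        conv_lhs => rw [← h3 Θ]
        exact eval₂_hom (h : E →+* E) _)
  refine ⟨q, ?_⟩
  rw [aeval_def, ← eval_map, hq, hQ]
  simpa using Lagrange.eval_interpolate_at_node (fun g : E ≃ₐ[F] E => g b) hinj
    (Finset.mem_univ 1)

variable [FiniteDimensional Ω L] [IsGalois Ω L]

theorem adjoin_eq_top_of_forall_fixed {y : L} (h : ∀ δ : L ≃ₐ[Ω] L, δ y = y → δ = 1) :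
    Algebra.adjoin Ω {y} = ⊤ := by
  have h1 : IntermediateField.adjoin Ω {y} = ⊤ := by
    rw [← IsGalois.fixedField_fixingSubgroup (IntermediateField.adjoin Ω {y})]
    have : (IntermediateField.adjoin Ω {y}).fixingSubgroup = ⊥ := by
      rw [eq_bot_iff]
      intro δ hδ
      rw [IntermediateField.mem_fixingSubgroup_iff] at hδ
      exact h δ (hδ y (IntermediateField.mem_adjoin_simple_self Ω y))
    rw [this, IntermediateField.fixedField_bot]
  have h2 := IntermediateField.adjoin_simple_toSubalgebra_of_isAlgebraic (F := Ω)
    (Algebra.IsAlgebraic.isAlgebraic (R := Ω) y)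
  rw [← h2, h1, IntermediateField.top_toSubalgebra]

theorem isReduced_and_exists_quotient
    (hic : ∀ y : F, IsIntegral A y → ∃ a, algebraMap A F a = y)
    (x : integralClosure A E →+* L)
    (hx : ∀ a, x (algebraMap A (integralClosure A E) a) = algebraMap Ω L (algebraMap A Ω a))
    (Θ : integralClosure A E)
    (hu : ∀ g : E ≃ₐ[F] E, g ≠ 1 → g (Θ : E) ≠ Θ ∧ IsIntegral A (g (Θ : E) - Θ)⁻¹)
    (hgen : ∀ δ : L ≃ₐ[Ω] L, δ (x Θ) = x Θ → δ = 1) :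
    IsReduced (Ω ⊗[A] (integralClosure A E)) ∧
      ∃ m : Ideal (Ω ⊗[A] (integralClosure A E)), m.IsMaximal ∧
        Nonempty (((Ω ⊗[A] (integralClosure A E)) ⧸ m) ≃ₐ[Ω] L) := by
  classical
  let conj : (E ≃ₐ[F] E) → (integralClosure A E) := fun g => ⟨g (Θ : E), isIntegral_apply g Θ.2⟩
  have hinjx : Function.Injective fun g => x (conj g) := by
    intro g g' h
    by_contra hne
    have h1 := hu (g'⁻¹ * g) fun h' => hne (inv_mul_eq_one.1 h').symm
    have h3 : ∀ z, g' ((g'⁻¹ * g) z) = g z := fun z => by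
      change g' (g'.symm (g z)) = g z
      simp
    have h4 : g (Θ : E) - g' Θ ≠ 0 := by
      rw [← h3, ← map_sub]
      exact (map_ne_zero g').2 (sub_ne_zero.2 h1.1)
    have h5 : IsIntegral A (g (Θ : E) - g' Θ)⁻¹ := by
      rw [← h3, ← map_sub, ← map_inv₀]
      exact isIntegral_apply g' h1.2
    have h6 : (conj g - conj g') * ⟨_, h5⟩ = 1 := Subtype.ext (mul_inv_cancel₀ h4)
    have h7 := congrArg x h6
    rw [map_mul, map_sub, map_one] at h7
    simp only at h
    rw [h, sub_self, zero_mul] at h7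
    exact zero_ne_one h7
  let Q : E[X] := ∏ g : E ≃ₐ[F] E, (X - C (g (Θ : E)))
  have hQmap : (∏ g : E ≃ₐ[F] E, (X - C (conj g))).map (algebraMap (integralClosure A E) E) = Q := by
    rw [Polynomial.map_prod]
    exact Finset.prod_congr rfl fun g _ => by simp [conj]
  obtain ⟨f, hf⟩ := exists_lift_of_invariant hic (Q := Q) (by
      intro n
      rw [← hQmap, coeff_map]
      exact (Subtype.prop (coeff (∏ g : E ≃ₐ[F] E, (X - C (conj g))) n))) (by
      intro h
      simp only [Q, Polynomial.map_prod, Polynomial.map_sub, map_X, map_C]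
      exact Fintype.prod_equiv (Equiv.mulLeft h) _ _ fun g => rfl)
  have hfB : f.map (algebraMap A (integralClosure A E)) = ∏ g : E ≃ₐ[F] E, (X - C (conj g)) := by
    apply Polynomial.map_injective (algebraMap (integralClosure A E) E) Subtype.val_injective
    rw [hQmap, ← hf, Polynomial.map_map]
    rfl
  have hfL : (f.map (algebraMap A Ω)).map (algebraMap Ω L) =
      ∏ g : E ≃ₐ[F] E, (X - C (x (conj g))) := by
    have h1 : (algebraMap Ω L).comp (algebraMap A Ω) = x.comp (algebraMap A (integralClosure A E)) :=
      RingHom.ext fun a => (hx a).symm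
    rw [Polynomial.map_map, h1, ← Polynomial.map_map, hfB, Polynomial.map_prod]
    simp
  have hsep : (f.map (algebraMap A Ω)).Separable := by
    rw [← Polynomial.separable_map (algebraMap Ω L), hfL]
    exact separable_prod_X_sub_C_iff.2 hinjx
  let Φ : Polynomial Ω →ₐ[Ω] Ω ⊗[A] (integralClosure A E) := aeval (1 ⊗ₜ[A] Θ)
  have hΦA : ∀ q : A[X], Φ (q.map (algebraMap A Ω)) = 1 ⊗ₜ[A] (aeval Θ q) := by
    intro q
    have : (1 : Ω) ⊗ₜ[A] (aeval Θ q) = aeval ((1 : Ω) ⊗ₜ[A] Θ) q :=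
      (aeval_algHom_apply
      (Algebra.TensorProduct.includeRight :
        (integralClosure A E) →ₐ[A] Ω ⊗[A] (integralClosure A E)) Θ q).symm
    rw [this]
    exact aeval_map_algebraMap Ω _ q
  have hΦf : Φ (f.map (algebraMap A Ω)) = 0 := by
    rw [hΦA]
    have : aeval Θ f = 0 := by
      rw [aeval_def, ← eval_map, hfB, eval_prod]
      refine Finset.prod_eq_zero (Finset.mem_univ 1) ?_
      simp [conj]
    rw [this, TensorProduct.tmul_zero]
  have hΦsurj : Function.Surjective Φ := by
    intro y
    induction y with
    | zero => exact ⟨0, map_zero _⟩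
    | add y z hy hz =>
      obtain ⟨p, rfl⟩ := hy
      obtain ⟨q, rfl⟩ := hz
      exact ⟨p + q, map_add _ _ _⟩
    | tmul c b =>
      obtain ⟨q, hq⟩ := exists_aeval_eq hic Θ.2 hu b.2
      refine ⟨C c * q.map (algebraMap A Ω), ?_⟩
      rw [map_mul, hΦA]
      have h1 : aeval Θ q = b := Subtype.ext (by
        rw [← hq]
        exact (aeval_algHom_apply (integralClosure A E).val Θ q).symm)
      rw [h1]
      simp [Φ, Algebra.TensorProduct.algebraMap_apply]
  refine ⟨⟨fun y hy => ?_⟩, ?_⟩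
  · obtain ⟨q, rfl⟩ := hΦsurj y
    obtain ⟨n, hn⟩ := hy
    obtain ⟨h, hh⟩ := (IsPrincipalIdealRing.principal (RingHom.ker Φ)).principal
    have hh' : ∀ p, Φ p = 0 ↔ h ∣ p := fun p => by
      rw [← RingHom.mem_ker, hh]
      exact Ideal.mem_span_singleton
    have hsq : Squarefree h := hsep.squarefree.squarefree_of_dvd ((hh' _).1 hΦf)
    rw [← map_pow, hh'] at hn
    exact (hh' _).2 (hsq.isRadical n q hn)
  · let _ : Algebra A L := ((algebraMap Ω L).comp (algebraMap A Ω)).toAlgebra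
    have : IsScalarTower A Ω L := IsScalarTower.of_algebraMap_eq fun _ => rfl
    let xA : (integralClosure A E) →ₐ[A] L := { x with commutes' := hx }
    let χ : Ω ⊗[A] (integralClosure A E) →ₐ[Ω] L := Algebra.TensorProduct.lift (Algebra.ofId Ω L) xA
      fun _ _ => Commute.all _ _
    have hχ : Function.Surjective χ := by
      rw [← AlgHom.range_eq_top, eq_top_iff, ← adjoin_eq_top_of_forall_fixed hgen,
        Algebra.adjoin_le_iff, Set.singleton_subset_iff]
      exact ⟨1 ⊗ₜ Θ, by simp [χ]; rfl⟩
    exact ⟨RingHom.ker χ, RingHom.ker_isMaximal_of_surjective χ.toRingHom hχ,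
      ⟨Ideal.quotientKerAlgEquivOfSurjective hχ⟩⟩

end Core

section FreeActions

variable {D X Y : Type*} [Group D] [MulAction D X] [MulAction D Y]

theorem exists_bijective_of_free (hX : ∀ (d : D) (x : X), d • x = x → d = 1) :
    ∃ s : MulAction.orbitRel.Quotient D X → X,
      Function.Bijective fun p : MulAction.orbitRel.Quotient D X × D => p.2 • s p.1 := by
  refine ⟨Quotient.out, ?_, ?_⟩
  · rintro ⟨o, d⟩ ⟨o', d'⟩ h
    have h1 : o = o' := by
      have : (Quotient.mk'' (d • o.out) : MulAction.orbitRel.Quotient D X)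
          = Quotient.mk'' (d' • o'.out) := congrArg _ h
      simpa [MulAction.Quotient.mk_smul_out] using this
    subst h1
    have h2 : (d'⁻¹ * d) • o.out = o.out := by
      rw [mul_smul]; exact inv_smul_eq_iff.2 h
    exact Prod.ext rfl (inv_mul_eq_one.1 (hX _ _ h2)).symm
  · intro x
    have : MulAction.orbitRel D X (Quotient.out (Quotient.mk'' x :
        MulAction.orbitRel.Quotient D X)) x := Quotient.exact (Quotient.out_eq _)
    obtain ⟨d, hd⟩ := (MulAction.orbitRel D X).symm this
    exact ⟨(Quotient.mk'' x, d), hd⟩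

theorem exists_equiv_of_free [Finite X] [Finite Y] [Finite D] (hcard : Nat.card X = Nat.card Y)
    (hX : ∀ (d : D) (x : X), d • x = x → d = 1) (hY : ∀ (d : D) (y : Y), d • y = y → d = 1) :
    ∃ e : X ≃ Y, ∀ (d : D) (x : X), e (d • x) = d • e x := by
  obtain ⟨s, hs⟩ := exists_bijective_of_free hX
  obtain ⟨t, ht⟩ := exists_bijective_of_free hY
  have h1 : Nat.card (MulAction.orbitRel.Quotient D X) =
      Nat.card (MulAction.orbitRel.Quotient D Y) := by
    have a := Nat.card_congr (Equiv.ofBijective _ hs)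
    have b := Nat.card_congr (Equiv.ofBijective _ ht)
    rw [Nat.card_prod] at a b
    exact Nat.eq_of_mul_eq_mul_right (Nat.card_pos (α := D)) (a.trans (hcard.trans b.symm))
  have e0 : MulAction.orbitRel.Quotient D X ≃ MulAction.orbitRel.Quotient D Y :=
    ((Finite.equivFin _).trans (finCongr h1)).trans (Finite.equivFin _).symm
  let u := Equiv.ofBijective _ hs
  let w := Equiv.ofBijective _ ht
  refine ⟨u.symm.trans ((Equiv.prodCongr e0 (Equiv.refl D)).trans w), fun d x => ?_⟩
  obtain ⟨⟨o, c⟩, rfl⟩ := u.surjective x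
  have hu : d • u (o, c) = u (o, d * c) := (mul_smul d c (s o)).symm
  rw [hu]
  simp only [Equiv.trans_apply, Equiv.symm_apply_apply]
  exact mul_smul d c (t (e0 o))

end FreeActions

section Criterion

variable {K F₀ E Ω L : Type} [Field K] [Field F₀] [Field E] [Field Ω] [Field L]
  [Algebra K F₀] [Algebra F₀ E] [Algebra K Ω] [Algebra Ω L]

/-- Relabel the roots in `L` so that the Galois action becomes the restriction of the action
of `G` on the index set. -/
theorem exists_equivariant_relabel {ι : Type} [Finite ι] {G : Type} [Group G] [MulAction G ι]
    [FiniteDimensional Ω L]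
    (hG : ∀ (g : G) (i : ι), g • i = i → g = 1)
    (f : (L ≃ₐ[Ω] L) →* G) (hf : Function.Injective f) (β : ι → L) (hβ : Function.Injective β)
    (hD : ∀ (δ : L ≃ₐ[Ω] L) (i : ι), δ (β i) = β i → δ = 1)
    (hst : ∀ (δ : L ≃ₐ[Ω] L) (i : ι), δ (β i) ∈ Set.range β) :
    ∃ e : ι ≃ ι, ∀ (δ : L ≃ₐ[Ω] L) (i : ι), δ (β (e i)) = β (e (f δ • i)) := by
  let _ : MulAction (L ≃ₐ[Ω] L) ι := MulAction.compHom ι f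
  let _ : MulAction (L ≃ₐ[Ω] L) (Set.range β) :=
    { smul := fun δ y => ⟨δ y, by obtain ⟨_, i, rfl⟩ := y; exact hst δ i⟩
      one_smul := fun y => Subtype.ext rfl
      mul_smul := fun δ δ' y => Subtype.ext rfl }
  obtain ⟨e, he⟩ := exists_equiv_of_free (D := L ≃ₐ[Ω] L) (X := ι) (Y := Set.range β)
    (Nat.card_congr (Equiv.ofInjective β hβ))
    (fun d i h => hf (by rw [map_one]; exact hG _ i h))
    (by
      rintro d ⟨_, i, rfl⟩ h
      exact hD d i (congrArg Subtype.val h))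
  have hb : ∀ i, β ((Equiv.ofInjective β hβ).symm (e i)) = e i := fun i =>
    Equiv.apply_ofInjective_symm hβ (e i)
  refine ⟨e.trans (Equiv.ofInjective β hβ).symm, fun δ i => ?_⟩
  simp only [Equiv.trans_apply]
  rw [hb, hb]
  exact (congrArg Subtype.val (he δ i)).symm

/-- Sufficient conditions for `IsSpecialization`, avoiding all derived instances. -/
theorem isSpecialization_of_subring {K F E Ω L : Type} [Field K] [Field F] [Field E] [Field Ω]
    [Field L] [Algebra K F] [Algebra F E] [Algebra K Ω] [Algebra Ω L]
    [FiniteDimensional F E] [IsGalois F E] [FiniteDimensional Ω L] [IsGalois Ω L]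
    (A : Subalgebra K F) (hFG : A.FG) (hic : ∀ x : F, IsIntegral A x → x ∈ A)
    (hfr : IsFractionRing A F) (B : Subring E)
    (hB : ∀ b : E, ((algebraMap F E).comp (algebraMap A F)).IsIntegralElem b ↔ b ∈ B)
    (x : B →+* L)
    (hxΩ : ∀ b : B, (∃ y : F, algebraMap F E y = b) → ∃ w : Ω, algebraMap Ω L w = x b)
    (hxK : ∀ (b : B) (c : K), algebraMap F E (algebraMap K F c) = b →
      x b = algebraMap Ω L (algebraMap K Ω c))
    (Θ : B) (hu : ∀ g : E ≃ₐ[F] E, g ≠ 1 → g (Θ : E) ≠ Θ ∧ (g (Θ : E) - Θ)⁻¹ ∈ B)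
    (hgen : ∀ δ : L ≃ₐ[Ω] L, δ (x Θ) = x Θ → δ = 1) :
    IsSpecialization K F E Ω L := by
  have hmem : ∀ a : A, algebraMap F E a ∈ B := fun a =>
    (hB _).1 (((algebraMap F E).comp (algebraMap A F)).isIntegralElem_map (x := a))
  have h1 : ∀ a : A, ∃ w : Ω, algebraMap Ω L w = x ⟨_, hmem a⟩ := fun a => hxΩ _ ⟨a, rfl⟩
  choose ψ hψ using h1
  have hinj := (algebraMap Ω L).injective
  let ψ' : A →ₐ[K] Ω :=
    { toFun := ψ
      map_one' := hinj (by
        rw [hψ, map_one, ← map_one x]; exact congrArg x (Subtype.ext (map_one _)))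
      map_mul' := fun a b => hinj (by
        rw [hψ, map_mul, hψ, hψ, ← map_mul x]; exact congrArg x (Subtype.ext (map_mul _ _ _)))
      map_zero' := hinj (by
        rw [hψ, map_zero, ← map_zero x]; exact congrArg x (Subtype.ext (map_zero _)))
      map_add' := fun a b => hinj (by
        rw [hψ, map_add, hψ, hψ, ← map_add x]; exact congrArg x (Subtype.ext (map_add _ _ _)))
      commutes' := fun c => hinj (by rw [hψ]; exact hxK _ c rfl) }
  refine ⟨A, hFG, hic, hfr, ψ', ?_⟩
  let i1 : Algebra A E := ((algebraMap F E).comp (algebraMap A F)).toAlgebra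
  let i2 : Algebra A Ω := ψ'.toRingHom.toAlgebra
  have i3 : @IsScalarTower A F E _ _ i1.toSMul := @IsScalarTower.of_algebraMap_eq' A F E _ _ _ _ _ i1 rfl
  have hB' : ∀ b : E, b ∈ @integralClosure A E _ _ i1 ↔ b ∈ B := hB
  let x' : @integralClosure A E _ _ i1 →+* L :=
    { toFun := fun b => x ⟨b, (hB' _).1 b.2⟩
      map_one' := map_one x
      map_mul' := fun a b => map_mul x ⟨a, (hB' _).1 a.2⟩ ⟨b, (hB' _).1 b.2⟩
      map_zero' := map_zero x
      map_add' := fun a b => map_add x ⟨a, (hB' _).1 a.2⟩ ⟨b, (hB' _).1 b.2⟩ }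
  exact @isReduced_and_exists_quotient A F E Ω L _ _ _ _ _ _ _ i1 i3 i2 _ _ _ _ _
    (fun y hy => ⟨⟨y, hic y hy⟩, rfl⟩) x' (fun a => (hψ a).symm) ⟨Θ, (hB' _).2 Θ.2⟩
    (fun g hg => ⟨(hu g hg).1, (hB' _).2 (hu g hg).2⟩) hgen

theorem exists_perm_of_roots {A B D : Type} [CommRing A] [CommRing B] [CommRing D] [IsDomain D]
    [Algebra A B] {ι : Type} [Fintype ι] (r : ι → B) (P : Polynomial A)
    (hP : P.map (algebraMap A B) = ∏ i, (X - C (r i))) (x : B →+* D)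
    (β : ι → D) (hβ : Function.Injective β)
    (hroot : ∀ i, P.eval₂ (x.comp (algebraMap A B)) (β i) = 0) :
    ∃ σ : Equiv.Perm ι, ∀ i, x (r (σ i)) = β i := by
  classical
  have h1 : ∀ i, ∃ k, x (r k) = β i := by
    intro i
    have h2 := hroot i
    rw [← eval₂_map, hP, eval₂_finsetProd, Finset.prod_eq_zero_iff] at h2
    obtain ⟨k, _, hk⟩ := h2
    refine ⟨k, (sub_eq_zero.1 ?_).symm⟩
    rw [← hk]; simp
  choose k hk using h1
  have hkinj : Function.Injective k := fun a b h => hβ (by rw [← hk, ← hk, h])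
  exact ⟨Equiv.ofBijective k (Finite.injective_iff_bijective.1 hkinj), hk⟩

variable {A : Type} [CommRing A] [Algebra A F₀] [Algebra A E] [IsScalarTower A F₀ E] [Algebra A Ω]

theorem map_integralClosure_eq {ι : Type} [Fintype ι] (r : ι → E) (hr : ∀ i, IsIntegral A (r i))
    (P : Polynomial A) (hP : P.map (algebraMap A E) = ∏ i, (X - C (r i))) :
    P.map (algebraMap A (integralClosure A E)) =
      ∏ i, (X - C (⟨r i, hr i⟩ : integralClosure A E)) := by
  have hv : Function.Injective (integralClosure A E).val.toRingHom := Subtype.val_injective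
  apply Polynomial.map_injective _ hv
  rw [Polynomial.map_map, Polynomial.map_prod]
  simpa using hP

/-- The homomorphism `integralClosure A E → L` sending the roots to prescribed roots. -/
theorem exists_hom_of_roots (hinj : Function.Injective (algebraMap A E))
    {ι : Type} [Fintype ι] (r : ι → E) (P : Polynomial A)
    (hP : P.map (algebraMap A E) = ∏ i, (X - C (r i)))
    (hfull : ∀ π : Equiv.Perm ι, ∃ g : E ≃ₐ[F₀] E, ∀ i, g (r i) = r (π i))
    (hgen : ∀ b : E, IsIntegral A b → b ∈ Algebra.adjoin A (Set.range r))
    (hr : ∀ i, IsIntegral A (r i))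
    (β : ι → L) (hβ : Function.Injective β)
    (hroot : ∀ i, P.eval₂ ((algebraMap Ω L).comp (algebraMap A Ω)) (β i) = 0) :
    ∃ x : integralClosure A E →+* L,
      (∀ a, x (algebraMap A (integralClosure A E) a) = algebraMap Ω L (algebraMap A Ω a)) ∧
      ∀ i, x ⟨r i, hr i⟩ = β i := by
  classical
  let j : L →+* AlgebraicClosure L := algebraMap L (AlgebraicClosure L)
  have hinj' : Function.Injective (algebraMap A (integralClosure A E)) := fun a b h =>
    hinj (congrArg Subtype.val h)
  obtain ⟨x0, hx0⟩ := exists_extension_of_isIntegral hinj'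
    (j.comp ((algebraMap Ω L).comp (algebraMap A Ω)))
  let r' : ι → integralClosure A E := fun i => ⟨r i, hr i⟩
  have hP' := map_integralClosure_eq r hr P hP
  have hx0c : x0.comp (algebraMap A (integralClosure A E)) =
      j.comp ((algebraMap Ω L).comp (algebraMap A Ω)) := RingHom.ext hx0
  obtain ⟨σ, hσ⟩ := exists_perm_of_roots r' P hP' x0 (fun i => j (β i))
    (j.injective.comp hβ) fun i => by rw [hx0c, ← hom_eval₂, hroot, map_zero]
  obtain ⟨g, hg⟩ := hfull σ
  let x1 : integralClosure A E →+* AlgebraicClosure L :=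
    x0.comp ((g.restrictScalars A).mapIntegralClosure : integralClosure A E →+* integralClosure A E)
  have hx1r : ∀ i, x1 (r' i) = j (β i) := by
    intro i
    rw [← hσ]
    exact congrArg x0 (Subtype.ext (hg i))
  have hx1a : ∀ a, x1 (algebraMap A (integralClosure A E) a) =
      j (algebraMap Ω L (algebraMap A Ω a)) := by
    intro a
    rw [show j (algebraMap Ω L (algebraMap A Ω a)) = x0 (algebraMap A _ a) from (hx0 a).symm]
    exact congrArg x0 ((g.restrictScalars A).mapIntegralClosure.commutes a)
  have hmem : ∀ b : integralClosure A E, x1 b ∈ j.range := by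
    intro b
    have : ∀ c ∈ Algebra.adjoin A (Set.range r), ∃ h : IsIntegral A c, x1 ⟨c, h⟩ ∈ j.range := by
      intro c hc
      induction hc using Algebra.adjoin_induction with
      | mem y hy =>
        obtain ⟨i, rfl⟩ := hy
        exact ⟨hr i, β i, (hx1r i).symm⟩
      | algebraMap a => exact ⟨isIntegral_algebraMap, _, (hx1a a).symm⟩
      | add y z _ _ hy hz =>
        obtain ⟨a, ha⟩ := hy
        obtain ⟨b, hb⟩ := hz
        refine ⟨a.add b, ?_⟩
        have := j.range.add_mem ha hb
        rwa [← map_add] at this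
      | mul y z _ _ hy hz =>
        obtain ⟨a, ha⟩ := hy
        obtain ⟨b, hb⟩ := hz
        refine ⟨a.mul b, ?_⟩
        have := j.range.mul_mem ha hb
        rwa [← map_mul] at this
    exact (this b (hgen b b.2)).2
  let e : L ≃+* j.range := RingEquiv.ofLeftInverse (f := j)
    (g := Function.invFun j) (Function.leftInverse_invFun j.injective)
  refine ⟨(e.symm : j.range →+* L).comp (x1.codRestrict j.range hmem), fun a => ?_, fun i => ?_⟩
  · refine e.injective (Subtype.ext ?_)
    simp only [RingHom.comp_apply, RingHom.coe_coe, RingEquiv.apply_symm_apply]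
    exact hx1a a
  · refine e.injective (Subtype.ext ?_)
    simp only [RingHom.comp_apply, RingHom.coe_coe, RingEquiv.apply_symm_apply]
    exact hx1r i

/-- If the Galois group `D` of `L/Ω` acts freely on the roots of a specialization of `P`, and
`D` embeds into a group `G` acting freely on the index set of the roots, then `L/Ω` is a
specialization of `E` over the fixed field of `G`. -/
theorem isSpecialization_of_roots [Algebra K A] [Algebra K E] [IsScalarTower K A F₀]
    [IsScalarTower K F₀ E] [IsScalarTower K A Ω]
    [IsDomain A] [Algebra.FiniteType K A] [IsFractionRing A F₀] [CharZero F₀]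
    [FiniteDimensional F₀ E] [IsGalois F₀ E] [FiniteDimensional Ω L] [IsGalois Ω L]
    [IsIntegrallyClosed A]
    {ι : Type} [Fintype ι] [Nonempty ι] (r : ι → E) (P : Polynomial A)
    (hP : P.map (algebraMap A E) = ∏ i, (X - C (r i)))
    (hfull : ∀ π : Equiv.Perm ι, ∃ g : E ≃ₐ[F₀] E, ∀ i, g (r i) = r (π i))
    (hr : ∀ i, IsIntegral A (r i)) (Θ : E) (hΘ : Θ ∈ Algebra.adjoin A (Set.range r))
    (hu : ∀ g : E ≃ₐ[F₀] E, g ≠ 1 → g Θ ≠ Θ ∧ IsIntegral A (g Θ - Θ)⁻¹)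
    (β : ι → L) (hβ : Function.Injective β)
    (hroot : ∀ i, P.eval₂ ((algebraMap Ω L).comp (algebraMap A Ω)) (β i) = 0)
    (hD : ∀ (δ : L ≃ₐ[Ω] L) (i : ι), δ (β i) = β i → δ = 1)
    (hst : ∀ (δ : L ≃ₐ[Ω] L) (i : ι), δ (β i) ∈ Set.range β)
    {G : Type} [Group G] [MulAction G ι] (hG : ∀ (g : G) (i : ι), g • i = i → g = 1)
    (j : G →* (E ≃ₐ[F₀] E)) (hj : ∀ g i, j g (r i) = r (g • i))
    (f : (L ≃ₐ[Ω] L) →* G) (hf : Function.Injective f) :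
    IsSpecialization K (IntermediateField.fixedField j.range) E Ω L := by
  classical
  have hinj : Function.Injective (algebraMap A E) := by
    rw [IsScalarTower.algebraMap_eq A F₀ E]
    exact (algebraMap F₀ E).injective.comp (IsFractionRing.injective A F₀)
  have hic : ∀ y : F₀, IsIntegral A y → ∃ a, algebraMap A F₀ a = y := fun y hy =>
    IsIntegrallyClosed.isIntegral_iff.1 hy
  have hadj : ∀ y ∈ Algebra.adjoin A (Set.range r), IsIntegral A y := fun y hy =>
    Algebra.adjoin_le (S := integralClosure A E) (by rintro _ ⟨i, rfl⟩; exact hr i) hy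
  have hgen : ∀ b : E, IsIntegral A b → b ∈ Algebra.adjoin A (Set.range r) := by
    intro b hb
    obtain ⟨q, rfl⟩ := exists_aeval_eq hic (hadj Θ hΘ) hu hb
    exact Algebra.adjoin_le (S := Algebra.adjoin A (Set.range r))
      (Set.singleton_subset_iff.2 hΘ) (aeval_mem_adjoin_singleton A Θ)
  obtain ⟨e, he⟩ := exists_equivariant_relabel hG f hf β hβ hD hst
  have ⟨x, hxa, hxr⟩ := exists_hom_of_roots (F₀ := F₀) (Ω := Ω) hinj r P hP hfull hgen hr
    (fun i => β (e i)) (hβ.comp e.injective) fun i => hroot _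
  -- equivariance
  have heq : ∀ (δ : L ≃ₐ[Ω] L) (b : E) (hb : IsIntegral A b),
      δ (x ⟨b, hb⟩) = x ⟨j (f δ) b, isIntegral_apply _ hb⟩ := by
    intro δ b hb
    have : ∀ c ∈ Algebra.adjoin A (Set.range r), ∃ h : IsIntegral A c,
        δ (x ⟨c, h⟩) = x ⟨j (f δ) c, isIntegral_apply _ h⟩ := by
      intro c hc
      induction hc using Algebra.adjoin_induction with
      | mem y hy =>
        obtain ⟨i, rfl⟩ := hy
        refine ⟨hr i, ?_⟩
        rw [hxr, he, ← hxr]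
        exact congrArg x (Subtype.ext (hj _ _).symm)
      | algebraMap a =>
        refine ⟨isIntegral_algebraMap, ?_⟩
        have h1 : (⟨algebraMap A E a, isIntegral_algebraMap⟩ : integralClosure A E) =
          algebraMap A _ a := rfl
        have h2 : (⟨j (f δ) (algebraMap A E a), isIntegral_apply _ isIntegral_algebraMap⟩ :
            integralClosure A E) = algebraMap A _ a :=
          Subtype.ext (((j (f δ)).restrictScalars A).commutes a)
        rw [h1, h2, hxa, δ.commutes]
      | add y z _ _ hy hz =>
        obtain ⟨a, ha⟩ := hy
        obtain ⟨b, hb⟩ := hz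
        refine ⟨a.add b, ?_⟩
        have := congrArg₂ (· + ·) ha hb
        simp only [← map_add] at this
        refine this.trans (congrArg x (Subtype.ext ?_))
        exact (map_add _ _ _).symm
      | mul y z _ _ hy hz =>
        obtain ⟨a, ha⟩ := hy
        obtain ⟨b, hb⟩ := hz
        refine ⟨a.mul b, ?_⟩
        have := congrArg₂ (· * ·) ha hb
        simp only [← map_mul] at this
        refine this.trans (congrArg x (Subtype.ext ?_))
        exact (map_mul _ _ _).symm
    exact (this b (hgen b hb)).2
  set F := IntermediateField.fixedField j.range with hF
  have hfix : ∀ (y : F) (g : G), j g (y : E) = y := fun y g => y.2 ⟨j g, g, rfl⟩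
  have hΩ : ∀ (y : F) (hy : IsIntegral A (y : E)), ∃ w : Ω, algebraMap Ω L w = x ⟨y, hy⟩ := by
    intro y hy
    have := (IsGalois.mem_bot_iff_fixed (F := Ω) (E := L) (x ⟨y, hy⟩)).2 fun δ => by
      rw [heq]
      exact congrArg x (Subtype.ext (hfix y _))
    exact this
  have t1 : IsScalarTower A F E := IsScalarTower.of_algebraMap_eq fun a => rfl
  have t2 : IsScalarTower A F₀ F := IsScalarTower.of_algebraMap_eq fun a =>
    Subtype.ext (IsScalarTower.algebraMap_apply A F₀ E a)
  have t3 : IsScalarTower K A F := IsScalarTower.of_algebraMap_eq fun a => Subtype.ext (by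
    have h1 : ((algebraMap K F a : F) : E) = algebraMap F₀ E (algebraMap K F₀ a) :=
      IsScalarTower.algebraMap_apply K F₀ E a
    rw [h1, IsScalarTower.algebraMap_apply K A F₀ a, ← IsScalarTower.algebraMap_apply A F₀ E]
    rfl)
  have hAE : ∀ y : F, IsIntegral A (y : E) ↔ IsIntegral A y := fun y =>
    isIntegral_algebraMap_iff (algebraMap F E).injective
  have hN : IsNoetherianRing A := Algebra.FiniteType.isNoetherianRing K A
  have hfrA : IsFractionRing (integralClosure A F) F :=
    integralClosure.isFractionRing_of_finite_extension (A := A) F₀ F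
  have hfin : Module.Finite A (integralClosure A F) :=
    IsIntegralClosure.finite A F₀ F (integralClosure A F)
  have hft : Algebra.FiniteType K (integralClosure A F) :=
    Algebra.FiniteType.trans (S := A) inferInstance inferInstance
  let A1 : Subalgebra K F := (integralClosure A F).restrictScalars K
  refine isSpecialization_of_subring A1 ((Subalgebra.fg_iff_finiteType A1).2 hft) ?_ hfrA
    (integralClosure A E).toSubring ?_ x ?_ ?_ ⟨Θ, hadj Θ hΘ⟩ ?_ ?_
  · intro y hy
    have hy' : IsIntegral (integralClosure A F) y := hy
    exact isIntegral_trans (R := A) y hy'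
  · intro b
    have i2 : IsScalarTower A (integralClosure A F) E := IsScalarTower.of_algebraMap_eq fun a => rfl
    constructor
    · intro hb
      have hb' : IsIntegral (integralClosure A F) b := hb
      exact isIntegral_trans (R := A) b hb'
    · intro hb
      have hb' : IsIntegral A b := hb
      exact (hb'.tower_top : IsIntegral (integralClosure A F) b)
  · rintro b ⟨y, hy⟩
    obtain ⟨w, hw⟩ := hΩ y (by rw [show (y : E) = b from hy]; exact b.2)
    exact ⟨w, hw.trans (congrArg x (Subtype.ext hy))⟩
  · intro b c hbc
    have : b = algebraMap A (integralClosure A E) (algebraMap K A c) := Subtype.ext (by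
      rw [← hbc, IsScalarTower.algebraMap_apply K A F c, ← IsScalarTower.algebraMap_apply A F E]
      rfl)
    rw [this]
    exact (hxa _).trans (by rw [← IsScalarTower.algebraMap_apply K A Ω])
  · intro g hg
    exact hu (g.restrictScalars F₀) fun h => hg (AlgEquiv.ext fun z => DFunLike.congr_fun h z)
  · intro δ hδ
    by_contra hne
    obtain ⟨i⟩ := ‹Nonempty ι›
    have h1 : j (f δ) ≠ 1 := by
      intro h
      have h2 : f δ • i = i := by
        refine e.injective (hβ ?_)
        rw [← hxr, ← hxr]
        refine congrArg x (Subtype.ext ?_)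
        change r (f δ • i) = r i
        rw [← hj, h, AlgEquiv.one_apply]
      exact hne (hf (by rw [hG _ _ h2, map_one]))
    obtain ⟨h3, h4⟩ := hu _ h1
    have h5 : IsIntegral A (j (f δ) Θ) := isIntegral_apply _ (hadj Θ hΘ)
    have h6 : x (⟨_, h5⟩ - ⟨Θ, hadj Θ hΘ⟩) = 0 := by
      rw [map_sub, ← heq δ Θ (hadj Θ hΘ), sub_eq_zero]
      exact hδ
    have h7 : ((⟨_, h5⟩ - ⟨Θ, hadj Θ hΘ⟩) * ⟨_, h4⟩ : integralClosure A E) = 1 :=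
      Subtype.ext (mul_inv_cancel₀ (sub_ne_zero.2 h3))
    have h8 := congrArg x h7
    rw [map_mul, h6, zero_mul, map_one] at h8
    exact zero_ne_one h8

end Criterion

/-- Finitely many nonzero vectors are avoided by a single linear form with natural
coefficients. -/
theorem exists_nat_sum_ne_zero {κ ι D : Type} [Finite κ] [Fintype ι] [Field D] [CharZero D]
    (w : κ → ι → D) (hw : ∀ k, w k ≠ 0) : ∃ c : ι → ℕ, ∀ k, ∑ i, (c i : D) * w k i ≠ 0 := by
  classical
  cases nonempty_fintype κ
  let e := Fintype.equivFin ι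
  let p : κ → Polynomial D := fun k => ∑ i, C (w k i) * X ^ (e i : ℕ)
  have hp : ∀ k, p k ≠ 0 := by
    intro k h
    obtain ⟨i, hi⟩ := Function.ne_iff.1 (hw k)
    apply hi
    have h1 : (p k).coeff (e i) = w k i := by
      simp only [p, finsetSum_coeff, coeff_C_mul, coeff_X_pow, mul_ite, mul_one, mul_zero]
      rw [Finset.sum_eq_single i]
      · simp
      · intro b _ hb
        rw [if_neg]
        intro h'
        exact hb (e.injective (Fin.ext h'.symm))
      · simp
    rw [← h1, h]; simp
  have hprod : (∏ k, p k) ≠ 0 := Finset.prod_ne_zero_iff.2 fun k _ => hp k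
  have hfin : {x : D | (∏ k, p k).IsRoot x}.Finite := Polynomial.finite_setOfPred_isRoot hprod
  obtain ⟨n, hn⟩ := (hfin.preimage (Nat.cast_injective (R := D)).injOn).exists_notMem
  refine ⟨fun i => n ^ (e i : ℕ), fun k h => hn ?_⟩
  simp only [Set.mem_preimage, Set.mem_ofPred_eq, IsRoot.def, eval_prod]
  refine Finset.prod_eq_zero (Finset.mem_univ k) ?_
  simp only [p, eval_finsetSum, eval_mul, eval_C, eval_pow, eval_X]
  rw [← h]
  exact Finset.sum_congr rfl fun i _ => by push_cast; ring

section Point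

variable {F₀ E Ω L R : Type} [Field F₀] [Field E] [Field Ω] [Field L] [CommRing R]
  [Algebra R F₀] [Algebra F₀ E] [Algebra R E] [Algebra Ω L] [Algebra R Ω]
  [IsScalarTower R F₀ E]

theorem exists_root_eq_apply {ι : Type} [Fintype ι] (r : ι → E) (P : Polynomial R)
    (hP : P.map (algebraMap R E) = ∏ i, (X - C (r i))) (g : E ≃ₐ[F₀] E) (i : ι) :
    ∃ k, r k = g (r i) := by
  have h3 : (P.map (algebraMap R E)).eval (g (r i)) = 0 := by
    have h2 : (P.map (algebraMap R E)).eval (r i) = 0 := by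
      rw [hP, eval_prod]; exact Finset.prod_eq_zero (Finset.mem_univ i) (by simp)
    rw [eval_map_algebraMap] at h2 ⊢
    have := congrArg (g.restrictScalars R) h2
    rwa [map_zero, ← AlgEquiv.coe_toAlgHom, ← aeval_algHom_apply] at this
  rw [hP, eval_prod, Finset.prod_eq_zero_iff] at h3
  obtain ⟨j, _, hj⟩ := h3
  exact ⟨j, (sub_eq_zero.1 (by simpa using hj)).symm⟩

variable [IsIntegrallyClosed R] [IsFractionRing R F₀] [FiniteDimensional F₀ E] [IsGalois F₀ E]

theorem exists_primitive_and_discriminant [CharZero L] {ι : Type} [Fintype ι]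
    (r : ι → E) (hr : ∀ i, IsIntegral R (r i)) (hadj : Algebra.adjoin F₀ (Set.range r) = ⊤)
    (P : Polynomial R) (hP : P.map (algebraMap R E) = ∏ i, (X - C (r i)))
    (β : ι → L) (hβ : Function.Injective β)
    (hroot : ∀ i, P.eval₂ ((algebraMap Ω L).comp (algebraMap R Ω)) (β i) = 0) :
    ∃ Θ ∈ Algebra.adjoin R (Set.range r), ∃ Δ : R, algebraMap R Ω Δ ≠ 0 ∧
      ∀ g : E ≃ₐ[F₀] E, g ≠ 1 → g Θ ≠ Θ ∧ ∃ u, IsIntegral R u ∧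
        (g Θ - Θ) * u = algebraMap R E Δ := by
  classical
  let D := AlgebraicClosure L
  let j : L →+* D := algebraMap L D
  have hinj : Function.Injective (algebraMap R E) := by
    rw [IsScalarTower.algebraMap_eq R F₀ E]
    exact (algebraMap F₀ E).injective.comp (IsFractionRing.injective R F₀)
  let B := integralClosure R E
  have hinj' : Function.Injective (algebraMap R (integralClosure R E)) := fun a b h =>
    hinj (congrArg Subtype.val h)
  obtain ⟨x, hx⟩ := exists_extension_of_isIntegral hinj'
    (j.comp ((algebraMap Ω L).comp (algebraMap R Ω)))
  let r' : ι → integralClosure R E := fun i => ⟨r i, hr i⟩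
  have hP' := map_integralClosure_eq r hr P hP
  have hxc : x.comp (algebraMap R (integralClosure R E)) =
      j.comp ((algebraMap Ω L).comp (algebraMap R Ω)) := RingHom.ext hx
  obtain ⟨σ, hσ⟩ := exists_perm_of_roots r' P hP' x (fun i => j (β i))
    (j.injective.comp hβ) fun i => by rw [hxc, ← hom_eval₂, hroot, map_zero]
  have hxr : Function.Injective fun i => x (r' i) := by
    intro i k h
    have h1 := hσ (σ.symm i)
    have h2 := hσ (σ.symm k)
    rw [Equiv.apply_symm_apply] at h1 h2
    have := (j.injective.comp hβ) (h1.symm.trans (Eq.trans h h2))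
    exact σ.symm.injective this
  have hperm : ∀ (g : E ≃ₐ[F₀] E) (i : ι), ∃ k, r k = g (r i) := exists_root_eq_apply r P hP
  choose s hs using hperm
  obtain ⟨c, hc⟩ := exists_nat_sum_ne_zero (κ := {p : (E ≃ₐ[F₀] E) × (E ≃ₐ[F₀] E) // p.1 ≠ p.2})
    (fun p i => x (r' (s p.1.1 i)) - x (r' (s p.1.2 i))) (by
      rintro ⟨⟨g, h⟩, hne⟩ h0
      apply hne
      have h1 : ∀ i, g (r i) = h (r i) := by
        intro i
        rw [← hs, ← hs, hxr (sub_eq_zero.1 (congrFun h0 i))]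
      have h2 := AlgHom.ext_of_adjoin_eq_top hadj (φ₁ := g.toAlgHom) (φ₂ := h.toAlgHom)
        (by rintro _ ⟨i, rfl⟩; exact h1 i)
      exact AlgEquiv.ext fun z => DFunLike.congr_fun h2 z)
  let Θ : E := ∑ i, (c i : E) * r i
  have hΘadj : Θ ∈ Algebra.adjoin R (Set.range r) :=
    Subalgebra.sum_mem _ fun i _ => Subalgebra.mul_mem _ (natCast_mem _ _)
      (Algebra.subset_adjoin ⟨i, rfl⟩)
  have hgΘ : ∀ g : E ≃ₐ[F₀] E, g Θ = ∑ i, (c i : E) * r (s g i) := by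
    intro g
    simp only [Θ, map_sum, map_mul, map_natCast, hs]
  let θ : (E ≃ₐ[F₀] E) → integralClosure R E := fun g => ∑ i, (c i : integralClosure R E) * r' (s g i)
  have hθ : ∀ g, (θ g : E) = g Θ := by
    intro g
    rw [hgΘ]
    simp [θ, r']
  have hxθ : ∀ g h, g ≠ h → x (θ g - θ h) ≠ 0 := by
    intro g h hne
    have := hc ⟨(g, h), hne⟩
    convert this using 1
    simp [θ, mul_sub]
  let Δ : integralClosure R E := ∏ p : {p : (E ≃ₐ[F₀] E) × (E ≃ₐ[F₀] E) // p.1 ≠ p.2},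
    (θ p.1.1 - θ p.1.2)
  have hxΔ : x Δ ≠ 0 := by
    rw [map_prod]
    exact Finset.prod_ne_zero_iff.2 fun p _ => hxθ _ _ p.2
  have hΔfix : ∀ g : E ≃ₐ[F₀] E, g (Δ : E) = Δ := by
    intro g
    let e : {p : (E ≃ₐ[F₀] E) × (E ≃ₐ[F₀] E) // p.1 ≠ p.2} ≃
        {p : (E ≃ₐ[F₀] E) × (E ≃ₐ[F₀] E) // p.1 ≠ p.2} :=
      (Equiv.prodCongr (Equiv.mulLeft g) (Equiv.mulLeft g)).subtypeEquiv fun p => by simp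
    have h1 : ∀ p : (integralClosure R E), (p : E) = (integralClosure R E).val p := fun _ => rfl
    rw [h1, map_prod, map_prod]
    refine Fintype.prod_equiv e _ _ fun p => ?_
    rw [← h1, ← h1, AddSubgroupClass.coe_sub, AddSubgroupClass.coe_sub, hθ, hθ, hθ, hθ, map_sub]
    rfl
  obtain ⟨y, hy⟩ := (IsGalois.mem_bot_iff_fixed (F := F₀) (E := E) (Δ : E)).2 hΔfix
  have hyint : IsIntegral R y := by
    rw [← isIntegral_algebraMap_iff (algebraMap F₀ E).injective]
    have : algebraMap F₀ E y = Δ := hy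
    rw [this]; exact Δ.2
  obtain ⟨Δ0, rfl⟩ := IsIntegrallyClosed.isIntegral_iff.1 hyint
  have hΔ0 : algebraMap R (integralClosure R E) Δ0 = Δ := Subtype.ext (by
    rw [← hy]; exact IsScalarTower.algebraMap_apply R F₀ E Δ0)
  refine ⟨Θ, hΘadj, Δ0, ?_, fun g hg => ?_⟩
  · intro h
    apply hxΔ
    rw [← hΔ0, hx]
    simp [h]
  · have h1 := Finset.mul_prod_erase Finset.univ
      (fun p : {p : (E ≃ₐ[F₀] E) × (E ≃ₐ[F₀] E) // p.1 ≠ p.2} => θ p.1.1 - θ p.1.2)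
      (Finset.mem_univ ⟨(g, 1), hg⟩)
    refine ⟨?_, _, SetLike.coe_mem (p := integralClosure R E) (∏ p ∈ Finset.univ.erase
      (⟨(g, 1), hg⟩ : {p : (E ≃ₐ[F₀] E) × (E ≃ₐ[F₀] E) // p.1 ≠ p.2}), (θ p.1.1 - θ p.1.2)), ?_⟩
    · intro h
      apply hxθ g 1 hg
      have : θ g = θ 1 := Subtype.ext (by rw [hθ, hθ, h]; rfl)
      rw [this, sub_self, map_zero]
    · have := congrArg (Subtype.val) (h1.trans hΔ0.symm)
      simp only [MulMemClass.coe_mul, AddSubgroupClass.coe_sub, hθ] at this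
      exact this

/-- If the Galois group `D` of `L/Ω` acts freely on the roots of a separable specialization of
`P`, whose Galois group is the full symmetric group, and `D` embeds into a group `G` acting
freely on the index set of the roots, then `L/Ω` is a specialization of `E` over the fixed field
of `G`. -/
theorem isSpecialization_of_point {K : Type} [Field K] [IsDomain R] [Algebra K R] [Algebra K F₀]
    [Algebra K E] [Algebra K Ω] [IsScalarTower K R F₀] [IsScalarTower K F₀ E] [IsScalarTower K R Ω]
    [Algebra.FiniteType K R] [CharZero F₀] [FiniteDimensional Ω L] [IsGalois Ω L] [CharZero L]
    {ι : Type} [Fintype ι] [Nonempty ι]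
    (r : ι → E) (hr : ∀ i, IsIntegral R (r i)) (hadj : Algebra.adjoin F₀ (Set.range r) = ⊤)
    (P : Polynomial R) (hP : P.map (algebraMap R E) = ∏ i, (X - C (r i)))
    (hfull : ∀ π : Equiv.Perm ι, ∃ g : E ≃ₐ[F₀] E, ∀ i, g (r i) = r (π i))
    (β : ι → L) (hβ : Function.Injective β)
    (hroot : ∀ i, P.eval₂ ((algebraMap Ω L).comp (algebraMap R Ω)) (β i) = 0)
    (hD : ∀ (δ : L ≃ₐ[Ω] L) (i : ι), δ (β i) = β i → δ = 1)
    (hst : ∀ (δ : L ≃ₐ[Ω] L) (i : ι), δ (β i) ∈ Set.range β)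
    {G : Type} [Group G] [MulAction G ι] (hG : ∀ (g : G) (i : ι), g • i = i → g = 1)
    (j : G →* (E ≃ₐ[F₀] E)) (hj : ∀ g i, j g (r i) = r (g • i))
    (f : (L ≃ₐ[Ω] L) →* G) (hf : Function.Injective f) :
    IsSpecialization K (IntermediateField.fixedField j.range) E Ω L := by
  obtain ⟨Θ, hΘ, Δ, hΔ, hu⟩ := exists_primitive_and_discriminant (Ω := Ω) (F₀ := F₀)
    r hr hadj P hP β hβ hroot
  have hΔ0 : Δ ≠ 0 := by rintro rfl; exact hΔ (map_zero _)
  let A := Localization.Away Δ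
  have hle : Submonoid.powers Δ ≤ nonZeroDivisors R := powers_le_nonZeroDivisors_of_noZeroDivisors hΔ0
  have hunit : ∀ (y : Submonoid.powers Δ), IsUnit (algebraMap R F₀ y) := by
    rintro ⟨_, n, rfl⟩
    rw [map_pow]
    exact (IsUnit.mk0 _ (by simpa using hΔ0)).pow n
  let a1 : Algebra A F₀ := (IsLocalization.lift (M := Submonoid.powers Δ) hunit).toAlgebra
  have t1 : IsScalarTower R A F₀ := IsScalarTower.of_algebraMap_eq fun a =>
    (IsLocalization.lift_eq hunit a).symm
  let a2 : Algebra A E := ((algebraMap F₀ E).comp (algebraMap A F₀)).toAlgebra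
  have t2 : IsScalarTower A F₀ E := IsScalarTower.of_algebraMap_eq fun a => rfl
  have t2' : IsScalarTower R A E := IsScalarTower.of_algebraMap_eq fun a => by
    rw [IsScalarTower.algebraMap_apply A F₀ E, ← IsScalarTower.algebraMap_apply R A F₀,
      ← IsScalarTower.algebraMap_apply R F₀ E]
  have hunit' : ∀ (y : Submonoid.powers Δ), IsUnit (algebraMap R Ω y) := by
    rintro ⟨_, n, rfl⟩
    rw [map_pow]
    exact (IsUnit.mk0 _ hΔ).pow n
  let a3 : Algebra A Ω := (IsLocalization.lift (M := Submonoid.powers Δ) hunit').toAlgebra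
  have t3 : IsScalarTower R A Ω := IsScalarTower.of_algebraMap_eq fun a =>
    (IsLocalization.lift_eq hunit' a).symm
  have t4 : IsScalarTower K A F₀ := IsScalarTower.of_algebraMap_eq fun a => by
    rw [IsScalarTower.algebraMap_apply K R A, ← IsScalarTower.algebraMap_apply R A F₀,
      ← IsScalarTower.algebraMap_apply K R F₀]
  have t5 : IsScalarTower K A Ω := IsScalarTower.of_algebraMap_eq fun a => by
    rw [IsScalarTower.algebraMap_apply K R A, ← IsScalarTower.algebraMap_apply R A Ω,
      ← IsScalarTower.algebraMap_apply K R Ω]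
  have : IsDomain A := IsLocalization.isDomain_localization hle
  have : IsFractionRing A F₀ := IsFractionRing.isFractionRing_of_isDomain_of_isLocalization
    (Submonoid.powers Δ) A F₀
  have : IsIntegrallyClosed A := isIntegrallyClosed_of_isLocalization A (Submonoid.powers Δ) hle
  have : Algebra.FiniteType R A := IsLocalization.finiteType_of_monoid_fg (Submonoid.powers Δ) A
  have : Algebra.FiniteType K A := Algebra.FiniteType.trans (S := R) inferInstance inferInstance
  have hΔu : IsUnit (algebraMap R A Δ) := IsLocalization.Away.algebraMap_isUnit Δ
  refine isSpecialization_of_roots (A := A) r (P.map (algebraMap R A)) ?_ hfull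
    (fun i => (hr i).tower_top) Θ ?_ ?_ β hβ ?_ hD hst hG j hj f hf
  · rw [Polynomial.map_map, ← IsScalarTower.algebraMap_eq, hP]
  · have : Algebra.adjoin R (Set.range r) ≤ (Algebra.adjoin A (Set.range r)).restrictScalars R :=
      Algebra.adjoin_le Algebra.subset_adjoin
    exact this hΘ
  · intro g hg
    obtain ⟨h1, u, hu1, hu2⟩ := hu g hg
    refine ⟨h1, ?_⟩
    obtain ⟨w, hw⟩ := hΔu
    have h2 : (g Θ - Θ)⁻¹ = u * algebraMap A E (↑w⁻¹ : A) := by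
      refine inv_eq_of_mul_eq_one_right ?_
      rw [← mul_assoc, hu2, IsScalarTower.algebraMap_apply R A E, ← hw, ← map_mul, Units.mul_inv,
        map_one]
    rw [h2]
    exact hu1.tower_top.mul isIntegral_algebraMap
  · intro i
    rw [eval₂_map, RingHom.comp_assoc, ← IsScalarTower.algebraMap_eq, hroot]

end Point

theorem subgroup_perm_eq_top {ι : Type} [Finite ι] [DecidableEq ι] (S : Subgroup (Equiv.Perm ι))
    (h1 : ∀ i k, ∃ π ∈ S, π i = k) (l : ι)
    (h2 : ∀ i k, i ≠ l → k ≠ l → ∃ π ∈ S, π l = l ∧ π i = k)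
    {i₀ k₀ : ι} (hne : i₀ ≠ k₀) (h3 : Equiv.swap i₀ k₀ ∈ S) : S = ⊤ := by
  rw [eq_top_iff, ← Equiv.Perm.closure_isSwap, Subgroup.closure_le]
  rintro _ ⟨a, b, hab, rfl⟩
  obtain ⟨π, hπ, hi⟩ := h1 i₀ l
  obtain ⟨τ, hτ, ha⟩ := h1 a l
  have hk : π k₀ ≠ l := fun h => hne (π.injective (hi.trans h.symm))
  have hb : τ b ≠ l := fun h => hab (τ.injective (ha.trans h.symm))
  obtain ⟨υ, hυ, hl, hkb⟩ := h2 _ _ hk hb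
  have e1 : (τ⁻¹ * υ * π) i₀ = a := by
    rw [Equiv.Perm.mul_apply, Equiv.Perm.mul_apply, hi, hl]
    exact τ.symm_apply_eq.2 ha.symm
  have e2 : (τ⁻¹ * υ * π) k₀ = b := by
    simp [Equiv.Perm.mul_apply, hkb]
  have hm : τ⁻¹ * υ * π ∈ S := S.mul_mem (S.mul_mem (S.inv_mem hτ) hυ) hπ
  rw [← e1, ← e2, Equiv.swap_apply_apply]
  exact S.mul_mem (S.mul_mem hm h3) (S.inv_mem hm)

section Symmetric

variable {F₀ E R k Ω : Type} [Field F₀] [Field E] [CommRing R] [IsIntegrallyClosed R]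
  [Algebra R F₀] [Algebra F₀ E] [Algebra R E] [IsScalarTower R F₀ E] [IsFractionRing R F₀]
  [FiniteDimensional F₀ E] [IsGalois F₀ E] [Field k] [Field Ω] [IsAlgClosed Ω] [Algebra k Ω]

/-- Automorphisms of the roots of a specialization of `P` lift to the Galois group of `P`. -/
theorem exists_perm_forall_exists_lift {ι : Type} [Fintype ι] (r : ι → E)
    (hr : ∀ i, IsIntegral R (r i)) (P : Polynomial R)
    (hP : P.map (algebraMap R E) = ∏ i, (X - C (r i)))
    (χ : R →+* k) (β : ι → Ω) (hβ : Function.Injective β)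
    (hroot : ∀ i, P.eval₂ ((algebraMap k Ω).comp χ) (β i) = 0) :
    ∃ σ : Equiv.Perm ι, ∀ δ : Ω ≃ₐ[k] Ω, ∃ g : E ≃ₐ[F₀] E, ∀ i m, δ (β i) = β m →
      g (r (σ i)) = r (σ m) := by
  have hinj : Function.Injective (algebraMap R E) := by
    rw [IsScalarTower.algebraMap_eq R F₀ E]
    exact (algebraMap F₀ E).injective.comp (IsFractionRing.injective R F₀)
  have hinj' : Function.Injective (algebraMap R (integralClosure R E)) := fun a b h =>
    hinj (congrArg Subtype.val h)
  obtain ⟨x, hx⟩ := exists_extension_of_isIntegral hinj' ((algebraMap k Ω).comp χ)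
  have hP' := map_integralClosure_eq r hr P hP
  have hxc : x.comp (algebraMap R (integralClosure R E)) = (algebraMap k Ω).comp χ :=
    RingHom.ext hx
  let r' : ι → integralClosure R E := fun i => ⟨r i, hr i⟩
  obtain ⟨σ, hσ⟩ := exists_perm_of_roots r' P hP' x β hβ
    fun i => by rw [hxc, hroot]
  refine ⟨σ, fun δ => ?_⟩
  obtain ⟨g, hg⟩ := exists_forall_eq_apply_of_stable (G := E ≃ₐ[F₀] E)
    (integralClosure R E).toSubring (fun g b hb => isIntegral_apply g hb) x
    ((δ : Ω →+* Ω).comp x) (by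
      intro b hb
      obtain ⟨y, hy⟩ := (IsGalois.mem_bot_iff_fixed (F := F₀) (E := E) (b : E)).2 hb
      have hyint : IsIntegral R y := by
        rw [← isIntegral_algebraMap_iff (algebraMap F₀ E).injective]
        have : algebraMap F₀ E y = b := hy
        rw [this]; exact b.2
      obtain ⟨a, rfl⟩ := IsIntegrallyClosed.isIntegral_iff.1 hyint
      have ha : b = algebraMap R (integralClosure R E) a := Subtype.ext (by
        rw [← hy]; exact (IsScalarTower.algebraMap_apply R F₀ E a).symm)
      rw [ha]
      exact (hx a).trans (((congrArg δ (hx a)).trans (δ.commutes _)).symm))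
  refine ⟨g, fun i m him => ?_⟩
  have h1 : δ (x (r' (σ i))) = x ⟨g (r (σ i)), isIntegral_apply g (hr _)⟩ := hg (r' (σ i))
  rw [hσ, him] at h1
  obtain ⟨j, hj⟩ := exists_root_eq_apply r P hP g (σ i)
  have h4 : x (r' j) = β m := by
    rw [h1]; exact congrArg x (Subtype.ext hj)
  have h5 := hσ (σ.symm j)
  rw [Equiv.apply_symm_apply, h4] at h5
  rw [← hj, hβ h5, Equiv.apply_symm_apply]

/-- The Galois group of `P` is the full symmetric group as soon as three specializations have
Galois groups that are, respectively, transitive, transitive outside a fixed point, and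
containing a transposition. -/
theorem galois_eq_perm {ι : Type} [Fintype ι] (r : ι → E) (hrinj : Function.Injective r)
    (hr : ∀ i, IsIntegral R (r i)) (P : Polynomial R)
    (hP : P.map (algebraMap R E) = ∏ i, (X - C (r i)))
    (χ : Fin 3 → R →+* k) (β : Fin 3 → ι → Ω) (hβ : ∀ m, Function.Injective (β m))
    (hroot : ∀ m i, P.eval₂ ((algebraMap k Ω).comp (χ m)) (β m i) = 0)
    (h1 : ∀ i j, ∃ δ : Ω ≃ₐ[k] Ω, δ (β 0 i) = β 0 j) (l : ι)
    (h2 : ∀ i j, i ≠ l → j ≠ l → ∃ δ : Ω ≃ₐ[k] Ω, δ (β 1 l) = β 1 l ∧ δ (β 1 i) = β 1 j)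
    {i₀ k₀ : ι} (hne : i₀ ≠ k₀)
    (h3 : ∃ δ : Ω ≃ₐ[k] Ω, δ (β 2 i₀) = β 2 k₀ ∧ δ (β 2 k₀) = β 2 i₀ ∧
      ∀ m, m ≠ i₀ → m ≠ k₀ → δ (β 2 m) = β 2 m) (π : Equiv.Perm ι) :
    ∃ g : E ≃ₐ[F₀] E, ∀ i, g (r i) = r (π i) := by
  classical
  let S : Subgroup (Equiv.Perm ι) :=
    { carrier := {π | ∃ g : E ≃ₐ[F₀] E, ∀ i, g (r i) = r (π i)}
      one_mem' := ⟨1, fun i => rfl⟩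
      mul_mem' := by
        rintro π τ ⟨g, hg⟩ ⟨h, hh⟩
        exact ⟨g * h, fun i => by rw [AlgEquiv.mul_apply, hh, hg]; rfl⟩
      inv_mem' := by
        rintro π ⟨g, hg⟩
        refine ⟨g⁻¹, fun i => ?_⟩
        change g.symm (r i) = _
        rw [AlgEquiv.symm_apply_eq, hg]
        exact congrArg r (π.apply_symm_apply i).symm }
  have hperm : ∀ g : E ≃ₐ[F₀] E, ∃ π ∈ S, ∀ i, g (r i) = r (π i) := by
    intro g
    choose s hs using exists_root_eq_apply r P hP g
    have hsinj : Function.Injective s := fun a b h =>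
      hrinj (g.injective (by rw [← hs, ← hs, h]))
    exact ⟨Equiv.ofBijective s (Finite.injective_iff_bijective.1 hsinj),
      ⟨g, fun i => (hs i).symm⟩, fun i => (hs i).symm⟩
  obtain ⟨σ₀, hσ₀⟩ := exists_perm_forall_exists_lift (F₀ := F₀) r hr P hP (χ 0) (β 0) (hβ 0) (hroot 0)
  obtain ⟨σ₁, hσ₁⟩ := exists_perm_forall_exists_lift (F₀ := F₀) r hr P hP (χ 1) (β 1) (hβ 1) (hroot 1)
  obtain ⟨σ₂, hσ₂⟩ := exists_perm_forall_exists_lift (F₀ := F₀) r hr P hP (χ 2) (β 2) (hβ 2) (hroot 2)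
  have hS : S = ⊤ := by
    refine subgroup_perm_eq_top S ?_ (σ₁ l) ?_ (i₀ := σ₂ i₀) (k₀ := σ₂ k₀)
      (fun h => hne (σ₂.injective h)) ?_
    · intro i j
      obtain ⟨δ, hδ⟩ := h1 (σ₀.symm i) (σ₀.symm j)
      obtain ⟨g, hg⟩ := hσ₀ δ
      obtain ⟨π, hπ, hgπ⟩ := hperm g
      refine ⟨π, hπ, hrinj ?_⟩
      have := hg _ _ hδ
      rw [Equiv.apply_symm_apply, Equiv.apply_symm_apply] at this
      rw [← hgπ, this]
    · intro i j hi hj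
      obtain ⟨δ, hδ1, hδ2⟩ := h2 (σ₁.symm i) (σ₁.symm j)
        (fun h => hi (by rw [← h, Equiv.apply_symm_apply]))
        (fun h => hj (by rw [← h, Equiv.apply_symm_apply]))
      obtain ⟨g, hg⟩ := hσ₁ δ
      obtain ⟨π, hπ, hgπ⟩ := hperm g
      refine ⟨π, hπ, hrinj ?_, hrinj ?_⟩
      · rw [← hgπ, hg _ _ hδ1]
      · have := hg _ _ hδ2
        rw [Equiv.apply_symm_apply, Equiv.apply_symm_apply] at this
        rw [← hgπ, this]
    · obtain ⟨δ, hδ1, hδ2, hδ3⟩ := h3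
      obtain ⟨g, hg⟩ := hσ₂ δ
      obtain ⟨π, hπ, hgπ⟩ := hperm g
      have : Equiv.swap (σ₂ i₀) (σ₂ k₀) = π := by
        ext i
        apply hrinj
        rw [← hgπ]
        obtain ⟨i, rfl⟩ := σ₂.surjective i
        by_cases h : i = i₀
        · subst h; rw [Equiv.swap_apply_left, hg _ _ hδ1]
        by_cases h' : i = k₀
        · subst h'; rw [Equiv.swap_apply_right, hg _ _ hδ2]
        rw [Equiv.swap_apply_of_ne_of_ne (fun e => h (σ₂.injective e))
          (fun e => h' (σ₂.injective e)), hg _ _ (hδ3 i h h')]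
      rw [this]; exact hπ
  exact (hS ▸ Subgroup.mem_top π : π ∈ S)

end Symmetric

theorem irreducible_X_pow_sub_C_X (K k : Type) [Field K] [Field k] [Algebra (Polynomial K) k]
    [IsFractionRing (Polynomial K) k] {n : ℕ} (hn : 0 < n) :
    Irreducible (X ^ n - C (algebraMap (Polynomial K) k X) : Polynomial k) := by
  have hm : (X ^ n - C X : Polynomial (Polynomial K)).Monic := monic_X_pow_sub_C _ hn.ne'
  have hN : (X ^ n - C X : Polynomial (Polynomial K)).natDegree = n := natDegree_X_pow_sub_C
  have hp : (Ideal.span {(X : Polynomial K)}).IsPrime :=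
    (Ideal.span_singleton_prime X_ne_zero).2 prime_X
  have hE : (X ^ n - C X : Polynomial (Polynomial K)).IsEisensteinAt (Ideal.span {X}) := by
    refine hm.isEisensteinAt_of_mem_of_notMem hp.ne_top (fun {l} hl => ?_) ?_
    · rw [hN] at hl
      rw [coeff_sub, coeff_X_pow, if_neg hl.ne, zero_sub, coeff_C]
      split_ifs
      · exact neg_mem (Ideal.mem_span_singleton_self _)
      · simp
    · rw [coeff_sub, coeff_X_pow, if_neg hn.ne, zero_sub, coeff_C_zero, neg_mem_iff,
        Ideal.span_singleton_pow, Ideal.mem_span_singleton]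
      intro h
      have := (X_pow_dvd_iff.1 h) 1 (by norm_num)
      simp at this
  have := (hm.irreducible_iff_irreducible_map_fraction_map (K := k)).1
    (hE.irreducible hp hm.isPrimitive (by rwa [hN]))
  simpa using this

/-- Three polynomials of degree `N` over `S`, whose Galois groups over a field in which `s` is
transcendental generate the symmetric group. -/
noncomputable def fibre {S : Type*} [CommRing S] (N : ℕ) (s : S) : Fin 3 → Polynomial S :=
  ![X ^ N - C s, X * (X ^ (N - 1) - C s), (X ^ 2 - C s) * ∏ j ∈ Finset.range (N - 2), (X - C (j : S))]

theorem map_fibre {S T : Type*} [CommRing S] [CommRing T] (φ : S →+* T) (N : ℕ) (s : S)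
    (m : Fin 3) : (fibre N s m).map φ = fibre N (φ s) m := by
  fin_cases m <;> simp [fibre, Polynomial.map_prod]

theorem monic_fibre {S : Type*} [CommRing S] {N : ℕ} (hN : 3 ≤ N) (s : S) (m : Fin 3) :
    (fibre N s m).Monic := by
  fin_cases m
  · exact monic_X_pow_sub_C _ (by omega)
  · exact monic_X.mul (monic_X_pow_sub_C _ (by omega))
  · exact (monic_X_pow_sub_C _ (by omega)).mul (monic_prod_X_sub_C _ _)

theorem natDegree_fibre {S : Type*} [CommRing S] [Nontrivial S] {N : ℕ} (hN : 3 ≤ N) (s : S)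
    (m : Fin 3) : (fibre N s m).natDegree = N := by
  fin_cases m
  · exact natDegree_X_pow_sub_C
  · change (X * (X ^ (N - 1) - C s)).natDegree = N
    rw [monic_X.natDegree_mul (monic_X_pow_sub_C _ (by omega)), natDegree_X,
      natDegree_X_pow_sub_C]
    omega
  · change ((X ^ 2 - C s) * ∏ j ∈ Finset.range (N - 2), (X - C (j : S))).natDegree = N
    rw [(monic_X_pow_sub_C _ (by omega)).natDegree_mul (monic_prod_X_sub_C _ _),
      natDegree_X_pow_sub_C, natDegree_finsetProd_X_sub_C_eq_card, Finset.card_range]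
    omega

section

variable {k : Type} [Field k] [CharZero k]

theorem separable_fibre {N : ℕ} (hN : 3 ≤ N) {s : k} (h0 : s ≠ 0) (hs : ∀ j : ℕ, (j : k) ^ 2 ≠ s)
    (m : Fin 3) : (fibre N s m).Separable := by
  have hsep (n : ℕ) (hn : n ≠ 0) : (X ^ n - C s : Polynomial k).Separable :=
    separable_X_pow_sub_C _ (Nat.cast_ne_zero.2 hn) h0
  fin_cases m
  · exact hsep N (by omega)
  · refine separable_X.mul (hsep _ (by omega)) ?_
    rw [Irreducible.coprime_iff_not_dvd irreducible_X, X_dvd_iff]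
    simp [coeff_X_pow, h0, show ¬ 0 = N - 1 by omega]
  · refine (hsep 2 (by omega)).mul (separable_prod_X_sub_C_iff'.2 fun i _ j _ h =>
      Nat.cast_injective h) (IsCoprime.prod_right fun j _ => IsCoprime.symm ?_)
    rw [Irreducible.coprime_iff_not_dvd (irreducible_X_sub_C _), dvd_iff_isRoot, IsRoot.def]
    simpa [sub_eq_zero] using hs j

theorem exists_enumeration_roots {k Ω : Type} [Field k] [Field Ω] [IsAlgClosed Ω] [Algebra k Ω]
    {ι : Type} [Fintype ι] (Q : Polynomial k) (hQ : Q.Separable)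
    (hN : Q.natDegree = Fintype.card ι) :
    ∃ γ : ι → Ω, Function.Injective γ ∧ (∀ i, aeval (γ i) Q = 0) ∧
      ∀ x, aeval x Q = 0 → ∃ i, γ i = x := by
  have hcard := card_rootSet_eq_natDegree (K := Ω) hQ (IsAlgClosed.splits _)
  let e : ι ≃ Q.rootSet Ω := Fintype.equivOfCardEq (by rw [hcard, hN])
  refine ⟨fun i => e i, Subtype.val_injective.comp e.injective,
    fun i => (mem_rootSet.1 (e i).2).2, fun x hx => ?_⟩
  obtain ⟨i, hi⟩ := e.surjective ⟨x, mem_rootSet.2 ⟨hQ.ne_zero, hx⟩⟩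
  exact ⟨i, congrArg Subtype.val hi⟩

theorem exists_algEquiv_of_irreducible {Q : Polynomial k} (hQ : Irreducible Q)
    (hm : Q.Monic) {x y : AlgebraicClosure k} (hx : aeval x Q = 0) (hy : aeval y Q = 0) :
    ∃ δ : AlgebraicClosure k ≃ₐ[k] AlgebraicClosure k, δ x = y := by
  have h : IsConjRoot k y x := by
    rw [isConjRoot_def, ← minpoly.eq_of_irreducible_of_monic hQ hx hm,
      ← minpoly.eq_of_irreducible_of_monic hQ hy hm]
  exact h.exists_algEquiv

variable {F₀ E R : Type} [Field F₀] [Field E] [CommRing R] [IsIntegrallyClosed R]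
  [Algebra R F₀] [Algebra F₀ E] [Algebra R E] [IsScalarTower R F₀ E] [IsFractionRing R F₀]
  [FiniteDimensional F₀ E] [IsGalois F₀ E]

/-- A polynomial with the three given fibres has the symmetric group as Galois group. -/
theorem injective_and_forall_perm_of_fibres {ι : Type} [Fintype ι] {N : ℕ}
    (hcard : Fintype.card ι = N) (hN : 3 ≤ N) {s c : k} (hc : c ≠ 0)
    (hs : ∀ j : ℕ, (j : k) ^ 2 ≠ s)
    (hirr : ∀ n, 0 < n → Irreducible (X ^ n - C s : Polynomial k))
    (χ : Fin 3 → R →+* k) (r : ι → E) (hr : ∀ i, IsIntegral R (r i)) (P : Polynomial R)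
    (hP : P.map (algebraMap R E) = ∏ i, (X - C (r i)))
    (hPχ : ∀ m, P.map (χ m) = (fibre N s m).scaleRoots c) :
    Function.Injective r ∧ ∀ π : Equiv.Perm ι, ∃ g : E ≃ₐ[F₀] E, ∀ i, g (r i) = r (π i) := by
  have h0 : s ≠ 0 := fun h => hs 0 (by simp [h])
  have hcΩ : algebraMap k (AlgebraicClosure k) c ≠ 0 :=
    (map_ne_zero_iff _ (algebraMap k _).injective).2 hc
  choose γ hγ hγr hγs using fun m => exists_enumeration_roots (Ω := AlgebraicClosure k) (ι := ι)
    (fibre N s m) (separable_fibre hN h0 hs m) (by rw [natDegree_fibre hN, hcard])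
  have hβ (m) : Function.Injective fun i => algebraMap k (AlgebraicClosure k) c * γ m i :=
    fun i j h => hγ m (mul_left_cancel₀ hcΩ h)
  have hroot (m) (i) : P.eval₂ ((algebraMap k (AlgebraicClosure k)).comp (χ m))
      (algebraMap k (AlgebraicClosure k) c * γ m i) = 0 := by
    rw [← eval₂_map, hPχ, ← aeval_def]
    exact scaleRoots_aeval_eq_zero (hγr m i)
  have hlift (m) (i j) (δ : AlgebraicClosure k ≃ₐ[k] AlgebraicClosure k) (h : δ (γ m i) = γ m j) :
      δ (algebraMap k (AlgebraicClosure k) c * γ m i) =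
        algebraMap k (AlgebraicClosure k) c * γ m j := by
    rw [map_mul, AlgEquiv.commutes, h]
  have hinj : Function.Injective r := by
    have hRE : Function.Injective (algebraMap R E) := by
      rw [IsScalarTower.algebraMap_eq R F₀ E]
      exact (algebraMap F₀ E).injective.comp (IsFractionRing.injective R F₀)
    obtain ⟨x, hx⟩ := exists_extension_of_isIntegral (A := R) (B := integralClosure R E)
      (fun a b h => hRE (congrArg Subtype.val h)) ((algebraMap k (AlgebraicClosure k)).comp (χ 0))
    obtain ⟨σ, hσ⟩ := exists_perm_of_roots (fun i => (⟨r i, hr i⟩ : integralClosure R E)) P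
      (map_integralClosure_eq r hr P hP) x _ (hβ 0) fun i => by
        rw [show x.comp (algebraMap R (integralClosure R E)) = _ from RingHom.ext hx]
        exact hroot 0 i
    intro i j h
    have h1 := hσ (σ.symm i)
    have h2 := hσ (σ.symm j)
    rw [Equiv.apply_symm_apply] at h1 h2
    have h3 : (⟨r i, hr i⟩ : integralClosure R E) = ⟨r j, hr j⟩ := Subtype.ext h
    rw [h3, h2] at h1
    exact (σ.symm.injective (hβ 0 h1)).symm
  refine ⟨hinj, ?_⟩
  have hsub (n : ℕ) (x : AlgebraicClosure k) : aeval x (X ^ n - C s : Polynomial k) =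
    x ^ n - algebraMap k _ s := by simp
  have e0 (x : AlgebraicClosure k) : aeval x (fibre N s 0) = x ^ N - algebraMap k _ s := hsub N x
  have e1 (x : AlgebraicClosure k) : aeval x (fibre N s 1) =
      x * (x ^ (N - 1) - algebraMap k _ s) := by
    change aeval x (X * (X ^ (N - 1) - C s)) = _
    rw [map_mul, aeval_X, hsub]
  have e2 (x : AlgebraicClosure k) : aeval x (fibre N s 2) =
      (x ^ 2 - algebraMap k _ s) * ∏ j ∈ Finset.range (N - 2), (x - (j : AlgebraicClosure k)) := by
    change aeval x ((X ^ 2 - C s) * ∏ j ∈ Finset.range (N - 2), (X - C (j : k))) = _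
    rw [map_mul, hsub, map_prod]
    simp
  obtain ⟨l, hl⟩ := hγs 1 0 (by rw [e1, zero_mul])
  obtain ⟨z, hz⟩ := IsAlgClosed.exists_pow_nat_eq (algebraMap k (AlgebraicClosure k) s)
    (n := 2) (by norm_num)
  obtain ⟨i₀, hi₀⟩ := hγs 2 z (by rw [e2, hz, sub_self, zero_mul])
  obtain ⟨k₀, hk₀⟩ := hγs 2 (-z) (by rw [e2, neg_sq, hz, sub_self, zero_mul])
  have hz0 : z ≠ 0 := by
    rintro rfl
    rw [zero_pow two_ne_zero] at hz
    exact h0 ((map_eq_zero_iff _ (algebraMap k _).injective).1 hz.symm)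
  obtain ⟨δ, hδ⟩ := exists_algEquiv_of_irreducible (hirr 2 (by norm_num))
    (monic_X_pow_sub_C _ two_ne_zero) (x := z) (y := -z) (by rw [hsub, hz, sub_self])
    (by rw [hsub, neg_sq, hz, sub_self])
  refine galois_eq_perm (F₀ := F₀) r hinj hr P hP χ _ hβ hroot (fun i j => ?_) l
    (fun i j hi hj => ?_) (i₀ := i₀) (k₀ := k₀) (fun h => ?_) ⟨δ, ?_, ?_, fun m hm hm' => ?_⟩
  · obtain ⟨δ, hδ⟩ := exists_algEquiv_of_irreducible (hirr N (by omega))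
      (monic_X_pow_sub_C _ (by omega)) (hγr 0 i) (hγr 0 j)
    exact ⟨δ, hlift _ _ _ δ hδ⟩
  · have h (i) (hi : i ≠ l) : aeval (γ 1 i) (X ^ (N - 1) - C s : Polynomial k) = 0 := by
      have := hγr 1 i
      rw [e1, mul_eq_zero] at this
      rw [hsub]
      exact this.resolve_left fun h => hi (hγ 1 (h.trans hl.symm))
    obtain ⟨δ, hδ⟩ := exists_algEquiv_of_irreducible (hirr (N - 1) (by omega))
      (monic_X_pow_sub_C _ (by omega)) (h i hi) (h j hj)
    exact ⟨δ, hlift _ _ _ δ (by rw [hl, map_zero]), hlift _ _ _ δ hδ⟩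
  · rw [← h, hi₀, eq_neg_iff_add_eq_zero, ← two_mul, mul_eq_zero] at hk₀
    exact hk₀.elim two_ne_zero hz0
  · exact hlift _ _ _ δ (by rw [hi₀, hk₀, hδ])
  · exact hlift _ _ _ δ (by rw [hi₀, hk₀, map_neg, hδ, neg_neg])
  · refine hlift _ _ _ δ ?_
    have := hγr 2 m
    rw [e2, mul_eq_zero] at this
    rcases this with h | h
    · rw [sub_eq_zero, ← hz, sq_eq_sq_iff_eq_or_eq_neg] at h
      rcases h with h | h
      · exact absurd (hγ 2 (h.trans hi₀.symm)) hm
      · exact absurd (hγ 2 (h.trans hk₀.symm)) hm'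
    · obtain ⟨j, _, hj⟩ := Finset.prod_eq_zero_iff.1 h
      rw [sub_eq_zero.1 hj, map_natCast]

end

section Complete

open IsLocalRing
open scoped Ring

/-- Newton's method: in a complete local ring a simple approximate root of an arbitrary polynomial,
monic or not, lifts to a root. -/
theorem exists_isRoot_of_isAdicComplete {R : Type*} [CommRing R] [IsLocalRing R]
    [IsAdicComplete (maximalIdeal R) R] (f : R[X]) (a₀ : R) (h₁ : f.eval a₀ ∈ maximalIdeal R)
    (h₂ : IsUnit (f.derivative.eval a₀)) : ∃ a, f.IsRoot a ∧ a - a₀ ∈ maximalIdeal R := by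
  set I := maximalIdeal R
  let c : ℕ → R := fun n => Nat.recOn n a₀ fun _ b => b - f.eval b * (f.derivative.eval b)⁻¹ʳ
  have hc : ∀ n, c (n + 1) = c n - f.eval (c n) * (f.derivative.eval (c n))⁻¹ʳ := fun n => rfl
  have hsub : ∀ x y : R, ∀ g : R[X], x - y ∣ g.eval x - g.eval y := fun x y g =>
    sub_dvd_eval_sub x y g
  have hmod : ∀ n, c n - a₀ ∈ I ∧ f.eval (c n) ∈ I ^ (n + 1) := by
    intro n
    induction n with
    | zero => exact ⟨by simp [c], by simpa [c] using h₁⟩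
    | succ n ih =>
      obtain ⟨ih1, ih2⟩ := ih
      have hu : IsUnit (f.derivative.eval (c n)) := by
        have h3 : f.derivative.eval (c n) - f.derivative.eval a₀ ∈ I :=
          I.mem_of_dvd (hsub _ _ _) ih1
        by_contra hcon
        have h4 : f.derivative.eval (c n) ∈ I := hcon
        exact (mem_maximalIdeal _).1 ((Submodule.sub_mem_iff_right I h4).1 h3) h₂
      have ih3 : f.eval (c n) ∈ I := Ideal.pow_le_self (Nat.succ_ne_zero n) ih2
      constructor
      · rw [hc, sub_right_comm]
        exact I.sub_mem ih1 (I.mul_mem_right _ ih3)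
      · obtain ⟨w, hw⟩ := f.binomExpansion (c n) (-(f.eval (c n) * (f.derivative.eval (c n))⁻¹ʳ))
        have : f.derivative.eval (c n) * -(f.eval (c n) * (f.derivative.eval (c n))⁻¹ʳ)
            = - f.eval (c n) := by
          rw [mul_neg, mul_left_comm, Ring.mul_inverse_cancel _ hu, mul_one]
        rw [hc, sub_eq_add_neg, hw, this, add_neg_cancel, zero_add, neg_sq, mul_pow]
        refine Ideal.mul_mem_left _ _ (Ideal.mul_mem_right _ _ ?_)
        rw [pow_two]
        have := Ideal.mul_mem_mul ih2 ih3
        rwa [← pow_succ] at this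
  have hcau : ∀ {m n}, m ≤ n → c m ≡ c n [SMOD (I ^ m • ⊤ : Ideal R)] := by
    intro m n hmn
    rw [smul_eq_mul, Ideal.mul_top]
    induction n, hmn using Nat.le_induction with
    | base => rfl
    | succ n hmn ih =>
      refine ih.trans ?_
      rw [SModEq.sub_mem, hc, sub_sub_cancel]
      exact Ideal.mul_mem_right _ _ (Ideal.pow_le_pow_right (by omega) (hmod n).2)
  obtain ⟨a, ha⟩ := IsPrecomplete.prec' c hcau
  have ha' : ∀ n, a - c n ∈ I ^ n := fun n => by
    have := (ha n).symm
    rwa [SModEq.sub_mem, smul_eq_mul, Ideal.mul_top] at this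
  refine ⟨a, IsHausdorff.haus' (I := I) _ fun n => ?_, ?_⟩
  · rw [SModEq.zero, smul_eq_mul, Ideal.mul_top]
    have := (I ^ n).mem_of_dvd (hsub _ _ f) (ha' n)
    exact (Submodule.sub_mem_iff_left _ (Ideal.pow_le_pow_right (by omega) (hmod n).2)).1 this
  · have := ha' 1
    rw [pow_one] at this
    simpa using I.add_mem this (hmod 1).1

theorem isAdicComplete_of_pow_le {R : Type*} [CommRing R] {I J : Ideal R} [IsAdicComplete I R]
    (hIJ : I ≤ J) {r : ℕ} (hr : J ^ r ≤ I) : IsAdicComplete J R where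
  haus' x hx := by
    refine IsHausdorff.haus' (I := I) _ fun n => ?_
    have := hx (r * n)
    rw [SModEq.zero, smul_eq_mul, Ideal.mul_top] at this ⊢
    rw [pow_mul] at this
    exact Ideal.pow_right_mono hr n this
  prec' c hc := by
    have hc' : ∀ {m n}, m ≤ n → c m - c n ∈ J ^ m := fun h => by
      have := hc h
      rwa [SModEq.sub_mem, smul_eq_mul, Ideal.mul_top] at this
    obtain ⟨a, ha⟩ := IsPrecomplete.prec' (I := I) (fun n => c (r * n)) fun {m n} hmn => by
      rw [SModEq.sub_mem, smul_eq_mul, Ideal.mul_top]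
      have := hc' (Nat.mul_le_mul_left r hmn)
      rw [pow_mul] at this
      exact Ideal.pow_right_mono hr m this
    refine ⟨a, fun n => ?_⟩
    rw [SModEq.sub_mem, smul_eq_mul, Ideal.mul_top]
    have h1 := ha n
    rw [SModEq.sub_mem, smul_eq_mul, Ideal.mul_top] at h1
    have h2 : c (r * n) - a ∈ J ^ n := Ideal.pow_right_mono hIJ n h1
    rcases le_total n (r * n) with h | h
    · simpa using (J ^ n).add_mem (hc' h) h2
    · rcases Nat.eq_zero_or_pos r with rfl | hr0
      · have hJ : I = ⊤ := by simpa using hr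
        have : J ^ n = ⊤ := by
          rw [hJ, top_le_iff] at hIJ
          rw [hIJ, Ideal.top_pow]
        simp [this]
      · have := le_antisymm h (Nat.le_mul_of_pos_left n hr0)
        rwa [this] at h2

theorem mem_span_algebraMap_pow_iff {O B ι : Type*} [CommRing O] [CommRing B] [Algebra O B]
    [Finite ι] (b : Module.Basis ι O B) (ϖ : O) (n : ℕ) (x : B) :
    x ∈ (Ideal.span {ϖ}).map (algebraMap O B) ^ n ↔ ∀ i, b.repr x i ∈ Ideal.span {ϖ} ^ n := by
  have := Fintype.ofFinite ι
  simp only [Ideal.map_span, Set.image_singleton, Ideal.span_singleton_pow,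
    Ideal.mem_span_singleton]
  constructor
  · rintro ⟨y, rfl⟩ i
    rw [← map_pow, ← Algebra.smul_def, map_smul]
    exact ⟨b.repr y i, rfl⟩
  · intro h
    choose y hy using h
    refine ⟨∑ i, y i • b i, ?_⟩
    rw [← map_pow, ← Algebra.smul_def, Finset.smul_sum, ← b.sum_repr x]
    exact Finset.sum_congr rfl fun i _ => by rw [smul_smul, ← hy]

theorem isAdicComplete_map_of_finite {O B : Type*} [CommRing O] [IsDomain O]
    [IsPrincipalIdealRing O] [CommRing B] [Algebra O B] [Module.Finite O B] [Module.Free O B]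
    (I : Ideal O) [IsAdicComplete I O] : IsAdicComplete (I.map (algebraMap O B)) B := by
  obtain ⟨ϖ, rfl⟩ : ∃ ϖ, I = Ideal.span {ϖ} := (IsPrincipalIdealRing.principal I).principal
  let b := Module.Free.chooseBasis O B
  refine { haus' := fun x hx => ?_, prec' := fun c hc => ?_ }
  · refine b.ext_elem fun i => ?_
    rw [map_zero, Finsupp.zero_apply]
    refine IsHausdorff.haus' (I := Ideal.span {ϖ}) _ fun n => ?_
    have := hx n
    rw [SModEq.zero, smul_eq_mul, Ideal.mul_top] at this ⊢
    exact (mem_span_algebraMap_pow_iff b ϖ n x).1 this i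
  · have key : ∀ i, ∃ a, ∀ n, b.repr (c n) i - a ∈ Ideal.span {ϖ} ^ n := fun i => by
      obtain ⟨a, ha⟩ := IsPrecomplete.prec' (I := Ideal.span {ϖ}) (fun n => b.repr (c n) i)
        fun {m n} hmn => by
          have := hc hmn
          rw [SModEq.sub_mem, smul_eq_mul, Ideal.mul_top] at this ⊢
          simpa using (mem_span_algebraMap_pow_iff b ϖ m _).1 this i
      refine ⟨a, fun n => ?_⟩
      have := ha n
      rwa [SModEq.sub_mem, smul_eq_mul, Ideal.mul_top] at this
    choose a ha using key
    refine ⟨∑ i, a i • b i, fun n => ?_⟩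
    rw [SModEq.sub_mem, smul_eq_mul, Ideal.mul_top, mem_span_algebraMap_pow_iff b]
    intro i
    rw [map_sub, Finsupp.sub_apply, b.repr_sum_self]
    exact ha i n

theorem exists_pow_mul_self_eq {M : Type*} [Monoid M] [Finite M] (a : M) :
    ∃ n, 0 < n ∧ a ^ n * a ^ n = a ^ n := by
  obtain ⟨i, j, hij, h⟩ : ∃ i j, i < j ∧ a ^ i = a ^ j := by
    obtain ⟨i, j, hij, h⟩ := Finite.exists_ne_map_eq_of_infinite fun n : ℕ => a ^ n
    rcases lt_or_gt_of_ne hij with h' | h'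
    · exact ⟨i, j, h', h⟩
    · exact ⟨j, i, h', h.symm⟩
  obtain ⟨p, rfl⟩ := Nat.exists_eq_add_of_lt hij
  have h1 : ∀ n, i ≤ n → ∀ k, a ^ (n + (p + 1) * k) = a ^ n := by
    intro n hn k
    induction k with
    | zero => simp
    | succ k ih =>
      obtain ⟨m, rfl⟩ := Nat.exists_eq_add_of_le hn
      have e1 : i + m + (p + 1) * (k + 1) = (i + p + 1) + (m + (p + 1) * k) := by ring
      rw [e1, pow_add, ← h, ← pow_add, ← add_assoc, ih]
  refine ⟨(p + 1) * (i + 1), by positivity, ?_⟩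
  rw [← pow_add]
  exact h1 _ (by nlinarith) _

theorem isLocalRing_of_isAdicComplete {B : Type*} [CommRing B] [IsDomain B] (I : Ideal B)
    [IsAdicComplete I B] [Finite (B ⧸ I)] : IsLocalRing B := by
  have hloc := isLocalHom_of_le_jacobson_bot I (IsAdicComplete.le_jacobson_bot I)
  refine IsLocalRing.of_isUnit_or_isUnit_one_sub_self fun a => ?_
  obtain ⟨n, hn, h⟩ := exists_pow_mul_self_eq (Ideal.Quotient.mk I a)
  set u := Ideal.Quotient.mk I a
  have hmon : (X ^ 2 - X : B[X]).Monic := by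
    have := monic_X_pow_add (n := 2) (p := (-X : B[X])) (by
      rw [degree_neg]; exact degree_X_le.trans_lt (by norm_num))
    rwa [← sub_eq_add_neg] at this
  obtain ⟨w, hw, hwa⟩ := HenselianRing.is_henselian (I := I) (X ^ 2 - X : B[X]) hmon (a ^ n)
    (by rw [← Ideal.Quotient.eq_zero_iff_mem]; simp [u, pow_two, h])
    (by
      refine IsUnit.of_mul_eq_one (2 * u ^ n - 1) ?_
      have h2 : Ideal.Quotient.mk I ((X ^ 2 - X : B[X]).derivative.eval (a ^ n)) = 2 * u ^ n - 1 := by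
        simp [u]
        norm_num
      rw [h2]
      linear_combination 4 * h)
  have hw' : w * (w - 1) = 0 := by
    have : w ^ 2 - w = 0 := by simpa using hw
    linear_combination this
  have hw2 : Ideal.Quotient.mk I w = u ^ n := by
    rw [← sub_eq_zero, ← map_pow, ← map_sub]
    exact Ideal.Quotient.eq_zero_iff_mem.2 hwa
  rcases mul_eq_zero.1 hw' with rfl | h1
  · right
    refine IsUnit.of_map (Ideal.Quotient.mk I) _ ?_
    rw [map_sub, map_one]
    exact IsNilpotent.isUnit_one_sub ⟨n, by rw [← hw2, map_zero]⟩
  · left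
    rw [sub_eq_zero] at h1
    refine IsUnit.of_map (Ideal.Quotient.mk I) _ ?_
    rw [h1, map_one] at hw2
    exact IsUnit.of_pow_eq_one hw2.symm hn.ne'

end Complete

section Ramification

open IsLocalRing
open scoped Pointwise

theorem smul_mem_maximalIdeal_pow {B G : Type*} [CommRing B] [IsLocalRing B] [Group G]
    [MulSemiringAction G B] (δ : G) {x : B} {v : ℕ} (hx : x ∈ maximalIdeal B ^ v) :
    δ • x ∈ maximalIdeal B ^ v := by
  have h : (maximalIdeal B ^ v).map (MulSemiringAction.toRingHom G B δ) ≤ maximalIdeal B ^ v := by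
    rw [Ideal.map_pow]
    refine Ideal.pow_right_mono (Ideal.map_le_iff_le_comap.2 fun y hy => ?_) v
    rw [Ideal.mem_comap, mem_maximalIdeal, mem_nonunits_iff]
    intro hu
    have := hu.map (MulSemiringAction.toRingHom G B δ⁻¹)
    simp only [MulSemiringAction.toRingHom_apply, inv_smul_smul] at this
    exact hy this
  exact h (Ideal.mem_map_of_mem _ hx)

/-- A tame automorphism which is trivial on the residue field and on the cotangent space is
trivial. -/
theorem eq_one_of_smul_sub_mem {B G : Type*} [CommRing B] [IsDomain B] [IsDiscreteValuationRing B]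
    [Group G] [Finite G] [MulSemiringAction G B] [FaithfulSMul G B]
    (hcard : IsUnit ((Nat.card G : ℕ) : B)) {ω : B} (hω : maximalIdeal B = Ideal.span {ω}) {δ : G}
    (h1 : ∀ b : B, δ • b - b ∈ maximalIdeal B) (h2 : δ • ω - ω ∈ maximalIdeal B ^ 2) : δ = 1 := by
  set m := maximalIdeal B
  have hm : ∀ v, m ^ v = Ideal.span {ω ^ v} := fun v => by rw [hω, Ideal.span_singleton_pow]
  have hpow : ∀ v, ∃ w, δ • ω ^ v = ω ^ v + ω ^ (v + 1) * w := fun v => by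
    rw [hm, Ideal.mem_span_singleton] at h2
    obtain ⟨w, hw⟩ := h2
    have h3 : δ • ω = ω * (1 + ω * w) := by linear_combination hw
    obtain ⟨z, hz⟩ : ω * w ∣ (1 + ω * w) ^ v - 1 ^ v := by
      simpa using sub_dvd_pow_sub_pow (1 + ω * w) 1 v
    refine ⟨w * z, ?_⟩
    rw [smul_pow', h3, mul_pow]
    linear_combination ω ^ v * hz
  have hgr : ∀ v, ∀ y ∈ m ^ v, δ • y - y ∈ m ^ (v + 1) := fun v y hy => by
    rw [hm, Ideal.mem_span_singleton] at hy
    obtain ⟨u, rfl⟩ := hy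
    obtain ⟨w, hw⟩ := hpow v
    have h3 := h1 u
    rw [hω, Ideal.mem_span_singleton] at h3
    obtain ⟨z, hz⟩ := h3
    rw [hm, Ideal.mem_span_singleton, smul_mul', hw]
    exact ⟨z + w * δ • u, by linear_combination (ω ^ v) * hz⟩
  have key : ∀ v x, δ • x - x ∈ m ^ (v + 1) := by
    intro v
    induction v with
    | zero => simpa using h1
    | succ v ih =>
      intro x
      have h4 : ∀ i : ℕ, δ ^ i • x - x - i * (δ • x - x) ∈ m ^ (v + 2) := by
        intro i
        induction i with
        | zero => simp
        | succ i ihi =>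
          have e1 := smul_mem_maximalIdeal_pow δ ihi
          have e2 := Ideal.mul_mem_left _ (i : B) (hgr _ _ (ih x))
          have := Ideal.add_mem _ e1 e2
          have hi : δ • (i : B) = i := map_natCast (MulSemiringAction.toRingHom G B δ) i
          convert this using 1
          rw [pow_succ', mul_smul, smul_sub, smul_sub, smul_mul', hi]
          push_cast
          ring
      have h5 := h4 (Nat.card G)
      rw [pow_card_eq_one', one_smul, sub_self, zero_sub, Ideal.neg_mem_iff] at h5
      exact (Ideal.unit_mul_mem_iff_mem _ hcard).1 h5
  refine FaithfulSMul.eq_of_smul_eq_smul (α := B) fun x => ?_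
  rw [one_smul, ← sub_eq_zero]
  have : δ • x - x ∈ (⨅ i, m ^ i : Ideal B) := by
    rw [Ideal.mem_iInf]
    intro i
    exact Ideal.pow_le_pow_right (Nat.le_succ i) (key i x)
  rwa [Ideal.iInf_pow_eq_bot_of_isLocalRing m (maximalIdeal.isMaximal B).ne_top] at this

theorem exists_smul_eq_mul {B G : Type*} [CommRing B] [IsLocalRing B] [Group G]
    [MulSemiringAction G B] {ω : B} (hω : maximalIdeal B = Ideal.span {ω}) (δ : G) :
    ∃ c, δ • ω = c * ω := by
  have : δ • ω ∈ maximalIdeal B ^ 1 :=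
    smul_mem_maximalIdeal_pow δ (by rw [pow_one, hω]; exact Ideal.mem_span_singleton_self ω)
  rw [pow_one, hω] at this
  obtain ⟨c, hc⟩ := Ideal.mem_span_singleton'.1 this
  exact ⟨c, hc.symm⟩

theorem card_inertia_dvd {B G : Type*} [CommRing B] [IsDomain B] [IsDiscreteValuationRing B]
    [Group G] [Finite G] [MulSemiringAction G B] [FaithfulSMul G B]
    (hcard : IsUnit ((Nat.card G : ℕ) : B)) {ω : B} (hω : maximalIdeal B = Ideal.span {ω})
    (I : Subgroup G) (hI : ∀ δ ∈ I, ∀ b : B, δ • b - b ∈ maximalIdeal B) :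
    Nat.card I ∣ Nat.card (ResidueField B) - 1 := by
  have hω0 : ω ≠ 0 := fun h => IsDiscreteValuationRing.not_a_field B (by rw [hω, h]; simp)
  choose c hc using fun δ : G => exists_smul_eq_mul hω δ
  have hres : ∀ δ ∈ I, ∀ b : B, residue B (δ • b) = residue B b := fun δ hδ b => by
    rw [← sub_eq_zero, ← map_sub, residue_eq_zero_iff]
    exact hI δ hδ b
  let F : I →* ResidueField B :=
    { toFun := fun δ => residue B (c δ)
      map_one' := by
        have : c (1 : G) = 1 := mul_right_cancel₀ hω0 (by rw [← hc, one_smul, one_mul])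
        simp [this]
      map_mul' := fun δ δ' => by
        have : c ((δ : G) * δ') = (δ : G) • c δ' * c δ := mul_right_cancel₀ hω0 (by
          rw [← hc, mul_smul, hc δ', smul_mul', hc δ, mul_assoc])
        rw [Subgroup.coe_mul, this, map_mul, hres _ δ.2, mul_comm] }
  rw [← Nat.card_units]
  refine Subgroup.card_dvd_of_injective F.toHomUnits ((injective_iff_map_eq_one _).2 fun δ hδ => ?_)
  have h1 : residue B (c δ) = 1 := congrArg Units.val hδ
  refine Subtype.ext (eq_one_of_smul_sub_mem hcard hω (hI δ δ.2) ?_)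
  rw [← sub_eq_zero, ← map_one (residue B), ← map_sub, residue_eq_zero_iff, hω,
    Ideal.mem_span_singleton] at h1
  obtain ⟨w, hw⟩ := h1
  rw [hω, Ideal.span_singleton_pow, Ideal.mem_span_singleton]
  exact ⟨w, by rw [hc]; linear_combination ω * hw⟩

theorem natCard_quotient_map {O B : Type*} [CommRing O] [IsDomain O] [CommRing B] [Algebra O B]
    [Module.Finite O B] [Module.Free O B] (ϖ : O) :
    Nat.card (B ⧸ (Ideal.span {ϖ}).map (algebraMap O B)) =
      Nat.card (O ⧸ Ideal.span {ϖ}) ^ Module.finrank O B := by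
  let b := Module.Free.chooseBasis O B
  let F : B →+ (Module.Free.ChooseBasisIndex O B → O ⧸ Ideal.span {ϖ}) :=
    { toFun := fun x i => Ideal.Quotient.mk _ (b.repr x i)
      map_zero' := by ext; simp
      map_add' := fun x y => by ext; simp }
  have hsurj : Function.Surjective F := fun y => by
    choose z hz using fun i => Ideal.Quotient.mk_surjective (y i)
    refine ⟨∑ i, z i • b i, funext fun i => ?_⟩
    change Ideal.Quotient.mk _ (b.repr _ i) = _
    rw [b.repr_sum_self, hz]
  have hker : F.ker = ((Ideal.span {ϖ}).map (algebraMap O B)).toAddSubgroup := by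
    ext x
    have := mem_span_algebraMap_pow_iff b ϖ 1 x
    simp only [pow_one] at this
    rw [Submodule.mem_toAddSubgroup, this, AddMonoidHom.mem_ker, funext_iff]
    exact forall_congr' fun i => Ideal.Quotient.eq_zero_iff_mem
  have h2 := Nat.card_congr (QuotientAddGroup.quotientKerEquivOfSurjective F hsurj).toEquiv
  rw [hker, Nat.card_fun, ← Module.finrank_eq_nat_card_basis b] at h2
  exact h2

/-- Structure of tamely ramified Galois extensions of complete discrete valuation rings. -/
theorem exists_ramification {O B G : Type*} [CommRing O] [IsDomain O] [IsDiscreteValuationRing O]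
    [Finite (ResidueField O)] [CommRing B] [IsDomain B] [IsDiscreteValuationRing B] [Algebra O B]
    [Module.Finite O B] [Module.Free O B] [FaithfulSMul O B]
    [Group G] [Finite G] [MulSemiringAction G B] [FaithfulSMul G B] [SMulCommClass G O B]
    [Algebra.IsInvariant O B G] (hrank : Module.finrank O B = Nat.card G)
    (hcard : IsUnit ((Nat.card G : ℕ) : B)) {ϖ : O} (hϖ : maximalIdeal O = Ideal.span {ϖ})
    {ω : B} (hω : maximalIdeal B = Ideal.span {ω}) :
    ∃ (ε : B) (e f : ℕ), IsUnit ε ∧ algebraMap O B ϖ = ε * ω ^ e ∧ e * f = Nat.card G ∧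
      Nat.card (ResidueField B) = Nat.card (ResidueField O) ^ f ∧
      e ∣ Nat.card (ResidueField O) ^ f - 1 ∧
      (∃ φ : G, ∀ b : B, φ • b - b ^ Nat.card (ResidueField O) ∈ maximalIdeal B) ∧
      ∀ δ : G, ∃ i < f, ∀ b : B, δ • b - b ^ Nat.card (ResidueField O) ^ i ∈ maximalIdeal B := by
  have hω0 : ω ≠ 0 := fun h => IsDiscreteValuationRing.not_a_field B (by rw [hω, h]; simp)
  have hϖ0 : ϖ ≠ 0 := fun h => IsDiscreteValuationRing.not_a_field O (by rw [hϖ, h]; simp)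
  have hirr : Irreducible ω := (IsDiscreteValuationRing.irreducible_iff_uniformizer ω).2 hω
  obtain ⟨e, u, hu⟩ := IsDiscreteValuationRing.associated_pow_irreducible
    (x := algebraMap O B ϖ) ((map_ne_zero_iff _ (FaithfulSMul.algebraMap_injective O B)).2 hϖ0) hirr
  have hmap : (maximalIdeal O).map (algebraMap O B) = maximalIdeal B ^ e := by
    rw [hϖ, hω, Ideal.map_span, Set.image_singleton, Ideal.span_singleton_pow,
      Ideal.span_singleton_eq_span_singleton]
    exact ⟨u, hu⟩
  have hint : Algebra.IsIntegral O B := inferInstance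
  have hlies : (maximalIdeal B).LiesOver (maximalIdeal O) :=
    ⟨(eq_maximalIdeal (Ideal.isMaximal_comap_of_isIntegral_of_isMaximal (maximalIdeal B))).symm⟩
  let : Field (O ⧸ maximalIdeal O) := Ideal.Quotient.field _
  let : Field (B ⧸ maximalIdeal B) := Ideal.Quotient.field _
  have : Finite (O ⧸ maximalIdeal O) := ‹Finite (ResidueField O)›
  have : Fintype (O ⧸ maximalIdeal O) := Fintype.ofFinite _
  have : Module.Finite (O ⧸ maximalIdeal O) (B ⧸ maximalIdeal B) := inferInstance
  have : Finite (B ⧸ maximalIdeal B) := Module.finite_of_finite (O ⧸ maximalIdeal O)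
  set q := Nat.card (O ⧸ maximalIdeal O) with hq
  set f := Module.finrank (O ⧸ maximalIdeal O) (B ⧸ maximalIdeal B) with hf
  have hqB : Nat.card (B ⧸ maximalIdeal B) = q ^ f := Module.natCard_eq_pow_finrank
  have hq1 : 1 < q := Finite.one_lt_card
  have hef : e * f = Nat.card G := by
    have h1 := natCard_quotient_map (B := B) ϖ
    rw [← hϖ, hmap, hrank] at h1
    have h2 := cardQuot_pow_of_prime (IsDiscreteValuationRing.not_a_field B) (i := e)
    rw [Submodule.cardQuot_apply, Submodule.cardQuot_apply, h1, hqB, ← pow_mul] at h2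
    rw [mul_comm, Nat.pow_right_injective hq1 h2]
  have hstab : MulAction.stabilizer G (maximalIdeal B) = ⊤ := by
    refine top_le_iff.1 fun δ _ => le_antisymm ?_ ?_
    · intro x hx
      rw [Ideal.mem_pointwise_smul_iff_inv_smul_mem] at hx
      have := smul_mem_maximalIdeal_pow (v := 1) δ ((pow_one (maximalIdeal B)).symm ▸ hx)
      rwa [smul_inv_smul, pow_one] at this
    · intro x hx
      rw [Ideal.mem_pointwise_smul_iff_inv_smul_mem]
      have := smul_mem_maximalIdeal_pow (v := 1) δ⁻¹ ((pow_one (maximalIdeal B)).symm ▸ hx)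
      rwa [pow_one] at this
  set F := Ideal.Quotient.stabilizerHom (maximalIdeal B) (maximalIdeal O) G
  have hsurj : Function.Surjective F :=
    Ideal.Quotient.stabilizerHom_surjective G (maximalIdeal O) (maximalIdeal B)
  have hker : Nat.card F.ker = e := by
    have h1 := Subgroup.card_mul_index F.ker
    rw [Subgroup.index_ker, MonoidHom.range_eq_top.2 hsurj, Subgroup.card_top,
      IsGalois.card_aut_eq_finrank] at h1
    have h2 : Nat.card (MulAction.stabilizer G (maximalIdeal B)) = Nat.card G := by
      rw [hstab, Subgroup.card_top]
    rw [h2, ← hef] at h1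
    exact Nat.eq_of_mul_eq_mul_right Module.finrank_pos h1
  obtain ⟨φ, hφ⟩ := hsurj (FiniteField.frobeniusAlgEquivOfAlgebraic (O ⧸ maximalIdeal O)
    (B ⧸ maximalIdeal B))
  refine ⟨↑u⁻¹, e, f, u⁻¹.isUnit, ?_, hef, hqB, ?_, ⟨φ, fun b => ?_⟩, fun δ => ?_⟩
  · rw [← hu, mul_comm, mul_assoc, Units.mul_inv, mul_one]
  · have h1 := card_inertia_dvd hcard hω (F.ker.map (Subgroup.subtype _)) (by
      rintro _ ⟨δ, hδ, rfl⟩ b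
      have h2 : F δ (Ideal.Quotient.mk _ b) = Ideal.Quotient.mk _ b := by
        rw [MonoidHom.mem_ker.1 hδ, AlgEquiv.one_apply]
      rw [Ideal.Quotient.stabilizerHom_apply, ← sub_eq_zero, ← map_sub,
        Ideal.Quotient.eq_zero_iff_mem] at h2
      exact h2)
    rw [Subgroup.card_map_of_injective (Subgroup.subtype_injective _), hker] at h1
    have h3 : Nat.card (ResidueField B) = q ^ f := hqB
    rwa [h3] at h1
  · have h1 := DFunLike.congr_fun hφ (Ideal.Quotient.mk _ b)
    rw [Ideal.Quotient.stabilizerHom_apply, FiniteField.coe_frobeniusAlgEquivOfAlgebraic,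
      Fintype.card_eq_nat_card] at h1
    change _ = (Ideal.Quotient.mk _ b) ^ _ at h1
    rw [← map_pow, ← sub_eq_zero, ← map_sub,
      Ideal.Quotient.eq_zero_iff_mem] at h1
    exact h1
  · obtain ⟨i, hi⟩ := (FiniteField.bijective_frobeniusAlgEquivOfAlgebraic_pow (O ⧸ maximalIdeal O)
      (B ⧸ maximalIdeal B)).2 (F ⟨δ, hstab ▸ Subgroup.mem_top δ⟩)
    refine ⟨i, i.2, fun b => ?_⟩
    have h1 := DFunLike.congr_fun hi (Ideal.Quotient.mk _ b)
    simp only [AlgEquiv.coe_pow, FiniteField.coe_frobeniusAlgEquivOfAlgebraic_iterate,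
      Fintype.card_eq_nat_card] at h1
    rw [Ideal.Quotient.stabilizerHom_apply, ← map_pow, eq_comm, ← sub_eq_zero, ← map_sub,
      Ideal.Quotient.eq_zero_iff_mem] at h1
    exact h1

end Ramification

section Roots

open IsLocalRing

theorem exists_injective_pow_eq {k : Type*} [Field k] [IsAlgClosed k] {e : ℕ} (he : (e : k) ≠ 0)
    {a : k} (ha : a ≠ 0) : ∃ z : Fin e → k, Function.Injective z ∧ ∀ i, z i ^ e = a := by
  have hsep : (X ^ e - C a : k[X]).Separable := separable_X_pow_sub_C a he ha
  have h1 := card_rootSet_eq_natDegree (K := k) hsep (IsAlgClosed.splits _)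
  rw [natDegree_X_pow_sub_C] at h1
  let g := (Fintype.equivFinOfCardEq h1).symm
  refine ⟨fun i => g i, Subtype.val_injective.comp g.injective, fun i => ?_⟩
  have := aeval_eq_zero_of_mem_rootSet (g i).2
  simpa [sub_eq_zero] using this

theorem mem_range_of_pow_card_eq {B k : Type*} [CommRing B] [IsLocalRing B]
    [Finite (ResidueField B)] [Field k] (ψ : B →+* k) (hψ : RingHom.ker ψ = maximalIdeal B)
    {z : k} (hz : z ^ Nat.card (ResidueField B) = z) : ∃ b, ψ b = z := by
  classical
  have : Fintype (ResidueField B) := Fintype.ofFinite _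
  let ψ' : ResidueField B →+* k := Ideal.Quotient.lift (maximalIdeal B) ψ fun a ha => by
    rwa [← hψ] at ha
  set Q := Nat.card (ResidueField B) with hQ
  have hQ1 : 1 < Q := Finite.one_lt_card
  have hne : (X ^ Q - X : k[X]) ≠ 0 := FiniteField.X_pow_card_sub_X_ne_zero _ hQ1
  have hsub : Finset.univ.image ψ' ⊆ (X ^ Q - X : k[X]).roots.toFinset := fun x hx => by
    obtain ⟨a, -, rfl⟩ := Finset.mem_image.1 hx
    rw [Multiset.mem_toFinset, mem_roots hne]
    simp only [IsRoot.def, eval_sub, eval_pow, eval_X]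
    rw [← map_pow, hQ, Nat.card_eq_fintype_card, FiniteField.pow_card, sub_self]
  have heq := Finset.eq_of_subset_of_card_le hsub (by
    rw [Finset.card_image_of_injective _ ψ'.injective, Finset.card_univ]
    refine (Multiset.toFinset_card_le _).trans ((card_roots' _).trans ?_)
    rw [FiniteField.X_pow_card_sub_X_natDegree_eq _ hQ1, hQ, Nat.card_eq_fintype_card])
  have hmem : z ∈ (X ^ Q - X : k[X]).roots.toFinset := by
    rw [Multiset.mem_toFinset, mem_roots hne]
    simp [hz]
  rw [← heq] at hmem
  obtain ⟨a, -, rfl⟩ := Finset.mem_image.1 hmem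
  obtain ⟨b, rfl⟩ := Ideal.Quotient.mk_surjective a
  exact ⟨b, rfl⟩

/-- The roots of `f₀ ^ e - ϖ h₀ + ϖ ^ 2 r₀` over a tame extension with ramification index `e`. -/
theorem exists_roots_of_tame {O B G k : Type*} [CommRing O] [IsDomain O]
    [IsDiscreteValuationRing O] [Finite (ResidueField O)] [CommRing B] [IsDomain B]
    [IsDiscreteValuationRing B] [IsAdicComplete (maximalIdeal B) B] [Algebra O B]
    [Module.Finite O B] [Module.Free O B] [FaithfulSMul O B]
    [Group G] [Finite G] [MulSemiringAction G B] [FaithfulSMul G B] [SMulCommClass G O B]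
    [Algebra.IsInvariant O B G] (hrank : Module.finrank O B = Nat.card G)
    (hcard : IsUnit ((Nat.card G : ℕ) : B)) {ϖ : O} (hϖ : maximalIdeal O = Ideal.span {ϖ})
    [Field k] [IsAlgClosed k] (ψ : B →+* k) (hψ : RingHom.ker ψ = maximalIdeal B) :
    ∃ (e f : ℕ) (ρ : k), e * f = Nat.card G ∧ ρ ^ e = 1 ∧
      ρ ^ Nat.card (ResidueField O) = ρ ∧
      ∀ (f₀ h₀ r₀ : O[X]) {κ : Type} [Fintype κ] (b y : κ → k), Function.Injective b →
        f₀.map (ψ.comp (algebraMap O B)) = ∏ i, (X - C (b i)) →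
        (∀ i, b i ^ Nat.card (ResidueField O) ^ f = b i) →
        (∀ i j, 0 < j → j < f → b i ^ Nat.card (ResidueField O) ^ j ≠ b i) →
        (∀ i, y i ≠ 0) → (∀ i, y i ^ Nat.card (ResidueField O) ^ f = ρ * y i) →
        (∀ i, h₀.eval₂ (ψ.comp (algebraMap O B)) (b i) =
          (y i * f₀.derivative.eval₂ (ψ.comp (algebraMap O B)) (b i)) ^ e) →
        ∃ β : κ × Fin e → B, Function.Injective β ∧
          (∀ i, (f₀ ^ e - C ϖ * h₀ + C (ϖ ^ 2) * r₀).eval₂ (algebraMap O B) (β i) = 0) ∧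
          ∀ (δ : G) i, δ • β i = β i → δ = 1 := by
  obtain ⟨ω, hω⟩ : ∃ ω, maximalIdeal B = Ideal.span {ω} :=
    (IsPrincipalIdealRing.principal (maximalIdeal B)).principal
  have hω0 : ω ≠ 0 := fun h => IsDiscreteValuationRing.not_a_field B (by rw [hω, h]; simp)
  obtain ⟨ε, e, f, hε, hϖε, hef, hQ, hdvd, ⟨φ, hφ⟩, hgal⟩ :=
    exists_ramification hrank hcard hϖ hω
  set q := Nat.card (ResidueField O) with hq
  have hker : ∀ x, ψ x = 0 ↔ x ∈ maximalIdeal B := fun x => by rw [← hψ, RingHom.mem_ker]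
  have hψu : ∀ x, IsUnit x ↔ ψ x ≠ 0 := fun x => by
    rw [Ne, hker, mem_maximalIdeal, mem_nonunits_iff, not_not]
  have hψω : ψ ω = 0 := (hker ω).2 (hω ▸ Ideal.mem_span_singleton_self ω)
  have hQpos : 0 < q ^ f := by
    have : 0 < q := Nat.card_pos
    positivity
  have hfin : Finite (ResidueField B) := Nat.finite_of_card_ne_zero (by rw [hQ]; exact hQpos.ne')
  have hGpos : 0 < Nat.card G := Nat.card_pos
  have he0 : e ≠ 0 := by rintro rfl; simp at hef; omega
  have hf0 : 0 < f := Nat.pos_of_ne_zero (by rintro rfl; simp at hef; omega)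
  have hek : (e : k) ≠ 0 := by
    have h1 := (hψu _).1 hcard
    rw [map_natCast, ← hef, Nat.cast_mul] at h1
    exact left_ne_zero_of_mul h1
  have hfrob : ∀ x : B, ψ x ≠ 0 → ψ x ^ (q ^ f - 1) = 1 := fun x hx => by
    have : Fintype (ResidueField B) := Fintype.ofFinite _
    have h1 := FiniteField.pow_card_sub_one_eq_one (residue B x) (by
      rwa [Ne, residue_eq_zero_iff, ← hker])
    rw [← Nat.card_eq_fintype_card, hQ, ← map_pow, ← map_one (residue B), ← sub_eq_zero, ← map_sub,
      residue_eq_zero_iff, ← hker, map_sub, sub_eq_zero, map_pow, map_one] at h1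
    exact h1
  obtain ⟨n, hn⟩ := hdvd
  have hε0 : ψ ε ≠ 0 := (hψu ε).1 hε
  refine ⟨e, f, (ψ ε ^ n)⁻¹, hef, ?_, ?_, ?_⟩
  · rw [inv_pow, ← pow_mul, mul_comm, ← hn, hfrob ε hε0, inv_one]
  · obtain ⟨c, hc⟩ := exists_smul_eq_mul hω φ
    have h1 : φ • ε * c ^ e = ε := by
      have h2 : φ • algebraMap O B ϖ = algebraMap O B ϖ := smul_algebraMap φ ϖ
      rw [hϖε, smul_mul', smul_pow', hc, mul_pow, ← mul_assoc] at h2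
      exact mul_right_cancel₀ (pow_ne_zero e hω0) h2
    have h3 : ψ ε ^ q * ψ c ^ e = ψ ε := by
      have h4 : ψ (φ • ε) = ψ ε ^ q := by
        rw [← sub_eq_zero, ← map_pow, ← map_sub, hker]
        exact hφ ε
      rw [← h4, ← map_pow, ← map_mul, h1]
    have hc0 : ψ c ≠ 0 := fun h => hε0 (by rw [← h3, h, zero_pow he0, mul_zero])
    have h5 : (ψ ε ^ n) ^ q = ψ ε ^ n := by
      conv_rhs => rw [← h3, mul_pow, ← pow_mul (ψ c), ← hn, hfrob c hc0, mul_one]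
      rw [← pow_mul, ← pow_mul, mul_comm]
    rw [inv_pow, h5]
  intro f₀ h₀ r₀ κ _ b y hb hfb hbf hbj hy0 hy hh
  set ψ₀ := ψ.comp (algebraMap O B) with hψ₀
  -- lifts of the nodes
  have hder : ∀ i, f₀.derivative.eval₂ ψ₀ (b i) ≠ 0 := fun i => by
    classical
    rw [← eval_map, ← derivative_map, hfb, ← Finset.mul_prod_erase _ _ (Finset.mem_univ i),
      derivative_mul]
    simp only [derivative_sub, derivative_X, derivative_C, sub_zero, one_mul, eval_add, eval_mul,
      eval_sub, eval_X, eval_C, sub_self, zero_mul, add_zero, eval_prod]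
    refine Finset.prod_ne_zero_iff.2 fun j hj => sub_ne_zero.2 fun h => ?_
    exact (Finset.mem_erase.1 hj).1 (hb h).symm
  have hev : ∀ (p : O[X]) (x : B), ψ (p.eval₂ (algebraMap O B) x) = p.eval₂ ψ₀ (ψ x) :=
    fun p x => hom_eval₂ p _ _ _
  have hlift : ∀ i, ∃ x : B, f₀.eval₂ (algebraMap O B) x = 0 ∧ ψ x = b i := fun i => by
    obtain ⟨x₀, hx₀⟩ := mem_range_of_pow_card_eq ψ hψ (by rw [hQ]; exact hbf i)
    obtain ⟨x, hx, hxx⟩ := exists_isRoot_of_isAdicComplete (f₀.map (algebraMap O B)) x₀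
      (by
        rw [eval_map, ← hker, hev, hx₀, ← eval_map, hfb, eval_prod]
        exact Finset.prod_eq_zero (Finset.mem_univ i) (by simp))
      (by rw [derivative_map, eval_map, hψu, hev, hx₀]; exact hder i)
    refine ⟨x, by rwa [IsRoot.def, eval_map] at hx, ?_⟩
    rw [← hx₀, ← sub_eq_zero, ← map_sub, hker]
    exact hxx
  choose x hx hxb using hlift
  have hfac : ∀ i, ∃ g : B[X], f₀.map (algebraMap O B) = (X - C (x i)) * g := fun i =>
    dvd_iff_isRoot.2 (by rw [IsRoot.def, eval_map, hx])
  choose g hg using hfac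
  have hgb : ∀ i, (g i).eval₂ ψ (b i) = f₀.derivative.eval₂ ψ₀ (b i) := fun i => by
    have h1 := congrArg (fun p => ψ ((derivative p).eval (x i))) (hg i)
    simp only [derivative_map, eval_map, hev, hxb, derivative_mul, derivative_sub, derivative_X,
      derivative_C, sub_zero, one_mul, eval_add, eval_mul, eval_sub, eval_X, eval_C, sub_self,
      zero_mul, add_zero] at h1
    rw [h1, ← hxb, eval₂_hom]
  choose z hzinj hz using fun i => exists_injective_pow_eq hek
    (mul_ne_zero hε0 (pow_ne_zero e (hy0 i)))
  have hz0 : ∀ i j, z i j ≠ 0 := fun i j h => by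
    have h1 := hz i j
    rw [h, zero_pow he0] at h1
    exact mul_ne_zero hε0 (pow_ne_zero e (hy0 i)) h1.symm
  -- lifts of the tangent directions
  have hZ : ∀ i j, ∃ Z : B, ψ Z = z i j ∧
      (f₀ ^ e - C ϖ * h₀ + C (ϖ ^ 2) * r₀).eval₂ (algebraMap O B) (x i + ω * Z) = 0 := by
    intro i j
    obtain ⟨Z₀, hZ₀⟩ := mem_range_of_pow_card_eq ψ hψ (z := z i j) (by
      rw [hQ]
      have h1 : z i j ^ (q ^ f - 1) = 1 := by
        have hy1 : y i ^ (q ^ f - 1) = (ψ ε ^ n)⁻¹ := by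
          refine mul_right_cancel₀ (hy0 i) ?_
          rw [← pow_succ, Nat.sub_add_cancel hQpos, hy]
        rw [hn, pow_mul, hz, mul_pow, ← pow_mul, ← hn, hy1]
        exact mul_inv_cancel₀ (pow_ne_zero n hε0)
      conv_lhs => rw [← Nat.sub_add_cancel hQpos, pow_succ, h1, one_mul])
    let s : B[X] := C (x i) + C ω * X
    let P : B[X] := X ^ e * (g i).comp s ^ e - C ε * (h₀.map (algebraMap O B)).comp s +
      C (ε ^ 2 * ω ^ e) * (r₀.map (algebraMap O B)).comp s
    have hPs : (f₀.map (algebraMap O B) ^ e - C (algebraMap O B ϖ) * h₀.map (algebraMap O B) +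
        C (algebraMap O B ϖ ^ 2) * r₀.map (algebraMap O B)).comp s = C (ω ^ e) * P := by
      simp only [add_comp, sub_comp, mul_comp, pow_comp, C_comp, hg i, X_comp, hϖε, P, s]
      simp only [map_mul, map_pow]
      ring
    have hsψ : s.map ψ = C (b i) := by simp [s, hxb, hψω]
    have hcomp : ∀ p : B[X], (p.comp s).map ψ = C (p.eval₂ ψ (b i)) := fun p => by
      rw [Polynomial.map_comp, hsψ, comp_C, eval_map]
    have hPψ : P.map ψ = C (f₀.derivative.eval₂ ψ₀ (b i) ^ e) * X ^ e -
        C (ψ ε * (y i * f₀.derivative.eval₂ ψ₀ (b i)) ^ e) := by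
      have h1 : ψ (ε ^ 2 * ω ^ e) = 0 := by rw [map_mul, map_pow ψ ω, hψω, zero_pow he0, mul_zero]
      simp only [P, Polynomial.map_add, Polynomial.map_sub, Polynomial.map_mul, Polynomial.map_pow,
        map_X, map_C, hcomp, hgb, h1, map_zero, zero_mul, add_zero, eval₂_map]
      rw [← hh, ← hψ₀]
      simp only [map_mul, map_pow]
      ring
    obtain ⟨Z, hZr, hZZ⟩ := exists_isRoot_of_isAdicComplete P Z₀
      (by
        rw [← hker, ← eval₂_hom, hZ₀, ← eval_map, hPψ]
        simp only [eval_sub, eval_mul, eval_C, eval_pow, eval_X, hz]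
        ring)
      (by
        rw [hψu, ← eval₂_hom, hZ₀, ← eval_map, ← derivative_map, hPψ]
        simp only [derivative_sub, derivative_C_mul, derivative_X_pow, derivative_C, sub_zero,
          eval_mul, eval_C, eval_pow, eval_X]
        exact mul_ne_zero (pow_ne_zero _ (hder i)) (mul_ne_zero hek (pow_ne_zero _ (hz0 i j))))
    refine ⟨Z, ?_, ?_⟩
    · rw [← hZ₀, ← sub_eq_zero, ← map_sub, hker]
      exact hZZ
    · have h1 := congrArg (eval Z) hPs
      rw [eval_mul, hZr.eq_zero, mul_zero, eval_comp] at h1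
      rw [← eval_map]
      simpa [s] using h1
  choose Z hZz hZP using hZ
  refine ⟨fun p => x p.1 + ω * Z p.1 p.2, fun p p' hpp => ?_, fun p => hZP _ _, fun δ p hδ => ?_⟩
  · have h1 := congrArg ψ hpp
    simp only [map_add, map_mul, hψω, zero_mul, add_zero, hxb] at h1
    obtain ⟨i, j⟩ := p
    obtain ⟨i', j'⟩ := p'
    obtain rfl : i = i' := hb h1
    have h2 : Z i j = Z i j' := mul_left_cancel₀ hω0 (add_left_cancel hpp)
    have h3 : z i j = z i j' := by rw [← hZz, ← hZz, h2]
    rw [hzinj i h3]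
  · obtain ⟨i, j⟩ := p
    simp only at hδ
    obtain ⟨l, hl, hδl⟩ := hgal δ
    have hψβ : ψ (x i + ω * Z i j) = b i := by
      rw [map_add, map_mul, hψω, zero_mul, add_zero, hxb]
    have hl0 : l = 0 := by
      by_contra hne
      refine hbj i l (Nat.pos_of_ne_zero hne) hl ?_
      have h1 := hδl (x i + ω * Z i j)
      rw [hδ, ← hker, map_sub, map_pow, hψβ, sub_eq_zero] at h1
      exact h1.symm
    subst hl0
    simp only [pow_zero, pow_one] at hδl
    have hψδ : ∀ t, ψ (δ • t) = ψ t := fun t => by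
      rw [← sub_eq_zero, ← map_sub, hker]
      exact hδl t
    have hxδ : δ • x i = x i := by
      have h1 : (f₀.map (algebraMap O B)).eval (δ • x i) = 0 := by
        have h2 := congrArg (fun t => MulSemiringAction.toAlgHom O B δ t) (hx i)
        simp only [map_zero] at h2
        rw [eval_map]
        rw [← aeval_def, ← aeval_algHom_apply, aeval_def] at h2
        exact h2
      rw [hg, eval_mul] at h1
      have h3 : (g i).eval (δ • x i) ≠ 0 := fun h => hder i (by
        rw [← hgb, ← hxb i, ← hψδ, eval₂_hom, h, map_zero])
      have h4 := (mul_eq_zero.1 h1).resolve_right h3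
      rw [← sub_eq_zero]
      simpa using h4
    obtain ⟨c, hc⟩ := exists_smul_eq_mul hω δ
    rw [smul_add, smul_mul', hxδ, hc] at hδ
    have h5 : c * δ • Z i j = Z i j := mul_left_cancel₀ hω0 (by
      have := add_left_cancel hδ
      rw [← this]
      ring)
    have h6 : ψ c = 1 := by
      have h7 := congrArg ψ h5
      rw [map_mul, hψδ, hZz] at h7
      exact mul_right_cancel₀ (hz0 i j) (by rw [h7, one_mul])
    refine eq_one_of_smul_sub_mem hcard hω hδl ?_
    have h8 : c - 1 ∈ maximalIdeal B := by rw [← hker, map_sub, h6, map_one, sub_self]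
    rw [hω, Ideal.mem_span_singleton] at h8
    obtain ⟨w, hw⟩ := h8
    rw [hω, Ideal.span_singleton_pow, Ideal.mem_span_singleton, hc]
    exact ⟨w, by linear_combination ω * hw⟩

end Roots

section CompleteField

open IsLocalRing

theorem isDiscreteValuationRing_of_finite {O B : Type*} [CommRing O] [IsDomain O]
    [IsDiscreteValuationRing O] [IsAdicComplete (maximalIdeal O) O] [Finite (ResidueField O)]
    [CommRing B] [IsDedekindDomain B] [Algebra O B] [Module.Finite O B]
    [Module.Free O B] [FaithfulSMul O B] :
    ∃ _ : IsDiscreteValuationRing B, IsAdicComplete (maximalIdeal B) B := by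
  obtain ⟨ϖ, hϖ⟩ : ∃ ϖ, maximalIdeal O = Ideal.span {ϖ} :=
    (IsPrincipalIdealRing.principal (maximalIdeal O)).principal
  have hϖ0 : ϖ ≠ 0 := fun h => IsDiscreteValuationRing.not_a_field O (by rw [hϖ, h]; simp)
  set I := (maximalIdeal O).map (algebraMap O B) with hI
  have hcomp : IsAdicComplete I B := isAdicComplete_map_of_finite _
  have hfin : Finite (B ⧸ I) := by
    refine Nat.finite_of_card_ne_zero ?_
    rw [hI, hϖ, natCard_quotient_map, ← hϖ]
    have : Finite (O ⧸ maximalIdeal O) := ‹Finite (ResidueField O)›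
    exact pow_ne_zero _ Nat.card_pos.ne'
  have hloc : IsLocalRing B := isLocalRing_of_isAdicComplete I
  have hinj := FaithfulSMul.algebraMap_injective O B
  have hI0 : I ≠ ⊥ := fun h => by
    rw [hI, Ideal.map_eq_bot_iff_of_injective hinj] at h
    exact IsDiscreteValuationRing.not_a_field O h
  have hI1 : I ≠ ⊤ := fun h => by
    rw [hI, hϖ, Ideal.map_span, Set.image_singleton, Ideal.span_singleton_eq_top] at h
    have h1 : algebraMap O B ϖ ∈ (⊥ : Ideal B).jacobson :=
      IsAdicComplete.le_jacobson_bot I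
        (Ideal.mem_map_of_mem _ (hϖ ▸ Ideal.mem_span_singleton_self ϖ))
    rw [IsLocalRing.jacobson_eq_maximalIdeal ⊥ bot_ne_top] at h1
    exact h1 h
  have hIle : I ≤ maximalIdeal B := IsLocalRing.le_maximalIdeal hI1
  have hnf : ¬ IsField B := fun hf => by
    have : maximalIdeal B = ⊥ := isField_iff_maximalIdeal_eq.1 hf
    exact hI0 (le_bot_iff.1 (this ▸ hIle))
  have hdvr : IsDiscreteValuationRing B := ((IsDiscreteValuationRing.TFAE B hnf).out 0 2).2 ‹_›
  obtain ⟨n, hn⟩ := exists_maximalIdeal_pow_eq_of_principal B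
    (IsPrincipalIdealRing.principal (maximalIdeal B)) I hI0
  exact ⟨hdvr, isAdicComplete_of_pow_le hIle hn.ge⟩

theorem exists_roots_of_tame_field {O Ω L k : Type*} [CommRing O] [IsDomain O]
    [IsDiscreteValuationRing O] [IsAdicComplete (maximalIdeal O) O] [Finite (ResidueField O)]
    [Field Ω] [Algebra O Ω] [IsFractionRing O Ω] [Field L] [Algebra Ω L]
    [FiniteDimensional Ω L] [IsGalois Ω L] [Algebra O L] [IsScalarTower O Ω L]
    (hcard : IsUnit ((Nat.card (L ≃ₐ[Ω] L) : ℕ) : O)) {ϖ : O}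
    (hϖ : maximalIdeal O = Ideal.span {ϖ})
    [Field k] [IsAlgClosed k] (ψ : O →+* k) (hψ : RingHom.ker ψ = maximalIdeal O) :
    ∃ (e f : ℕ) (ρ : k), e * f = Nat.card (L ≃ₐ[Ω] L) ∧ ρ ^ e = 1 ∧
      ρ ^ Nat.card (ResidueField O) = ρ ∧
      ∀ (f₀ h₀ r₀ : O[X]) {κ : Type} [Fintype κ] (b y : κ → k), Function.Injective b →
        f₀.map ψ = ∏ i, (X - C (b i)) →
        (∀ i, b i ^ Nat.card (ResidueField O) ^ f = b i) →
        (∀ i j, 0 < j → j < f → b i ^ Nat.card (ResidueField O) ^ j ≠ b i) →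
        (∀ i, y i ≠ 0) → (∀ i, y i ^ Nat.card (ResidueField O) ^ f = ρ * y i) →
        (∀ i, h₀.eval₂ ψ (b i) = (y i * f₀.derivative.eval₂ ψ (b i)) ^ e) →
        ∃ β : κ × Fin e → L, Function.Injective β ∧
          (∀ i, (f₀ ^ e - C ϖ * h₀ + C (ϖ ^ 2) * r₀).eval₂ (algebraMap O L) (β i) = 0) ∧
          ∀ (δ : L ≃ₐ[Ω] L) i, δ (β i) = β i → δ = 1 := by
  have hinjL : Function.Injective (algebraMap O L) := by
    rw [IsScalarTower.algebraMap_eq O Ω L]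
    exact (algebraMap Ω L).injective.comp (IsFractionRing.injective O Ω)
  have : FaithfulSMul O L := (faithfulSMul_iff_algebraMap_injective O L).2 hinjL
  have : IsDedekindDomain (integralClosure O L) := integralClosure.isDedekindDomain O Ω L
  have : Module.Finite O (integralClosure O L) := IsIntegralClosure.finite O Ω L _
  have : Module.Free O (integralClosure O L) := IsIntegralClosure.module_free O Ω L _
  have : IsFractionRing (integralClosure O L) L :=
    integralClosure.isFractionRing_of_finite_extension Ω L
  have hrank : Module.finrank O (integralClosure O L) = Nat.card (L ≃ₐ[Ω] L) := by
    rw [IsIntegralClosure.rank O Ω L, IsGalois.card_aut_eq_finrank]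
  obtain ⟨_, _⟩ := isDiscreteValuationRing_of_finite (O := O) (B := integralClosure O L)
  let _ := IsIntegralClosure.MulSemiringAction O Ω L (integralClosure O L)
  have hsmul : ∀ (δ : L ≃ₐ[Ω] L) (b : integralClosure O L), ((δ • b : integralClosure O L) : L)
      = δ b := fun δ b => algebraMap_galRestrict_apply O δ b
  have : Algebra.IsInvariant O (integralClosure O L) (L ≃ₐ[Ω] L) :=
    Algebra.isInvariant_of_isGalois O Ω L _
  have : FaithfulSMul (L ≃ₐ[Ω] L) (integralClosure O L) := ⟨fun {δ δ'} h => by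
    refine AlgEquiv.ext fun x => ?_
    obtain ⟨a, b, -, rfl⟩ := IsFractionRing.div_surjective (A := integralClosure O L) x
    have h1 : ∀ c : integralClosure O L, δ (c : L) = δ' (c : L) := fun c => by
      rw [← hsmul, ← hsmul, h]
    change δ ((a : L) / b) = δ' ((a : L) / b)
    rw [map_div₀, map_div₀, h1, h1]⟩
  have : SMulCommClass (L ≃ₐ[Ω] L) O (integralClosure O L) := ⟨fun δ a b => by
    refine Subtype.ext ?_
    rw [hsmul]
    change δ (a • (b : L)) = a • ((δ • b : integralClosure O L) : L)
    rw [hsmul, ← algebraMap_smul Ω a (b : L), map_smul, algebraMap_smul]⟩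
  obtain ⟨ψ', hψ'⟩ := exists_extension_of_isIntegral (B := integralClosure O L)
    (FaithfulSMul.algebraMap_injective _ _) ψ
  have hcomp : ψ'.comp (algebraMap O (integralClosure O L)) = ψ := RingHom.ext hψ'
  have hker : RingHom.ker ψ' = maximalIdeal (integralClosure O L) := by
    have hp : (RingHom.ker ψ').IsPrime := RingHom.ker_isPrime ψ'
    have hne : RingHom.ker ψ' ≠ ⊥ := fun h => by
      refine IsDiscreteValuationRing.not_a_field O ?_
      rw [← hψ, ← hcomp, ← RingHom.comap_ker, h]
      exact (RingHom.injective_iff_ker_eq_bot _).1 (FaithfulSMul.algebraMap_injective _ _)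
    exact IsLocalRing.eq_maximalIdeal (hp.isMaximal hne)
  obtain ⟨e, f, ρ, hef, hρe, hρq, H⟩ := exists_roots_of_tame hrank
    (by simpa using hcard.map (algebraMap O (integralClosure O L))) hϖ ψ' hker
  rw [hcomp] at H
  refine ⟨e, f, ρ, hef, hρe, hρq, fun f₀ h₀ r₀ κ _ b y hb hfb hbf hbj hy0 hy hh => ?_⟩
  obtain ⟨β, hβ, hr, hD⟩ := H f₀ h₀ r₀ b y hb hfb hbf hbj hy0 hy hh
  refine ⟨fun i => β i, Subtype.val_injective.comp hβ, fun i => ?_, fun δ i h =>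
    hD δ i (Subtype.ext (by rw [hsmul]; exact h))⟩
  have h1 := congrArg (algebraMap (integralClosure O L) L) (hr i)
  rwa [hom_eval₂, map_zero, ← IsScalarTower.algebraMap_eq] at h1

end CompleteField

section Completion

open IsLocalRing HeightOneSpectrum WithZero
open scoped WithZero Topology

variable {A K : Type*} [CommRing A] [IsDedekindDomain A] [Field K] [Algebra A K]
  [IsFractionRing A K] (v : HeightOneSpectrum A)

theorem mem_maximalIdeal_adicCompletionIntegers_iff (x : v.adicCompletionIntegers K) :
    x ∈ maximalIdeal (v.adicCompletionIntegers K) ↔ Valued.v (x : v.adicCompletion K) < 1 := by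
  rw [mem_maximalIdeal, mem_nonunits_iff, adicCompletionIntegers.isUnit_iff_valued_eq_one]
  exact ⟨fun h => lt_of_le_of_ne x.2 h, fun h => h.ne⟩

theorem algebraMap_mem_maximalIdeal_iff (a : A) :
    algebraMap A (v.adicCompletionIntegers K) a ∈ maximalIdeal (v.adicCompletionIntegers K) ↔
      a ∈ v.asIdeal := by
  rw [mem_maximalIdeal_adicCompletionIntegers_iff, algebraMap_adicCompletionIntegers_apply,
    ← valuation_lt_one_iff_mem (K := K)]
  rw [valuedAdicCompletion_eq_valuation']

theorem exists_sub_mem_maximalIdeal (x : v.adicCompletionIntegers K) :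
    ∃ a : A, x - algebraMap A _ a ∈ maximalIdeal (v.adicCompletionIntegers K) := by
  have h1 : {y : v.adicCompletion K | Valued.v (y - x : v.adicCompletion K) < 1} ∈
      𝓝 (x : v.adicCompletion K) := by
    rw [Valued.mem_nhds]
    refine ⟨1, fun y hy => ?_⟩
    exact (Valuation.restrict_lt_one_iff _).1 hy
  obtain ⟨_, hk, k, rfl⟩ := mem_closure_iff_nhds.1 (denseRange_algebraMap K v x) _ h1
  have hk1 : v.valuation K k ≤ 1 := by
    rw [← valuedAdicCompletion_eq_valuation']
    have := Valuation.map_add_le Valued.v (g := (1 : ℤᵐ⁰)) (x := (k : v.adicCompletion K) - x)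
      (y := x) hk.le x.2
    rwa [sub_add_cancel] at this
  obtain ⟨a, ha⟩ := exists_valuation_sub_lt_of_integer v hk1 1
  refine ⟨a, ?_⟩
  rw [mem_maximalIdeal_adicCompletionIntegers_iff]
  have h2 : ((x - algebraMap A (v.adicCompletionIntegers K) a : v.adicCompletionIntegers K) :
      v.adicCompletion K) = -((k : v.adicCompletion K) - x) -
        ((algebraMap A K a - k : K) : v.adicCompletion K) := by
    rw [AddSubgroupClass.coe_sub, algebraMap_adicCompletionIntegers_apply]
    have : ((algebraMap A K a - k : K) : v.adicCompletion K) =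
      ((algebraMap A K a : K) : v.adicCompletion K) - (k : v.adicCompletion K) :=
      map_sub (algebraMap K (v.adicCompletion K)) _ _
    rw [this]
    ring
  rw [h2]
  refine Valuation.map_sub_lt _ (by rw [Valuation.map_neg]; exact hk) ?_
  rw [valuedAdicCompletion_eq_valuation']
  exact ha

instance finite_residueField_adicCompletionIntegers [Finite (A ⧸ v.asIdeal)] :
    Finite (ResidueField (v.adicCompletionIntegers K)) := by
  refine Finite.of_surjective (Ideal.Quotient.lift v.asIdeal
    ((residue (v.adicCompletionIntegers K)).comp (algebraMap A _)) fun a ha => ?_) fun x => ?_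
  · rw [RingHom.comp_apply, residue_eq_zero_iff]
    exact (algebraMap_mem_maximalIdeal_iff v a).2 ha
  · obtain ⟨x, rfl⟩ := residue_surjective x
    obtain ⟨a, ha⟩ := exists_sub_mem_maximalIdeal v x
    refine ⟨Ideal.Quotient.mk _ a, ?_⟩
    rw [Ideal.Quotient.lift_mk, RingHom.comp_apply]
    exact (sub_eq_zero.1 (by rw [← map_sub, residue_eq_zero_iff]; exact ha)).symm

instance isAdicComplete_adicCompletionIntegers :
    IsAdicComplete (maximalIdeal (v.adicCompletionIntegers K)) (v.adicCompletionIntegers K) := by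
  have hc : CompleteSpace (v.adicCompletionIntegers K) :=
    (Valued.isClosed_valuationSubring (v.adicCompletion K)).completeSpace_coe
  have hu : IsUniformAddGroup (v.adicCompletionIntegers K) :=
    inferInstanceAs (IsUniformAddGroup (v.adicCompletionIntegers K).toSubring.toAddSubgroup)
  have ht : IsTopologicalRing (v.adicCompletionIntegers K) :=
    inferInstanceAs (IsTopologicalRing (v.adicCompletionIntegers K).toSubring)
  refine (IsAdic.isAdicComplete_iff ?_).2 ⟨hc, inferInstance⟩
  obtain ⟨ϖ, hϖ⟩ := IsDiscreteValuationRing.exists_irreducible (v.adicCompletionIntegers K)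
  have hm (n : ℕ) (x : v.adicCompletionIntegers K) :
      x ∈ maximalIdeal (v.adicCompletionIntegers K) ^ n ↔
        Valued.v (x : v.adicCompletion K) ≤ Valued.v (ϖ : v.adicCompletion K) ^ n := by
    rw [hϖ.maximalIdeal_eq, Ideal.span_singleton_pow, Ideal.mem_span_singleton,
      (adicCompletionIntegers.integers K v).dvd_iff_le, map_pow, map_pow]
    rfl
  have h0 : Valued.v (ϖ : v.adicCompletion K) ≠ 0 := by
    rw [Valuation.ne_zero_iff]
    simpa using hϖ.ne_zero
  refine isAdic_iff.2 ⟨fun n => ?_, fun s hs => ?_⟩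
  · have : ((maximalIdeal (v.adicCompletionIntegers K) ^ n : Ideal _) :
        Set (v.adicCompletionIntegers K)) = Subtype.val ⁻¹' {x : v.adicCompletion K |
          Valued.v.restrict x ≤ Valued.v.restrict ((ϖ : v.adicCompletion K) ^ n)} := by
      ext x
      rw [SetLike.mem_coe, hm, Set.mem_preimage, Set.mem_ofPred_eq, Valuation.restrict_le_iff,
        map_pow]
    rw [this]
    refine (Valued.isOpen_closedBall _ ?_).preimage continuous_subtype_val
    rw [Ne, Valuation.restrict_eq_zero_iff, map_pow]
    exact pow_ne_zero n h0
  · obtain ⟨u, hu, hus⟩ := mem_nhds_subtype _ _ _ |>.1 hs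
    obtain ⟨γ, hγ⟩ := Valued.mem_nhds_zero.1 hu
    obtain ⟨n, hn⟩ := exists_pow_lt₀
      ((mem_maximalIdeal_adicCompletionIntegers_iff v ϖ).1 (hϖ.maximalIdeal_eq ▸
        Ideal.mem_span_singleton_self ϖ))
      (Units.mk0 (MonoidWithZeroHom.ValueGroup₀.embedding γ.1) (by simp))
    refine ⟨n, fun x hx => hus (hγ ?_)⟩
    exact (Valuation.restrict_lt_iff_lt_embedding _).2 (((hm n x).1 hx).trans_lt hn)

end Completion

section Nodes

variable {k E : Type*} [Field k] [Field E] [Algebra k E] [FiniteDimensional k E] [IsGalois k E]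

theorem exists_forall_fixed_eq_aeval (H : Subgroup (E ≃ₐ[k] E)) :
    ∃ a : E, (∀ h ∈ H, h a = a) ∧
      ∀ x : E, (∀ h ∈ H, h x = x) → ∃ g : Polynomial k, Polynomial.aeval a g = x := by
  obtain ⟨a, ha⟩ := Field.exists_primitive_element k (IntermediateField.fixedField H)
  refine ⟨a, fun h hh => a.2 ⟨h, hh⟩, fun x hx => ?_⟩
  have h2 : (⟨x, fun h => hx h h.2⟩ : IntermediateField.fixedField H) ∈
      IntermediateField.adjoin k {a} := by rw [ha]; trivial
  rw [← IntermediateField.mem_toSubalgebra,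
    IntermediateField.adjoin_simple_toSubalgebra_of_isAlgebraic (Algebra.IsAlgebraic.isAlgebraic a),
    Algebra.adjoin_singleton_eq_range_aeval] at h2
  obtain ⟨g, hg⟩ := h2
  have := congrArg (algebraMap _ E) hg
  refine ⟨g, ?_⟩
  simpa [← Polynomial.aeval_algebraMap_apply] using this

theorem exists_forall_apply_eq_self_iff (H : Subgroup (E ≃ₐ[k] E)) :
    ∃ a : E, ∀ h : E ≃ₐ[k] E, h a = a ↔ h ∈ H := by
  obtain ⟨a, ha, hg⟩ := exists_forall_fixed_eq_aeval H
  refine ⟨a, fun h => ⟨fun hh => ?_, ha h⟩⟩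
  rw [← IntermediateField.fixingSubgroup_fixedField H, IntermediateField.mem_fixingSubgroup_iff]
  intro x hx
  obtain ⟨g, rfl⟩ := hg x fun h hh => hx ⟨h, hh⟩
  refine (Polynomial.aeval_algHom_apply h.toAlgHom a g).symm.trans ?_
  change Polynomial.aeval (h a) g = _
  rw [hh]

theorem exists_pow_apply_eq_self_iff (σ : E ≃ₐ[k] E) {f : ℕ} (hf : f ∣ orderOf σ) :
    ∃ a : E, ∀ n : ℕ, (σ ^ n) a = a ↔ f ∣ n := by
  obtain ⟨a, ha⟩ := exists_forall_apply_eq_self_iff (Subgroup.zpowers (σ ^ f))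
  refine ⟨a, fun n => ?_⟩
  rw [ha]
  constructor
  · rintro ⟨i, hi⟩
    have h2 : σ ^ ((f : ℤ) * i - n) = 1 := by
      rw [zpow_sub, zpow_mul, zpow_natCast, zpow_natCast, ← hi]
      exact mul_inv_cancel _
    have h3 := orderOf_dvd_iff_zpow_eq_one.2 h2
    have h4 : (f : ℤ) ∣ (f : ℤ) * i - n := (Int.natCast_dvd_natCast.2 hf).trans h3
    have h5 := (dvd_sub_right (Dvd.intro i rfl)).1 h4
    exact_mod_cast h5
  · rintro ⟨i, rfl⟩
    rw [pow_mul]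
    exact Subgroup.npow_mem_zpowers _ _

theorem exists_ne_zero_apply_eq_mul (σ : E ≃ₐ[k] E) {ρ : E} (hρ : ρ ^ orderOf σ = 1)
    (hσ : σ ρ = ρ) : ∃ y : E, y ≠ 0 ∧ σ y = ρ * y := by
  have hρ0 : ρ ≠ 0 := by
    rintro rfl
    rw [zero_pow (orderOf_pos σ).ne'] at hρ
    exact zero_ne_one hρ
  have h1 : ∃ z : E, ∑ j : Fin (orderOf σ), ρ⁻¹ ^ (j : ℕ) * (σ ^ (j : ℕ)) z ≠ 0 := by
    by_contra! h
    have h2 := linearIndependent_monoidHom E E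
    have h3 : Function.Injective fun j : Fin (orderOf σ) =>
        (((σ ^ (j : ℕ) : E ≃ₐ[k] E) : E →* E)) := by
      intro i j hij
      have : σ ^ (i : ℕ) = σ ^ (j : ℕ) := AlgEquiv.ext fun x => DFunLike.congr_fun hij x
      exact Fin.ext (pow_injOn_Iio_orderOf i.2 j.2 this)
    have h4 := h2.comp _ h3
    rw [Fintype.linearIndependent_iff] at h4
    have h5 := h4 (fun j => ρ⁻¹ ^ (j : ℕ)) (by
      funext z
      simpa using h z) ⟨0, orderOf_pos σ⟩
    simp at h5
  obtain ⟨z, hz⟩ := h1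
  refine ⟨_, hz, ?_⟩
  rw [Fin.sum_univ_eq_sum_range (fun j => ρ⁻¹ ^ j * (σ ^ j) z), map_sum, Finset.mul_sum]
  have h2 (j : ℕ) : σ (ρ⁻¹ ^ j * (σ ^ j) z) = ρ * (ρ⁻¹ ^ (j + 1) * (σ ^ (j + 1)) z) := by
    rw [map_mul, map_pow, map_inv₀, hσ, pow_succ' ρ⁻¹, pow_succ' σ, AlgEquiv.mul_apply]
    field_simp
  rw [Finset.sum_congr rfl fun j _ => h2 j]
  have h3 := Finset.sum_range_succ (fun j => ρ * (ρ⁻¹ ^ j * (σ ^ j) z)) (orderOf σ)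
  rw [Finset.sum_range_succ'] at h3
  have h4 : ρ⁻¹ ^ orderOf σ = 1 := by rw [inv_pow, hρ, inv_one]
  rw [h4, pow_orderOf_eq_one] at h3
  simpa using h3

variable {A : Type*} [CommRing A] [IsDomain A] [Algebra A k] [IsFractionRing A k] [Algebra A E]
  [IsScalarTower A k E]

theorem exists_smul_isIntegral (k : Type*) {E A : Type*} [Field k] [Field E] [Algebra k E]
    [FiniteDimensional k E] [CommRing A] [IsDomain A] [Algebra A k] [IsFractionRing A k]
    [Algebra A E] [IsScalarTower A k E] (z : E) :
    ∃ d : A, d ≠ 0 ∧ IsIntegral A (algebraMap A E d * z) := by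
  have h1 : IsAlgebraic A z := (IsFractionRing.isAlgebraic_iff A k E).2
    (Algebra.IsAlgebraic.isAlgebraic z)
  obtain ⟨d, hd, h⟩ := h1.exists_integral_multiple
  exact ⟨d, hd, by rwa [← Algebra.smul_def]⟩

theorem pow_mod_apply_eq (σ : E ≃ₐ[k] E) {f : ℕ} {a : E} (h : (σ ^ f) a = a) (n : ℕ) :
    (σ ^ (n % f)) a = (σ ^ n) a := by
  have h1 (m : ℕ) : (σ ^ (f * m)) a = a := by
    induction m with
    | zero => simp
    | succ m ih => rw [mul_add, mul_one, pow_add, AlgEquiv.mul_apply, h, ih]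
  conv_rhs => rw [← Nat.mod_add_div n f, pow_add, AlgEquiv.mul_apply, h1]

theorem exists_nodes [CharZero k] (σ : E ≃ₐ[k] E) {e f M : ℕ} (hf : 0 < f)
    (hσ : e * f ∣ orderOf σ) {ρ : E} (hρ : ρ ^ e = 1) (hσρ : σ ρ = ρ) :
    ∃ b y : Fin f × Fin M → E, (∀ i, IsIntegral A (b i)) ∧ (∀ i, IsIntegral A (y i)) ∧
      Function.Injective b ∧ (∀ i, (σ ^ f) (b i) = b i) ∧
      (∀ i j, 0 < j → j < f → (σ ^ j) (b i) ≠ b i) ∧ (∀ i, y i ≠ 0) ∧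
      (∀ i, (σ ^ f) (y i) = ρ * y i) ∧
      ∃ π : Equiv.Perm (Fin f × Fin M), ∀ i, σ (b i) = b (π i) ∧ σ (y i) ^ e = y (π i) ^ e := by
  have := NeZero.of_pos hf
  have hcE : CharZero E := charZero_of_injective_algebraMap (algebraMap k E).injective
  obtain ⟨a₀, ha₀⟩ := exists_pow_apply_eq_self_iff σ (f := f) ((Dvd.intro_left _ rfl).trans hσ)
  obtain ⟨y₀, hy₀, hy₁⟩ := exists_ne_zero_apply_eq_mul (σ ^ f) (ρ := ρ) (by
      rw [orderOf_pow_of_dvd hf.ne' ((Dvd.intro_left _ rfl).trans hσ)]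
      obtain ⟨m, hm⟩ := hσ
      rw [hm, mul_assoc, mul_left_comm, Nat.mul_div_cancel_left _ hf, pow_mul, hρ, one_pow])
    (by
      have h (n : ℕ) : (σ ^ n) ρ = ρ := by
        induction n with
        | zero => simp
        | succ n ih => rw [pow_succ, AlgEquiv.mul_apply, hσρ, ih]
      exact h f)
  have hA (d : A) (τ : E ≃ₐ[k] E) : τ (algebraMap A E d) = algebraMap A E d := by
    rw [IsScalarTower.algebraMap_apply A k E, τ.commutes]
  have hinj : Function.Injective (algebraMap A E) := by
    rw [IsScalarTower.algebraMap_eq A k E]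
    exact (algebraMap k E).injective.comp (IsFractionRing.injective A k)
  obtain ⟨a, ha, haI⟩ : ∃ a : E, (∀ n : ℕ, (σ ^ n) a = a ↔ f ∣ n) ∧ IsIntegral A a := by
    obtain ⟨d, hd, hI⟩ := exists_smul_isIntegral k (A := A) a₀
    have hd' : algebraMap A E d ≠ 0 := (map_ne_zero_iff _ hinj).2 hd
    refine ⟨_, fun n => ?_, hI⟩
    rw [map_mul, hA, mul_right_inj' hd', ha₀]
  obtain ⟨y, hy, hyf, hyI⟩ : ∃ y : E, y ≠ 0 ∧ (σ ^ f) y = ρ * y ∧ IsIntegral A y := by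
    obtain ⟨d, hd, hI⟩ := exists_smul_isIntegral k (A := A) y₀
    have hd' : algebraMap A E d ≠ 0 := (map_ne_zero_iff _ hinj).2 hd
    refine ⟨_, mul_ne_zero hd' hy₀, ?_, hI⟩
    rw [map_mul, hA, hy₁]
    ring
  have hfa : (σ ^ f) a = a := (ha f).2 dvd_rfl
  have hint (τ : E ≃ₐ[k] E) (z : E) (hz : IsIntegral A z) : IsIntegral A (τ z) :=
    hz.map (τ.toAlgHom.restrictScalars A)
  have hcomm (m n : ℕ) (z : E) : (σ ^ m) ((σ ^ n) z) = (σ ^ n) ((σ ^ m) z) := by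
    rw [← AlgEquiv.mul_apply, ← pow_add, add_comm, pow_add, AlgEquiv.mul_apply]
  refine ⟨fun i => (σ ^ (i.1 : ℕ)) a + (i.2 : ℕ), fun i => (σ ^ (i.1 : ℕ)) y,
    fun i => (hint _ _ haI).add (isIntegral_natCast _), fun i => hint _ _ hyI, ?_, ?_, ?_, ?_, ?_,
    (Equiv.addRight 1).prodCongr (Equiv.refl _), ?_⟩
  · intro i i' hii
    simp only at hii
    set g : E ≃ₐ[k] E := (σ ^ (i'.1 : ℕ))⁻¹ * σ ^ (i.1 : ℕ) with hg
    have h1 : g a = a + ((i'.2 : ℕ) - (i.2 : ℕ) : E) := by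
      rw [hg, AlgEquiv.mul_apply, eq_sub_of_add_eq hii, map_sub, map_add, map_natCast, map_natCast,
        AlgEquiv.aut_inv, AlgEquiv.symm_apply_apply]
      ring
    have h2 (n : ℕ) : (g ^ n) a = a + n * ((i'.2 : ℕ) - (i.2 : ℕ) : E) := by
      induction n with
      | zero => simp
      | succ n ih =>
        rw [pow_succ', AlgEquiv.mul_apply, ih, map_add, h1, map_mul, map_sub, map_natCast,
          map_natCast, map_natCast]
        push_cast
        ring
    have h3 := h2 (orderOf g)
    rw [pow_orderOf_eq_one, AlgEquiv.one_apply, left_eq_add, mul_eq_zero, sub_eq_zero] at h3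
    have h4 : ((i'.2 : ℕ) : E) = (i.2 : ℕ) :=
      h3.resolve_left (Nat.cast_ne_zero.2 (orderOf_pos g).ne')
    rw [h4, add_left_inj] at hii
    have h5 : (σ ^ (f - i'.1 + i.1 : ℕ)) a = a := by
      rw [pow_add, AlgEquiv.mul_apply, hii, ← AlgEquiv.mul_apply, ← pow_add,
        Nat.sub_add_cancel i'.1.2.le, hfa]
    have h6 := Nat.eq_of_dvd_of_lt_two_mul (by omega) ((ha _).1 h5) (by omega)
    exact Prod.ext (Fin.ext (by omega)) (Fin.ext (Nat.cast_injective h4.symm))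
  · intro i
    simp only [map_add, map_natCast]
    rw [hcomm, hfa]
  · intro i j hj hjf h
    simp only [map_add, map_natCast] at h
    rw [hcomm, add_left_inj, (σ ^ (i.1 : ℕ)).injective.eq_iff, ha] at h
    exact absurd (Nat.le_of_dvd hj h) (by omega)
  · intro i
    exact (map_ne_zero_iff _ (σ ^ (i.1 : ℕ)).injective).2 hy
  · intro i
    have h (n : ℕ) : (σ ^ n) ρ = ρ := by
      induction n with
      | zero => simp
      | succ n ih => rw [pow_succ, AlgEquiv.mul_apply, hσρ, ih]
    rw [hcomm, hyf, map_mul, h]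
  · intro i
    have h1 : ((i.1 + 1 : Fin f) : ℕ) = ((i.1 : ℕ) + 1) % f := by
      rw [Fin.val_add]
      simp
    have h2 : (σ ^ f) (y ^ e) = y ^ e := by rw [map_pow, hyf, mul_pow, hρ, one_mul]
    constructor
    · simp only [Equiv.prodCongr_apply, Prod.map, Equiv.coe_addRight, Equiv.refl_apply, h1]
      rw [pow_mod_apply_eq σ hfa, map_add, map_natCast, pow_succ', AlgEquiv.mul_apply]
    · simp only [Equiv.prodCongr_apply, Prod.map, Equiv.coe_addRight, h1]
      rw [← map_pow, ← map_pow, ← map_pow, pow_mod_apply_eq σ h2, pow_succ', AlgEquiv.mul_apply]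

end Nodes

section Lagrange

variable {E κ : Type*} [Field E] [Fintype κ]

theorem map_prod_X_sub_C_eq (σ : E →+* E) (b : κ → E) (π : Equiv.Perm κ)
    (hb : ∀ i, σ (b i) = b (π i)) :
    (∏ i, (X - C (b i))).map σ = ∏ i, (X - C (b i)) := by
  rw [Polynomial.map_prod]
  simp only [Polynomial.map_sub, Polynomial.map_X, Polynomial.map_C, hb]
  exact Equiv.prod_comp π fun i => X - C (b i)

theorem exists_eval_eq_derivative_pow (σ : E →+* E) (b y : κ → E) (hb : Function.Injective b)
    (e : ℕ) (π : Equiv.Perm κ) (hσb : ∀ i, σ (b i) = b (π i))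
    (hσy : ∀ i, σ (y i) ^ e = y (π i) ^ e) :
    ∃ h : Polynomial E, h.degree < Fintype.card κ ∧ h.map σ = h ∧
      ∀ i, h.eval (b i) = (y i * (∏ i, (X - C (b i))).derivative.eval (b i)) ^ e := by
  classical
  set g : Polynomial E := ∏ i, (X - C (b i)) with hg
  have hgσ : g.map σ = g := map_prod_X_sub_C_eq σ b π hσb
  set h := Lagrange.interpolate Finset.univ b fun i => (y i * g.derivative.eval (b i)) ^ e with hh
  have h1 (i : κ) : h.eval (b i) = (y i * g.derivative.eval (b i)) ^ e :=
    Lagrange.eval_interpolate_at_node _ hb.injOn (Finset.mem_univ i)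
  have hdeg : h.degree < Fintype.card κ := Lagrange.degree_interpolate_lt _ hb.injOn
  refine ⟨h, hdeg, ?_, h1⟩
  refine Lagrange.eq_interpolate_of_eval_eq _ hb.injOn ?_ fun i _ => ?_
  · exact degree_map_le.trans_lt hdeg
  · obtain ⟨i, rfl⟩ := π.surjective i
    rw [← hσb, eval_map, eval₂_at_apply, h1, map_pow, map_mul, mul_pow, mul_pow, hσy]
    congr 2
    rw [← eval₂_at_apply, ← eval_map, ← derivative_map, hgσ, hσb]

end Lagrange

section Interpolation

variable {k E : Type*} [Field k] [Field E] [Algebra k E]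

theorem exists_nat_minpoly_ne [CharZero k] {I : Type*} [Finite I] (α : I → E)
    (hα : ∀ i, IsIntegral k (α i)) :
    ∃ n : I → ℕ, ∀ i j, i ≠ j → minpoly k (α i + n i) ≠ minpoly k (α j + n j) := by
  classical
  have hcE : CharZero E := charZero_of_injective_algebraMap (algebraMap k E).injective
  cases nonempty_fintype I
  suffices H : ∀ s : Finset I, ∃ n : I → ℕ, ∀ i ∈ s, ∀ j ∈ s, i ≠ j →
      minpoly k (α i + n i) ≠ minpoly k (α j + n j) by
    obtain ⟨n, hn⟩ := H Finset.univ
    exact ⟨n, fun i j => hn i (Finset.mem_univ i) j (Finset.mem_univ j)⟩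
  intro s
  induction s using Finset.induction_on with
  | empty => exact ⟨0, by simp⟩
  | insert a s ha ih =>
    obtain ⟨n, hn⟩ := ih
    have hI (i : I) (m : ℕ) : IsIntegral k (α i + m) := (hα i).add (isIntegral_natCast m)
    have h1 : (⋃ j ∈ s, {m : ℕ | minpoly k (α a + m) = minpoly k (α j + n j)}).Finite := by
      refine Set.Finite.biUnion s.finite_toSet fun j _ => ?_
      have h2 : ((minpoly k (α j + n j)).rootSet E).Finite := rootSet_finite _ _
      refine (h2.preimage (f := fun m : ℕ => α a + m) ?_).subset fun m hm => ?_
      · exact fun x _ y _ hxy => Nat.cast_injective (add_left_cancel hxy)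
      · refine (mem_rootSet.2 ⟨minpoly.ne_zero (hI _ _), ?_⟩)
        rw [← show minpoly k (α a + m) = minpoly k (α j + n j) from hm]
        exact minpoly.aeval _ _
    obtain ⟨m, hm⟩ := h1.exists_notMem
    simp only [Set.mem_iUnion, not_exists] at hm
    refine ⟨Function.update n a m, fun i hi j hj hij => ?_⟩
    rw [Finset.mem_insert] at hi hj
    rcases hi with rfl | hi <;> rcases hj with rfl | hj
    · exact absurd rfl hij
    · rw [Function.update_self, Function.update_of_ne hij.symm]
      exact hm j hj
    · rw [Function.update_self, Function.update_of_ne hij]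
      exact fun h => hm i hi h.symm
    · rw [Function.update_of_ne (by rintro rfl; exact ha hi),
        Function.update_of_ne (by rintro rfl; exact ha hj)]
      exact hn i hi j hj hij

/-- Hermite interpolation at pairwise non-conjugate algebraic elements. -/
theorem exists_aeval_eq_and_aeval_derivative_eq [CharZero k] {I : Type*} [Finite I] (α : I → E)
    (hα : ∀ i, IsIntegral k (α i)) (hne : ∀ i j, i ≠ j → minpoly k (α i) ≠ minpoly k (α j))
    (g h : I → k[X]) :
    ∃ p : k[X], ∀ i, aeval (α i) p = aeval (α i) (g i) ∧
      aeval (α i) p.derivative = aeval (α i) (h i) := by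
  have h1 (i : I) : ∃ w : k[X],
      aeval (α i) (minpoly k (α i)).derivative * aeval (α i) w =
        aeval (α i) (h i - (g i).derivative) := by
    have hsep := (minpoly.irreducible (hα i)).separable
    obtain ⟨u, w, huw⟩ := hsep
    refine ⟨w * (h i - (g i).derivative), ?_⟩
    have := congrArg (aeval (α i)) huw
    rw [map_add, map_mul, map_mul, minpoly.aeval, mul_zero, zero_add, map_one] at this
    rw [map_mul, ← mul_assoc, mul_comm (aeval (α i) _) (aeval (α i) w), this, one_mul]
  choose w hw using h1
  obtain ⟨p, hp⟩ := Ideal.exists_forall_sub_mem_ideal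
    (I := fun i => Ideal.span {minpoly k (α i) ^ 2})
    (by
      intro i j hij
      rw [Function.onFun, Ideal.isCoprime_span_singleton_iff]
      refine IsCoprime.pow ?_
      rw [(minpoly.irreducible (hα i)).coprime_iff_not_dvd]
      intro hdvd
      exact hne i j hij (eq_of_monic_of_associated (minpoly.monic (hα i)) (minpoly.monic (hα j))
        ((minpoly.irreducible (hα i)).associated_of_dvd (minpoly.irreducible (hα j)) hdvd)))
    (fun i => g i + minpoly k (α i) * w i)
  refine ⟨p, fun i => ?_⟩
  obtain ⟨c, hc⟩ := Ideal.mem_span_singleton.1 (hp i)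
  rw [sub_eq_iff_eq_add] at hc
  have h0 := minpoly.aeval k (α i)
  constructor
  · rw [hc]
    simp [h0]
  · rw [hc]
    simp only [derivative_mul, map_add, map_mul, derivative_pow, map_pow, h0]
    have := hw i
    rw [map_sub] at this
    simp [this]

end Interpolation

/-- A point `α` fixed by `σ` at which the bivariate polynomial `P` degenerates to the `e`-th power
of a polynomial with roots `b i`, in such a way that nearby fibres are tamely ramified of type
`(e, f, ρ)`; the elements `b i`, `y i` are integral over `A`, and `P` has coefficients in `S`. -/
structure RamificationDatum (A S : Type) {k E : Type} [CommRing A] [CommRing S] [Field k] [Field E]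
    [Algebra k E] [Algebra A E] [Algebra S E] (σ : E ≃ₐ[k] E) (N e f : ℕ) (ρ : E)
    (P : Polynomial (Polynomial S)) where
  m : ℕ
  m_mul : m * e = N
  α : E
  b : Fin m → E
  y : Fin m → E
  F : Polynomial (Polynomial S)
  H : Polynomial (Polynomial S)
  isIntegral_α : IsIntegral A α
  isIntegral_b : ∀ i, IsIntegral A (b i)
  isIntegral_y : ∀ i, IsIntegral A (y i)
  apply_α : σ α = α
  injective_b : Function.Injective b
  pow_apply_b : ∀ i, (σ ^ f) (b i) = b i
  pow_apply_b_ne : ∀ i j, 0 < j → j < f → (σ ^ j) (b i) ≠ b i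
  y_ne_zero : ∀ i, y i ≠ 0
  pow_apply_y : ∀ i, (σ ^ f) (y i) = ρ * y i
  monic_F : F.Monic
  natDegree_F : F.natDegree = m
  map_F : F.map (aeval α : Polynomial S →ₐ[S] E).toRingHom = ∏ i, (X - C (b i))
  degree_H : H.degree < N
  eval_H : ∀ i, (H.map (aeval α : Polynomial S →ₐ[S] E).toRingHom).eval (b i) =
    (y i * (∏ i, (X - C (b i))).derivative.eval (b i)) ^ e
  map_P : P.map (aeval α : Polynomial S →ₐ[S] E).toRingHom = (∏ i, (X - C (b i))) ^ e
  derivative_P : ∀ l, aeval α (P.coeff l).derivative = - aeval α (H.coeff l)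

theorem Monic.eq_of_forall_coeff_eq {R : Type*} [CommRing R] [Nontrivial R] {p q : Polynomial R}
    {N : ℕ} (hp : p.Monic) (hq : q.Monic) (hpN : p.natDegree = N) (hqN : q.natDegree = N)
    (h : ∀ l < N, p.coeff l = q.coeff l) : p = q := by
  ext l
  rcases lt_trichotomy l N with hl | rfl | hl
  · exact h l hl
  · rw [← hpN, hp.coeff_natDegree, hpN, ← hqN, hq.coeff_natDegree]
  · rw [coeff_eq_zero_of_natDegree_lt (hpN ▸ hl), coeff_eq_zero_of_natDegree_lt (hqN ▸ hl)]

theorem exists_monic_coeff_eq {R : Type*} [CommRing R] [Nontrivial R] (N : ℕ) (p : ℕ → R) :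
    ∃ P : Polynomial R, P.Monic ∧ P.natDegree = N ∧ ∀ l < N, P.coeff l = p l := by
  have hdeg : (∑ l ∈ Finset.range N, C (p l) * X ^ l : Polynomial R).degree < N := by
    refine (degree_sum_le _ _).trans_lt ((Finset.sup_lt_iff (WithBot.bot_lt_coe N)).2 fun l hl => ?_)
    exact (degree_C_mul_X_pow_le _ _).trans_lt (Nat.cast_lt.2 (Finset.mem_range.1 hl))
  refine ⟨X ^ N + ∑ l ∈ Finset.range N, C (p l) * X ^ l, monic_X_pow_add hdeg,
    ?_, fun l hl => ?_⟩
  · exact natDegree_eq_of_degree_eq_some (by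
      rw [degree_add_eq_left_of_degree_lt (by rwa [degree_X_pow]), degree_X_pow])
  · rw [coeff_add, coeff_X_pow, if_neg hl.ne, zero_add, finsetSum_coeff]
    simp [coeff_X_pow, hl]

section

variable {A k E : Type} [CommRing A] [IsDomain A] [Field k] [Field E] [Algebra A k]
  [IsFractionRing A k] [Algebra k E] [Algebra A E] [IsScalarTower A k E] [FiniteDimensional k E]
  [IsGalois k E]

theorem exists_isIntegral_forall_fixed_eq_aeval (σ : E ≃ₐ[k] E) :
    ∃ a : E, IsIntegral A a ∧ σ a = a ∧ ∀ x : E, σ x = x → ∃ g : Polynomial k, aeval a g = x := by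
  obtain ⟨a, ha, hg⟩ := exists_forall_fixed_eq_aeval (Subgroup.zpowers σ)
  obtain ⟨d, hd, hI⟩ := exists_smul_isIntegral k (A := A) a
  have hd' : algebraMap A k d ≠ 0 := (map_ne_zero_iff _ (IsFractionRing.injective A k)).2 hd
  have hdE : algebraMap k E (algebraMap A k d) ≠ 0 :=
    (map_ne_zero_iff _ (algebraMap k E).injective).2 hd'
  rw [IsScalarTower.algebraMap_apply A k E] at hI
  refine ⟨_, hI, ?_, fun x hx => ?_⟩
  · rw [map_mul, σ.commutes, ha σ (Subgroup.mem_zpowers σ)]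
  · obtain ⟨g, hg⟩ := hg x fun h hh => by
      have : σ ∈ MulAction.stabilizer (E ≃ₐ[k] E) x := hx
      exact (Subgroup.zpowers_le.2 this) hh
    refine ⟨g.comp (C (algebraMap A k d)⁻¹ * X), ?_⟩
    rw [aeval_comp, map_mul, aeval_C, aeval_X, map_inv₀, inv_mul_cancel_left₀ hdE, hg]

theorem exists_field_polynomial [CharZero k] (N : ℕ) (Q : Fin 3 → Polynomial k)
    (hQ : ∀ m, (Q m).Monic) (hQN : ∀ m, (Q m).natDegree = N)
    {I : Type} [Finite I] (σ : I → (E ≃ₐ[k] E)) (e f : I → ℕ) (ρ : I → E)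
    (he : ∀ i, 0 < e i) (hf : ∀ i, 0 < f i) (hN : ∀ i, e i * f i ∣ N)
    (hσ : ∀ i, N ∣ orderOf (σ i)) (hρ : ∀ i, ρ i ^ e i = 1) (hσρ : ∀ i, σ i (ρ i) = ρ i) :
    ∃ P : Polynomial (Polynomial k), P.Monic ∧ P.natDegree = N ∧
      (∃ n : Fin 3 → ℕ, ∀ m, P.map (evalRingHom (n m : k)) = Q m) ∧
      ∀ i, Nonempty (RamificationDatum A k (σ i) N (e i) (f i) (ρ i) P) := by
  choose α₀ hα₀I hα₀ hα₀g using fun i => exists_isIntegral_forall_fixed_eq_aeval (A := A) (σ i)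
  obtain ⟨n, hn⟩ := exists_nat_minpoly_ne (k := k) (Sum.elim α₀ fun _ : Fin 3 => (0 : E))
    fun i => Algebra.IsIntegral.isIntegral _
  have hα : ∀ i, IsIntegral A (α₀ i + n (.inl i)) := fun i => (hα₀I i).add (isIntegral_natCast _)
  have hσα : ∀ i, σ i (α₀ i + n (.inl i)) = α₀ i + n (.inl i) := fun i => by
    rw [map_add, map_natCast, hα₀]
  have hαg : ∀ i, ∀ x : E, σ i x = x → ∃ g : Polynomial k,
      aeval (α₀ i + n (.inl i) : E) g = x := fun i x hx => by
    obtain ⟨g, hg⟩ := hα₀g i x hx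
    refine ⟨g.comp (X - C (n (.inl i) : k)), ?_⟩
    rw [aeval_comp, map_sub, aeval_X, aeval_C, map_natCast, add_sub_cancel_right, hg]
  set α : I → E := fun i => α₀ i + n (.inl i) with hαdef
  have hlift (i : I) (q : Polynomial E) (hq : q.map (σ i : E →+* E) = q) :
      q ∈ lifts (aeval (α i) : Polynomial k →ₐ[k] E).toRingHom := by
    rw [lifts_iff_coeff_lifts]
    intro l
    obtain ⟨g, hg⟩ := hαg i (q.coeff l) (by
      conv_rhs => rw [← hq, coeff_map]
      rfl)
    exact ⟨g, hg⟩
  have hdata (i : I) : ∃ (m : ℕ) (b y : Fin m → E) (F H : Polynomial (Polynomial k)),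
      m * e i = N ∧ (∀ j, IsIntegral A (b j)) ∧ (∀ j, IsIntegral A (y j)) ∧
      Function.Injective b ∧ (∀ j, (σ i ^ f i) (b j) = b j) ∧
      (∀ j l, 0 < l → l < f i → (σ i ^ l) (b j) ≠ b j) ∧ (∀ j, y j ≠ 0) ∧
      (∀ j, (σ i ^ f i) (y j) = ρ i * y j) ∧ F.Monic ∧ F.natDegree = m ∧
      F.map (aeval (α i) : Polynomial k →ₐ[k] E).toRingHom = ∏ j, (X - C (b j)) ∧
      H.degree < N ∧
      ∀ j, (H.map (aeval (α i) : Polynomial k →ₐ[k] E).toRingHom).eval (b j) =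
        (y j * (∏ j, (X - C (b j))).derivative.eval (b j)) ^ e i := by
    obtain ⟨M, hM⟩ := hN i
    obtain ⟨b, y, hb, hy, hbinj, h1, h2, h3, h4, π, hπ⟩ := exists_nodes (A := A) (M := M) (σ i)
      (hf i) ((hN i).trans (hσ i)) (hρ i) (hσρ i)
    have hcard : f i * M * e i = N := by rw [hM]; ring
    let w : Fin (f i) × Fin M ≃ Fin (f i * M) := finProdFinEquiv
    have hbinj' : Function.Injective (b ∘ w.symm) := hbinj.comp w.symm.injective
    have hπ' (j : Fin (f i * M)) : (σ i) ((b ∘ w.symm) j) = (b ∘ w.symm) ((w.symm.trans (π.trans w)) j) ∧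
        (σ i) ((y ∘ w.symm) j) ^ e i = (y ∘ w.symm) ((w.symm.trans (π.trans w)) j) ^ e i := by
      simpa using hπ (w.symm j)
    obtain ⟨h, hdeg, hmap, heval⟩ := exists_eval_eq_derivative_pow (σ i : E →+* E) (b ∘ w.symm)
      (y ∘ w.symm) hbinj' (e i) _ (fun j => (hπ' j).1) (fun j => (hπ' j).2)
    have hGmap := map_prod_X_sub_C_eq (σ i : E →+* E) (b ∘ w.symm) _ (fun j => (hπ' j).1)
    obtain ⟨F, hF, hFN, hFm⟩ := lifts_and_natDegree_eq_and_monic (hlift i _ hGmap)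
      (monic_prod_X_sub_C _ Finset.univ)
    obtain ⟨H, hH, hHd⟩ := exists_degree_eq_of_mem_lifts (hlift i _ hmap)
    refine ⟨f i * M, b ∘ w.symm, y ∘ w.symm, F, H, hcard, fun j => hb _, fun j => hy _, hbinj',
      fun j => h1 _, fun j => h2 _, fun j => h3 _, fun j => h4 _, hFm, ?_, hF, ?_, ?_⟩
    · rw [hFN, natDegree_finsetProd_X_sub_C_eq_card]
      simp
    · rw [hHd]
      refine hdeg.trans_le ?_
      rw [Fintype.card_fin, ← hcard]
      exact_mod_cast Nat.le_mul_of_pos_right _ (he i)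
    · rw [hH]
      exact heval
  choose m b y F H hm hb hy hbinj h1 h2 h3 h4 hFm hFN hF hHd hH using hdata
  have hherm (l : ℕ) := exists_aeval_eq_and_aeval_derivative_eq (k := k)
    (fun i => Sum.elim α₀ (fun _ : Fin 3 => (0 : E)) i + n i)
    (fun i => Algebra.IsIntegral.isIntegral _) hn
    (Sum.elim (fun i => (F i ^ e i).coeff l) fun m => C ((Q m).coeff l))
    (Sum.elim (fun i => - (H i).coeff l) fun m => 0)
  choose p hp using hherm
  obtain ⟨P, hPm, hPN, hP⟩ := exists_monic_coeff_eq N p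
  refine ⟨P, hPm, hPN, ⟨fun m => n (.inr m), fun m => ?_⟩, fun i => ⟨?_⟩⟩
  · refine Monic.eq_of_forall_coeff_eq (hPm.map _) (hQ m) (by rw [hPm.natDegree_map, hPN]) (hQN m)
      fun l hl => ?_
    have h5 := (hp l (.inr m)).1
    simp only [Sum.elim_inr, zero_add, aeval_C] at h5
    rw [coeff_map, hP l hl, coe_evalRingHom]
    apply (algebraMap k E).injective
    rw [← h5, ← map_natCast (algebraMap k E), aeval_algebraMap_apply]
    simp
  · refine ⟨m i, hm i, α i, b i, y i, F i, H i, hα i, hb i, hy i, hσα i, hbinj i, h1 i, h2 i, h3 i,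
      h4 i, hFm i, hFN i, hF i, hHd i, hH i, ?_, fun l => ?_⟩
    · rw [← hF i, ← Polynomial.map_pow]
      refine Monic.eq_of_forall_coeff_eq (hPm.map _) ((hFm i).pow _ |>.map _)
        (by rw [hPm.natDegree_map, hPN])
        (by rw [((hFm i).pow _).natDegree_map, (hFm i).natDegree_pow, hFN, mul_comm, hm])
        fun l hl => ?_
      rw [coeff_map, coeff_map, hP l hl]
      exact (hp l (.inl i)).1
    · rcases lt_or_ge l N with hl | hl
      · rw [hP l hl]
        have := (hp l (.inl i)).2
        simp only [Sum.elim_inl, map_neg] at this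
        exact this
      · have h5 : (H i).coeff l = 0 := coeff_eq_zero_of_degree_lt ((hHd i).trans_le (by
          exact_mod_cast hl))
        have h6 : (P.coeff l).derivative = 0 := by
          rcases hl.eq_or_lt with rfl | hl
          · rw [← hPN, hPm.coeff_natDegree, derivative_one]
          · rw [coeff_eq_zero_of_natDegree_lt (hPN ▸ hl), derivative_zero]
        rw [h5, h6, map_zero, neg_zero]

end

theorem eval_scaleRoots_smul {R : Type*} [CommRing R] (p : Polynomial R) (c x : R) :
    (p.scaleRoots c).eval (c * x) = c ^ p.natDegree * p.eval x := by
  rw [scaleRoots_eval_mul]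

theorem scaleRoots_prod_X_sub_C {E : Type*} [CommRing E] [IsDomain E] {ι : Type*} [Fintype ι]
    (b : ι → E) (c : E) :
    (∏ i, (X - C (b i)) : Polynomial E).scaleRoots c = ∏ i, (X - C (c * b i)) := by
  classical
  induction (Finset.univ : Finset ι) using Finset.induction_on with
  | empty => simp
  | insert a s ha ih =>
    rw [Finset.prod_insert ha, Finset.prod_insert ha, mul_scaleRoots_of_noZeroDivisors, ih,
      X_sub_C_scaleRoots, mul_comm c]

theorem mul_eval_derivative_scaleRoots {R : Type*} [CommRing R] [IsDomain R] (p : Polynomial R)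
    (c x : R) :
    c * (p.scaleRoots c).derivative.eval (c * x) = c ^ p.natDegree * p.derivative.eval x := by
  have h : (p.scaleRoots c).comp (C c * X) = C (c ^ p.natDegree) * p := by
    ext l
    rw [comp_C_mul_X_coeff, coeff_scaleRoots, coeff_C_mul]
    rcases le_or_gt l p.natDegree with hl | hl
    · rw [mul_assoc, ← pow_add, Nat.sub_add_cancel hl, mul_comm]
    · rw [coeff_eq_zero_of_natDegree_lt hl, zero_mul, zero_mul, mul_zero]
  have := congrArg (fun q => (derivative q).eval x) h
  simpa only [derivative_comp, derivative_C_mul, derivative_X, mul_one, eval_mul, eval_C, eval_comp,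
    eval_X] using this

theorem exists_monic_map_eq_scaleRoots {A k : Type} [CommRing A] [Field k] [Algebra A k]
    {p : Polynomial (Polynomial k)} (hp : p.Monic) {c : A}
    (hc : ∀ l, ∃ g : Polynomial A, g.map (algebraMap A k) = C (algebraMap A k c) * p.coeff l) :
    ∃ q : Polynomial (Polynomial A), q.Monic ∧ q.natDegree = p.natDegree ∧
      q.map (mapRingHom (algebraMap A k)) = p.scaleRoots (C (algebraMap A k c)) := by
  have h : p.scaleRoots (C (algebraMap A k c)) ∈ lifts (mapRingHom (algebraMap A k)) := by
    rw [lifts_iff_coeff_lifts]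
    intro l
    rw [coeff_scaleRoots]
    rcases lt_trichotomy l p.natDegree with hl | rfl | hl
    · obtain ⟨g, hg⟩ := hc l
      refine ⟨g * C c ^ (p.natDegree - l - 1), ?_⟩
      rw [map_mul, coe_mapRingHom, hg, Polynomial.map_pow, map_C]
      obtain ⟨n, hn⟩ : ∃ n, p.natDegree - l = n + 1 := ⟨p.natDegree - l - 1, by omega⟩
      rw [hn]
      simp only [Nat.add_sub_cancel]
      ring
    · exact ⟨1, by simp [hp]⟩
    · exact ⟨0, by rw [coeff_eq_zero_of_natDegree_lt hl]; simp⟩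
  obtain ⟨q, hq, hqN, hqm⟩ := lifts_and_natDegree_eq_and_monic h ((monic_scaleRoots_iff _).2 hp)
  exact ⟨q, hqm, by rw [hqN, natDegree_scaleRoots], hq⟩

theorem map_aeval_eq_map_mapRingHom {A k E : Type} [CommRing A] [Field k] [Field E] [Algebra A k]
    [Algebra k E] [Algebra A E] [IsScalarTower A k E] (α : E) (q : Polynomial (Polynomial A)) :
    q.map (aeval α : Polynomial A →ₐ[A] E).toRingHom =
      (q.map (mapRingHom (algebraMap A k))).map (aeval α : Polynomial k →ₐ[k] E).toRingHom := by
  rw [Polynomial.map_map]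
  congr 1
  ext <;> simp [← IsScalarTower.algebraMap_apply]

theorem map_aeval_scaleRoots {k E : Type} [Field k] [Field E] [Algebra k E] (α : E)
    {p : Polynomial (Polynomial k)} (hp : p.Monic) (c : k) :
    (p.scaleRoots (C c)).map (aeval α : Polynomial k →ₐ[k] E).toRingHom =
      (p.map (aeval α : Polynomial k →ₐ[k] E).toRingHom).scaleRoots (algebraMap k E c) := by
  rw [map_scaleRoots _ _ _ (by rw [hp.leadingCoeff, map_one]; exact one_ne_zero)]
  simp

section

variable {A k E : Type} [CommRing A] [IsDomain A] [Field k] [Field E] [Algebra A k]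
  [IsFractionRing A k] [Algebra k E] [Algebra A E] [IsScalarTower A k E]

theorem exists_common_denominator {I : Type*} [Finite I] (p : I → Polynomial (Polynomial k)) :
    ∃ c : A, c ≠ 0 ∧ ∀ i l, ∃ g : Polynomial A,
      g.map (algebraMap A k) = C (algebraMap A k c) * (p i).coeff l := by
  classical
  cases nonempty_fintype I
  obtain ⟨c, hc⟩ := IsLocalization.exist_integer_multiples_of_finset (nonZeroDivisors A)
    (Finset.univ.biUnion fun i => (p i).coeffs.biUnion fun q => q.coeffs)
  refine ⟨c, nonZeroDivisors.ne_zero c.2, fun i l => ?_⟩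
  have : C (algebraMap A k c) * (p i).coeff l ∈ lifts (algebraMap A k) := by
    rw [lifts_iff_coeff_lifts]
    intro n
    rw [coeff_C_mul]
    by_cases h0 : ((p i).coeff l).coeff n = 0
    · exact ⟨0, by rw [h0, map_zero, mul_zero]⟩
    · have hl : (p i).coeff l ≠ 0 := fun h => h0 (by rw [h, coeff_zero])
      obtain ⟨a, ha⟩ := hc (((p i).coeff l).coeff n) (Finset.mem_biUnion.2 ⟨i, Finset.mem_univ _,
        Finset.mem_biUnion.2 ⟨_, coeff_mem_coeffs hl, coeff_mem_coeffs h0⟩⟩)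
      exact ⟨a, by rw [ha, Algebra.smul_def]⟩
  exact (mem_lifts _).1 this

/-- Scaling the roots of all polynomials involved by a common denominator makes a ramification
datum integral. -/
theorem RamificationDatum.nonempty_of_scaleRoots {σ : E ≃ₐ[k] E} {N e f : ℕ} {ρ : E}
    {p : Polynomial (Polynomial k)} (D : RamificationDatum A k σ N e f ρ p) (hp : p.Monic)
    (hpN : p.natDegree = N) {c : A} (hc : c ≠ 0)
    (hF : ∀ l, ∃ g : Polynomial A, g.map (algebraMap A k) = C (algebraMap A k c) * D.F.coeff l)
    (hH : ∀ l, ∃ g : Polynomial A,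
      g.map (algebraMap A k) = C (algebraMap A k c) * (X ^ N + D.H).coeff l)
    {P : Polynomial (Polynomial A)}
    (hP : P.map (mapRingHom (algebraMap A k)) = p.scaleRoots (C (algebraMap A k c))) :
    Nonempty (RamificationDatum A A σ N e f ρ P) := by
  have hck : algebraMap A k c ≠ 0 := (map_ne_zero_iff _ (IsFractionRing.injective A k)).2 hc
  have hcE : algebraMap k E (algebraMap A k c) ≠ 0 :=
    (map_ne_zero_iff _ (algebraMap k E).injective).2 hck
  have hcI : IsIntegral A (algebraMap k E (algebraMap A k c)) := by
    rw [← IsScalarTower.algebraMap_apply]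
    exact isIntegral_algebraMap
  have hXH : (X ^ N + D.H).Monic := monic_X_pow_add D.degree_H
  have hXHN : (X ^ N + D.H).natDegree = N := natDegree_eq_of_degree_eq_some (by
    rw [degree_add_eq_left_of_degree_lt (by rw [degree_X_pow]; exact D.degree_H), degree_X_pow])
  obtain ⟨F, hFm, hFN, hF⟩ := exists_monic_map_eq_scaleRoots D.monic_F hF
  obtain ⟨H, hHm, hHN, hH⟩ := exists_monic_map_eq_scaleRoots hXH hH
  have hGN : (∏ i, (X - C (D.b i)) : Polynomial E).natDegree = D.m := by
    rw [natDegree_finsetProd_X_sub_C_eq_card]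
    simp
  have hHk : (H - X ^ N).map (mapRingHom (algebraMap A k)) =
      (X ^ N + D.H).scaleRoots (C (algebraMap A k c)) - X ^ N := by
    rw [Polynomial.map_sub, hH, Polynomial.map_pow, map_X]
  refine ⟨⟨D.m, D.m_mul, D.α, fun i => algebraMap k E (algebraMap A k c) * D.b i,
    fun i => algebraMap k E (algebraMap A k c) * D.y i, F, H - X ^ N, D.isIntegral_α,
    fun i => hcI.mul (D.isIntegral_b i), fun i => hcI.mul (D.isIntegral_y i), D.apply_α,
    fun i j h => D.injective_b (mul_left_cancel₀ hcE h), fun i => ?_, fun i j hj hjf h => ?_,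
    fun i => mul_ne_zero hcE (D.y_ne_zero i), fun i => ?_, hFm, hFN.trans D.natDegree_F, ?_, ?_,
    fun i => ?_, ?_, fun l => ?_⟩⟩
  · rw [map_mul, AlgEquiv.commutes, D.pow_apply_b]
  · rw [map_mul, AlgEquiv.commutes] at h
    exact D.pow_apply_b_ne i j hj hjf (mul_left_cancel₀ hcE h)
  · rw [map_mul, AlgEquiv.commutes, D.pow_apply_y, mul_left_comm]
  · rw [map_aeval_eq_map_mapRingHom (k := k), hF, map_aeval_scaleRoots _ D.monic_F, D.map_F,
      scaleRoots_prod_X_sub_C]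
  · have : H.degree = (X ^ N : Polynomial (Polynomial A)).degree := by
      rw [degree_X_pow, degree_eq_natDegree hHm.ne_zero, hHN, hXHN]
    refine (degree_sub_lt_left this hHm.ne_zero ?_).trans_eq ?_
    · rw [hHm.leadingCoeff, (monic_X_pow N).leadingCoeff]
    · rw [this, degree_X_pow]
  · rw [map_aeval_eq_map_mapRingHom (k := k), hHk, Polynomial.map_sub,
      map_aeval_scaleRoots _ hXH, eval_sub, eval_scaleRoots_smul, hXH.natDegree_map, hXHN,
      ← scaleRoots_prod_X_sub_C, Polynomial.map_add, eval_add, D.eval_H]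
    have h1 := mul_eval_derivative_scaleRoots (∏ i, (X - C (D.b i)))
      (algebraMap k E (algebraMap A k c)) (D.b i)
    rw [hGN] at h1
    rw [mul_right_comm, h1, mul_right_comm, mul_assoc, mul_pow _ (D.y i * _), ← pow_mul, D.m_mul]
    simp
    ring
  · rw [map_aeval_eq_map_mapRingHom (k := k), hP, map_aeval_scaleRoots _ hp, D.map_P,
      pow_scaleRoots_of_isReduced, scaleRoots_prod_X_sub_C]
  · have hA (g : Polynomial A) : (aeval D.α) g = aeval D.α (g.map (algebraMap A k)) :=
      (aeval_map_algebraMap k D.α g).symm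
    have hPl := congrArg (fun q => q.coeff l) hP
    have hHl := congrArg (fun q => q.coeff l) hHk
    simp only [coeff_map, coe_mapRingHom, coeff_scaleRoots, coeff_sub, coeff_add, hXHN, hpN]
      at hPl hHl
    have hX : (X ^ N : Polynomial (Polynomial k)).coeff l * C (algebraMap A k c) ^ (N - l) =
        (X ^ N : Polynomial (Polynomial k)).coeff l := by
      rw [coeff_X_pow]
      split_ifs with h
      · rw [h, Nat.sub_self, pow_zero, mul_one]
      · rw [zero_mul]
    rw [add_mul, hX, add_sub_cancel_left] at hHl
    rw [coeff_sub, hA, hA, ← derivative_map, hPl, hHl, ← map_pow, mul_comm (p.coeff l), derivative_C_mul,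
      map_mul, map_mul, D.derivative_P, mul_neg, mul_comm (aeval D.α (D.H.coeff l))]

theorem exists_integral_polynomial [FiniteDimensional k E] [IsGalois k E] [CharZero k] (N : ℕ)
    (Q : Fin 3 → Polynomial A)
    (hQ : ∀ m, (Q m).Monic) (hQN : ∀ m, (Q m).natDegree = N)
    {I : Type} [Finite I] (σ : I → (E ≃ₐ[k] E)) (e f : I → ℕ) (ρ : I → E)
    (he : ∀ i, 0 < e i) (hf : ∀ i, 0 < f i) (hN : ∀ i, e i * f i ∣ N)
    (hσ : ∀ i, N ∣ orderOf (σ i)) (hρ : ∀ i, ρ i ^ e i = 1) (hσρ : ∀ i, σ i (ρ i) = ρ i) :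
    ∃ (P : Polynomial (Polynomial A)) (c : A), c ≠ 0 ∧ P.Monic ∧ P.natDegree = N ∧
      (∃ n : Fin 3 → ℕ, ∀ m, P.map (evalRingHom (n m : A)) = (Q m).scaleRoots c) ∧
      ∀ i, Nonempty (RamificationDatum A A (σ i) N (e i) (f i) (ρ i) P) := by
  obtain ⟨p, hp, hpN, ⟨n, hn⟩, hD⟩ := exists_field_polynomial (A := A) N
    (fun m => (Q m).map (algebraMap A k)) (fun m => (hQ m).map _)
    (fun m => by rw [(hQ m).natDegree_map, hQN]) σ e f ρ he hf hN hσ hρ hσρ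
  let D := fun i => (hD i).some
  obtain ⟨c, hc, hcI⟩ := exists_common_denominator (A := A)
    (Sum.elim (fun _ : Unit => p) (Sum.elim (fun i => (D i).F) fun i => X ^ N + (D i).H))
  obtain ⟨P, hPm, hPN, hP⟩ := exists_monic_map_eq_scaleRoots hp (hcI (.inl ()))
  refine ⟨P, c, hc, hPm, hPN.trans hpN, ⟨n, fun m => ?_⟩, fun i =>
    (D i).nonempty_of_scaleRoots hp hpN hc (hcI (.inr (.inl i))) (hcI (.inr (.inr i))) hP⟩
  apply map_injective _ (IsFractionRing.injective A k)
  have h1 : (P.map (evalRingHom (n m : A))).map (algebraMap A k) =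
      (P.map (mapRingHom (algebraMap A k))).map (evalRingHom (n m : k)) := by
    rw [Polynomial.map_map, Polynomial.map_map]
    congr 1
    ext <;> simp
  rw [h1, hP, map_scaleRoots _ _ _ (by rw [hp.leadingCoeff, map_one]; exact one_ne_zero), hn,
    map_scaleRoots _ _ _ (by rw [(hQ m).leadingCoeff, map_one]; exact one_ne_zero)]
  simp

end

/-- A nonzero element of the base avoiding the zeros of finitely many integral elements. -/
theorem exists_ne_zero_forall_apply_ne_zero {A B : Type*} [CommRing A] [IsDomain A] [CommRing B]
    [IsDomain B] [Algebra A B] [Algebra.IsIntegral A B] {Z : Set B} (hZ : Z.Finite)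
    (h0 : ∀ z ∈ Z, z ≠ 0) :
    ∃ δ : A, δ ≠ 0 ∧ ∀ {D : Type} [Field D] (x : B →+* D), x (algebraMap A B δ) ≠ 0 →
      ∀ z ∈ Z, x z ≠ 0 := by
  induction Z, hZ using Set.Finite.induction_on with
  | empty => exact ⟨1, one_ne_zero, by simp⟩
  | @insert z Z _ _ ih =>
    obtain ⟨δ, hδ, h⟩ := ih fun z hz => h0 z (Set.mem_insert_of_mem _ hz)
    obtain ⟨r, hr, b, hb⟩ := (Algebra.IsIntegral.isIntegral (R := A) z).isAlgebraic.exists_nonzero_dvd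
      (mem_nonZeroDivisors_of_ne_zero (h0 z (Set.mem_insert _ _)))
    refine ⟨r * δ, mul_ne_zero hr hδ, fun x hx w hw => ?_⟩
    rw [map_mul, map_mul] at hx
    rcases Set.mem_insert_iff.1 hw with rfl | hw
    · rintro h
      exact left_ne_zero_of_mul hx (by rw [hb, map_mul, h, zero_mul])
    · exact h x (right_ne_zero_of_mul hx) w hw

section

variable {A k E : Type} [CommRing A] [Field k] [Field E] [Algebra A k]
  [Algebra k E] [Algebra A E] [IsScalarTower A k E]

/-- A homomorphism from the integral closure which preserves the nondegeneracy of a ramification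
datum. -/
structure RamificationDatum.IsGood {σ : E ≃ₐ[k] E} {N e f : ℕ} {ρ : E}
    {P : Polynomial (Polynomial A)} (D : RamificationDatum A A σ N e f ρ P) {F : Type} [Field F]
    (x : integralClosure A E →+* F) : Prop where
  injective_b : Function.Injective fun i => x ⟨D.b i, D.isIntegral_b i⟩
  pow_apply_b_ne : ∀ i j, 0 < j → j < f →
    x ⟨(σ ^ j) (D.b i), isIntegral_apply (σ ^ j) (D.isIntegral_b i)⟩ ≠ x ⟨D.b i, D.isIntegral_b i⟩
  y_ne_zero : ∀ i, x ⟨D.y i, D.isIntegral_y i⟩ ≠ 0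
  derivative_ne_zero : x (aeval ⟨D.α, D.isIntegral_α⟩ (minpoly A D.α).derivative) ≠ 0

variable [IsDomain A] [IsIntegrallyClosed A] [IsFractionRing A k] [CharZero k]

theorem exists_ne_zero_forall_isGood {N : ℕ} {P : Polynomial (Polynomial A)} {I : Type} [Finite I]
    {σ : I → (E ≃ₐ[k] E)} {e f : I → ℕ} {ρ : I → E}
    (D : ∀ i, RamificationDatum A A (σ i) N (e i) (f i) (ρ i) P) (hN : 0 < N) :
    ∃ δ : A, δ ≠ 0 ∧ ∀ {F : Type} [Field F] (x : integralClosure A E →+* F),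
      x (algebraMap A _ δ) ≠ 0 →
        (∀ z w : integralClosure A E, z ^ N = 1 → w ^ N = 1 → x z = x w → z = w) ∧
        ∀ i, (D i).IsGood x := by
  classical
  let Z : Set (integralClosure A E) :=
    ((fun p : integralClosure A E × integralClosure A E => p.1 - p.2) ''
      ({z | z ^ N = 1} ×ˢ {z | z ^ N = 1}) ∪
    ⋃ i, ((Set.range fun p : Fin (D i).m × Fin (D i).m =>
        (⟨(D i).b p.1, (D i).isIntegral_b p.1⟩ - ⟨(D i).b p.2, (D i).isIntegral_b p.2⟩ :
          integralClosure A E)) ∪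
      (Set.range fun p : Fin (D i).m × Fin (f i) =>
        (⟨(σ i ^ (p.2 : ℕ)) ((D i).b p.1), isIntegral_apply _ ((D i).isIntegral_b p.1)⟩ -
          ⟨(D i).b p.1, (D i).isIntegral_b p.1⟩ : integralClosure A E)) ∪
      (Set.range fun j => (⟨(D i).y j, (D i).isIntegral_y j⟩ : integralClosure A E)) ∪
      {aeval ⟨(D i).α, (D i).isIntegral_α⟩ (minpoly A (D i).α).derivative})) \ {0}
  have hroots : {z : integralClosure A E | z ^ N = 1}.Finite := by
    refine (Polynomial.finite_setOfPred_isRoot (p := (X ^ N - 1 : Polynomial (integralClosure A E)))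
      (monic_X_pow_sub_C 1 hN.ne').ne_zero).subset fun z hz => ?_
    change z ^ N = 1 at hz
    simp [hz]
  have hZ : Z.Finite := by
    refine Set.Finite.sdiff (Set.Finite.union ((hroots.prod hroots).image _)
      (Set.finite_iUnion fun i => ?_))
    exact (((Set.finite_range _).union (Set.finite_range _)).union (Set.finite_range _)).union
      (Set.finite_singleton _)
  have : Algebra.IsIntegral A (integralClosure A E) := inferInstance
  obtain ⟨δ, hδ, h⟩ := exists_ne_zero_forall_apply_ne_zero (A := A) hZ fun z hz => hz.2
  refine ⟨δ, hδ, fun x hx => ?_⟩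
  have hx' := h x hx
  refine ⟨fun z w hz hw hzw => ?_, fun i => ⟨fun j l hjl => ?_, fun j l hl hlf hjl => ?_,
    fun j => ?_, ?_⟩⟩
  · by_contra hne
    refine hx' (z - w) ⟨Or.inl ⟨(z, w), ⟨hz, hw⟩, rfl⟩, sub_ne_zero.2 hne⟩ ?_
    rw [map_sub, hzw, sub_self]
  · by_contra hne
    refine hx' (⟨(D i).b j, (D i).isIntegral_b j⟩ - ⟨(D i).b l, (D i).isIntegral_b l⟩)
      ⟨Or.inr (Set.mem_iUnion.2 ⟨i, Or.inl (Or.inl (Or.inl ⟨(j, l), rfl⟩))⟩),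
        sub_ne_zero.2 fun h => hne ((D i).injective_b (congrArg Subtype.val h))⟩ ?_
    rw [map_sub, sub_eq_zero]
    exact hjl
  · refine hx' (⟨(σ i ^ l) ((D i).b j), isIntegral_apply _ ((D i).isIntegral_b j)⟩ -
        ⟨(D i).b j, (D i).isIntegral_b j⟩)
      ⟨Or.inr (Set.mem_iUnion.2 ⟨i, Or.inl (Or.inl (Or.inr ⟨(j, ⟨l, hlf⟩), rfl⟩))⟩),
        sub_ne_zero.2 fun h => (D i).pow_apply_b_ne j l hl hlf (congrArg Subtype.val h)⟩ ?_
    rw [map_sub, sub_eq_zero]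
    exact hjl
  · exact hx' _ ⟨Or.inr (Set.mem_iUnion.2 ⟨i, Or.inl (Or.inr ⟨j, rfl⟩)⟩),
      fun h => (D i).y_ne_zero j (congrArg Subtype.val h)⟩
  · refine hx' _ ⟨Or.inr (Set.mem_iUnion.2 ⟨i, Or.inr rfl⟩), fun h => ?_⟩
    have h1 : aeval (D i).α (minpoly A (D i).α).derivative = 0 := by
      have := congrArg (integralClosure A E).val h
      rwa [← aeval_algHom_apply, map_zero] at this
    have hint : IsIntegral k (D i).α := (D i).isIntegral_α.tower_top
    have h2 : (minpoly k (D i).α).Separable := (minpoly.irreducible hint).separable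
    rw [minpoly.isIntegrallyClosed_eq_field_fractions' k (D i).isIntegral_α] at h2
    have h3 := h2.eval₂_derivative_ne_zero (algebraMap k E) (x := (D i).α) (by
      rw [← minpoly.isIntegrallyClosed_eq_field_fractions' k (D i).isIntegral_α]
      exact minpoly.aeval k (D i).α)
    rw [derivative_map, eval₂_map, ← IsScalarTower.algebraMap_eq] at h3
    exact h3 h1

end

/-- First order expansion of a family of polynomials. -/
theorem exists_map_eval₂RingHom_add_eq {A O : Type*} [CommRing A] [CommRing O] (θ : A →+* O)
    (a ϖ : O) (P H : Polynomial (Polynomial A))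
    (h : ∀ l, eval₂RingHom θ a (P.coeff l).derivative = -eval₂RingHom θ a (H.coeff l)) :
    ∃ r : Polynomial O, P.map (eval₂RingHom θ (a + ϖ)) =
      P.map (eval₂RingHom θ a) - C ϖ * H.map (eval₂RingHom θ a) + C (ϖ ^ 2) * r := by
  have hdvd : C (ϖ ^ 2) ∣ P.map (eval₂RingHom θ (a + ϖ)) -
      (P.map (eval₂RingHom θ a) - C ϖ * H.map (eval₂RingHom θ a)) := by
    refine (C_dvd_iff_dvd_coeff _ _).2 fun l => ?_
    obtain ⟨c, hc⟩ := Polynomial.binomExpansion ((P.coeff l).map θ) a ϖ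
    refine ⟨c, ?_⟩
    have hl := h l
    simp only [coe_eval₂RingHom, ← eval_map] at hl
    simp only [coeff_sub, coeff_C_mul, coeff_map, coe_eval₂RingHom, ← eval_map]
    rw [hc, derivative_map, hl]
    ring
  obtain ⟨r, hr⟩ := hdvd
  exact ⟨r, by rw [← hr]; ring⟩

section

variable {A k E : Type} [CommRing A] [Field k] [Field E] [Algebra A k]
  [Algebra k E] [Algebra A E] [IsScalarTower A k E]

theorem pow_pow_eq_apply_pow {σ : E ≃ₐ[k] E} {F : Type*} [Field F] {x : integralClosure A E →+* F}
    {q : ℕ} (hx : ∀ b : integralClosure A E, x b ^ q = x ⟨σ b, isIntegral_apply σ b.2⟩) (j : ℕ)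
    (b : integralClosure A E) :
    x b ^ q ^ j = x ⟨(σ ^ j) b, isIntegral_apply (σ ^ j) b.2⟩ := by
  induction j with
  | zero => simp
  | succ j ih =>
    rw [pow_succ q, pow_mul, ih, hx]
    refine congrArg x (Subtype.ext ?_)
    change σ ((σ ^ j) b) = (σ ^ (j + 1)) b
    rw [pow_succ', AlgEquiv.mul_apply]

/-- Existence of a Frobenius element. -/
theorem exists_forall_pow_eq [IsIntegrallyClosed A] [IsFractionRing A k] [FiniteDimensional k E]
    [IsGalois k E] {F : Type} [Field F]
    (p n : ℕ) [Fact p.Prime] [CharP F p] (x : integralClosure A E →+* F)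
    (hx : ∀ a : A, x (algebraMap A _ a) ^ p ^ n = x (algebraMap A _ a)) :
    ∃ σ : E ≃ₐ[k] E, ∀ b : integralClosure A E,
      x b ^ p ^ n = x ⟨σ b, isIntegral_apply σ b.2⟩ := by
  obtain ⟨g, hg⟩ := exists_forall_eq_apply_of_stable (G := E ≃ₐ[k] E)
    (integralClosure A E).toSubring (fun g b hb => isIntegral_apply g hb) x
    ((iterateFrobenius F p n).comp x) (by
      intro b hb
      obtain ⟨y, hy⟩ := (IsGalois.mem_bot_iff_fixed (F := k) (E := E) (b : E)).2 hb
      have hyint : IsIntegral A y := by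
        rw [← isIntegral_algebraMap_iff (algebraMap k E).injective]
        have : algebraMap k E y = b := hy
        rw [this]; exact b.2
      obtain ⟨a, rfl⟩ := IsIntegrallyClosed.isIntegral_iff.1 hyint
      have ha : b = algebraMap A (integralClosure A E) a := Subtype.ext (by
        rw [← hy]; exact (IsScalarTower.algebraMap_apply A k E a).symm)
      rw [ha]
      exact (hx a).symm)
  exact ⟨g, fun b => hg b⟩

variable [IsDomain A] [IsIntegrallyClosed A] [IsFractionRing A k]

/-- A place of the base at which a ramification datum is unramified gives a point of the base at
which the polynomial has roots generating a prescribed tame extension. -/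
theorem exists_roots_of_isGood {N : ℕ} {P : Polynomial (Polynomial A)} {σ : E ≃ₐ[k] E}
    {e f : ℕ} {ρ : E} (D : RamificationDatum A A σ N e f ρ P) (hρ : IsIntegral A ρ)
    {O Ω L F : Type} [CommRing O] [IsDomain O] [IsDiscreteValuationRing O]
    [IsAdicComplete (IsLocalRing.maximalIdeal O) O] [Finite (IsLocalRing.ResidueField O)]
    [Field Ω] [Field L] [Algebra Ω L] [Algebra O L] [Field F]
    (θ : A →+* O) (ψ : O →+* F) (hψ : RingHom.ker ψ = IsLocalRing.maximalIdeal O)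
    (x : integralClosure A E →+* F) (hx : ∀ a, x (algebraMap A _ a) = ψ (θ a))
    (hfrob : ∀ b : integralClosure A E, x b ^ Nat.card (IsLocalRing.ResidueField O) =
      x ⟨σ b, isIntegral_apply σ b.2⟩)
    (hD : D.IsGood x) {ϖ : O} (htame : ∀ (f₀ h₀ r₀ : Polynomial O) {κ : Type} [Fintype κ]
      (b y : κ → F), Function.Injective b → f₀.map ψ = ∏ i, (X - C (b i)) →
      (∀ i, b i ^ Nat.card (IsLocalRing.ResidueField O) ^ f = b i) →
      (∀ i j, 0 < j → j < f → b i ^ Nat.card (IsLocalRing.ResidueField O) ^ j ≠ b i) →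
      (∀ i, y i ≠ 0) →
      (∀ i, y i ^ Nat.card (IsLocalRing.ResidueField O) ^ f = x ⟨ρ, hρ⟩ * y i) →
      (∀ i, h₀.eval₂ ψ (b i) = (y i * f₀.derivative.eval₂ ψ (b i)) ^ e) →
      ∃ β : κ × Fin e → L, Function.Injective β ∧
        (∀ i, (f₀ ^ e - C ϖ * h₀ + C (ϖ ^ 2) * r₀).eval₂ (algebraMap O L) (β i) = 0) ∧
        ∀ (δ : L ≃ₐ[Ω] L) i, δ (β i) = β i → δ = 1) :
    ∃ (t : O) (β : Fin D.m × Fin e → L), Function.Injective β ∧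
      (∀ i, (P.map (eval₂RingHom θ t)).eval₂ (algebraMap O L) (β i) = 0) ∧
      ∀ (δ : L ≃ₐ[Ω] L) i, δ (β i) = β i → δ = 1 := by
  have hinjA : Function.Injective (algebraMap A E) := by
    rw [IsScalarTower.algebraMap_eq A k E]
    exact (algebraMap k E).injective.comp (IsFractionRing.injective A k)
  have : IsDomain (integralClosure A E) := inferInstance
  let a : integralClosure A E := ⟨D.α, D.isIntegral_α⟩
  have hxa : x a ^ Nat.card (IsLocalRing.ResidueField O) = x a := by
    rw [hfrob]
    exact congrArg x (Subtype.ext D.apply_α)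
  obtain ⟨a₀, ha₀⟩ := mem_range_of_pow_card_eq ψ hψ hxa
  have hxc : x.comp (algebraMap A (integralClosure A E)) = ψ.comp θ := RingHom.ext hx
  have heval : ∀ (g : Polynomial A) (u : O), ψ u = x a → ψ ((g.map θ).eval u) = x (aeval a g) := by
    intro g u hu
    rw [eval_map, hom_eval₂, hu, aeval_def, hom_eval₂, hxc]
  have : Module.IsTorsionFree A E := Module.isTorsionFree_iff_algebraMap_injective.2 hinjA
  have hker : ∀ u : O, u ∈ IsLocalRing.maximalIdeal O ↔ ψ u = 0 := fun u => by
    rw [← hψ, RingHom.mem_ker]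
  have hμ : aeval a (minpoly A D.α) = 0 := Subtype.ext (by
    have : ((aeval a (minpoly A D.α) : integralClosure A E) : E) = aeval D.α (minpoly A D.α) :=
      (aeval_algHom_apply (integralClosure A E).val a _).symm
    rw [this, minpoly.aeval]; rfl)
  obtain ⟨α₀, hα₀, hα₀'⟩ := exists_isRoot_of_isAdicComplete ((minpoly A D.α).map θ) a₀
    ((hker _).2 (by rw [heval _ _ ha₀, hμ, map_zero])) (by
      rw [derivative_map]
      by_contra h
      exact hD.derivative_ne_zero (by
        rw [← heval _ _ ha₀]
        exact (hker _).1 ((IsLocalRing.mem_maximalIdeal _).2 h)))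
  have hψα : ψ α₀ = x a := by
    rw [← ha₀, ← sub_eq_zero, ← map_sub]
    exact (hker _).1 hα₀'
  let ev : Polynomial A →+* O := eval₂RingHom θ α₀
  have hev : ψ.comp ev = x.comp (aeval a : Polynomial A →ₐ[A] integralClosure A E).toRingHom := by
    refine RingHom.ext fun g => ?_
    exact (congrArg ψ (eval_map θ α₀).symm).trans (heval g α₀ hψα)
  have hev0 : ∀ g : Polynomial A, aeval D.α g = 0 → ev g = 0 := by
    intro g hg
    obtain ⟨c, rfl⟩ := minpoly.isIntegrallyClosed_dvd (R := A) D.isIntegral_α hg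
    have : ev (minpoly A D.α) = 0 := by
      have := hα₀
      rwa [IsRoot.def, eval_map] at this
    rw [map_mul, this, zero_mul]
  let val : integralClosure A E →+* E := (integralClosure A E).val.toRingHom
  have hval : Function.Injective val := Subtype.val_injective
  have hav : val.comp (aeval a : Polynomial A →ₐ[A] integralClosure A E).toRingHom =
      (aeval D.α : Polynomial A →ₐ[A] E).toRingHom :=
    RingHom.ext fun g => (aeval_algHom_apply (integralClosure A E).val a g).symm
  let evB := (aeval a : Polynomial A →ₐ[A] integralClosure A E).toRingHom
  let bB : Fin D.m → integralClosure A E := fun i => ⟨D.b i, D.isIntegral_b i⟩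
  let yB : Fin D.m → integralClosure A E := fun i => ⟨D.y i, D.isIntegral_y i⟩
  have hprod : (∏ i, (X - C (bB i))).map val = ∏ i, (X - C (D.b i)) := by
    rw [Polynomial.map_prod]
    refine Finset.prod_congr rfl fun i _ => ?_
    rw [Polynomial.map_sub, map_X, map_C]; rfl
  have hFB : D.F.map evB = ∏ i, (X - C (bB i)) := by
    refine map_injective val hval ?_
    rw [map_map, hav, D.map_F, hprod]
  have hHB : ∀ i, (D.H.map evB).eval (bB i) =
      (yB i * (∏ i, (X - C (bB i))).derivative.eval (bB i)) ^ e := by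
    intro i
    refine hval ?_
    rw [map_pow, map_mul, ← eval_map_apply, ← eval_map_apply, map_map, hav, ← derivative_map, hprod]
    exact D.eval_H i
  have hPF : P.map ev = (D.F.map ev) ^ e := by
    rw [← Polynomial.map_pow, ← sub_eq_zero, ← Polynomial.map_sub]
    ext l
    rw [coeff_map, coeff_zero]
    refine hev0 _ ?_
    have h := congrArg (coeff · l) D.map_P
    rw [← D.map_F, ← Polynomial.map_pow, coeff_map, coeff_map] at h
    rw [coeff_sub, map_sub, sub_eq_zero]
    exact h
  obtain ⟨r₀, hr₀⟩ := exists_map_eval₂RingHom_add_eq θ α₀ ϖ P D.H fun l => by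
    have := hev0 ((P.coeff l).derivative + D.H.coeff l) (by
      rw [map_add, D.derivative_P, neg_add_cancel])
    rw [map_add] at this
    exact eq_neg_of_add_eq_zero_left this
  obtain ⟨β, hβ, hroot, hfix⟩ := htame (D.F.map ev) (D.H.map ev) r₀ (fun i => x (bB i))
    (fun i => x (yB i)) hD.injective_b
    (by
      rw [map_map, hev, ← map_map]
      change (D.F.map evB).map x = _
      rw [hFB, Polynomial.map_prod]
      simp)
    (fun i => by
      rw [pow_pow_eq_apply_pow hfrob]
      exact congrArg x (Subtype.ext (D.pow_apply_b i)))
    (fun i j h0 hj => by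
      rw [pow_pow_eq_apply_pow hfrob]
      exact hD.pow_apply_b_ne i j h0 hj)
    hD.y_ne_zero
    (fun i => by
      rw [pow_pow_eq_apply_pow hfrob, ← map_mul]
      exact congrArg x (Subtype.ext (D.pow_apply_y i)))
    (fun i => by
      rw [derivative_map, eval₂_map, eval₂_map, hev]
      change D.H.eval₂ (x.comp evB) _ = (_ * D.F.derivative.eval₂ (x.comp evB) _) ^ e
      rw [← hom_eval₂, ← hom_eval₂, ← eval_map, ← eval_map, hHB, ← derivative_map, hFB,
        map_pow, map_mul])
  refine ⟨α₀ + ϖ, β, hβ, fun i => ?_, hfix⟩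
  rw [hr₀]
  change (P.map ev - _ + _).eval₂ _ _ = 0
  rw [hPF]
  exact hroot i

end

/-- Indexing of the roots of a monic split polynomial. -/
theorem exists_eq_prod_X_sub_C {E : Type} [Field E] {Φ : Polynomial E} (hΦ : Φ.Monic)
    (hs : Φ.Splits) :
    ∃ (ι : Type) (_ : Fintype ι) (r : ι → E), Φ = ∏ i, (X - C (r i)) := by
  classical
  refine ⟨Φ.roots.ToType, inferInstance, fun i => i, ?_⟩
  have h := hs.eq_prod_roots_of_monic hΦ
  conv_lhs => rw [h, ← Multiset.map_univ_coe Φ.roots, Multiset.map_map]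
  rfl

/-- Roots of a split polynomial modulo a prime lift. -/
theorem exists_isRoot_of_eval₂_eq_zero {A E F : Type} [CommRing A] [Field E] [Algebra A E] [Field F]
    (Φ : Polynomial A) (hΦ : Φ.Monic) (hs : (Φ.map (algebraMap A E)).Splits)
    (x : integralClosure A E →+* F) {z : F}
    (hz : Φ.eval₂ (x.comp (algebraMap A (integralClosure A E))) z = 0) :
    ∃ w : integralClosure A E, aeval w Φ = 0 ∧ x w = z := by
  obtain ⟨ι, _, r, hr⟩ := exists_eq_prod_X_sub_C (hΦ.map _) hs
  have hint : ∀ i, IsIntegral A (r i) := fun i => ⟨Φ, hΦ, by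
    rw [← eval_map, hr, eval_prod]
    exact Finset.prod_eq_zero (Finset.mem_univ i) (by simp)⟩
  have hB := map_integralClosure_eq r hint Φ hr
  rw [← eval_map, ← map_map, hB, Polynomial.map_prod, eval_prod, Finset.prod_eq_zero_iff] at hz
  obtain ⟨i, -, hi⟩ := hz
  refine ⟨⟨r i, hint i⟩, ?_, ?_⟩
  · rw [aeval_def, ← eval_map, hB, eval_prod]
    exact Finset.prod_eq_zero (Finset.mem_univ i) (by simp)
  · have hi' : z - x ⟨r i, hint i⟩ = 0 := by simpa using hi
    exact (sub_eq_zero.1 hi').symm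

theorem orderOf_natCast_pos_and_le {N q : ℕ} (hN : 0 < N) (hq : q.Coprime N) :
    0 < orderOf (q : ZMod N) ∧ orderOf (q : ZMod N) ≤ N := by
  have : NeZero N := ⟨hN.ne'⟩
  rw [← ZMod.coe_unitOfCoprime q hq, orderOf_units]
  refine ⟨orderOf_pos _, (orderOf_le_card_univ).trans ?_⟩
  rw [ZMod.card_units_eq_totient]
  exact Nat.totient_le N

theorem orderOf_natCast_dvd_iff {N q : ℕ} (hq : 0 < q) (m : ℕ) :
    orderOf (q : ZMod N) ∣ m ↔ N ∣ q ^ m - 1 := by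
  rw [orderOf_dvd_iff_pow_eq_one, ← ZMod.natCast_eq_zero_iff, Nat.cast_sub (Nat.one_le_pow _ _ hq),
    sub_eq_zero]
  simp

theorem pow_pow_eq_self_iff {F : Type*} [Field F] {q : ℕ} (hq : 0 < q) {z : F} (hz : z ≠ 0)
    (m : ℕ) : z ^ q ^ m = z ↔ z ^ (q ^ m - 1) = 1 := by
  conv_lhs => lhs; rw [← Nat.sub_add_cancel (Nat.one_le_pow m q hq), pow_succ]
  exact ⟨fun h => mul_right_cancel₀ hz (h.trans (one_mul z).symm), fun h => by rw [h, one_mul]⟩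

/-- The order of Frobenius is divisible by `N` as soon as it acts on an `N`-th root of `s - ζ`
with full order. -/
theorem dvd_of_pow_pow_eq {F : Type*} [Field F] {N q m : ℕ} (hN : 0 < N) (hq : 1 < q)
    (hqN : q.Coprime N) {ζ z : F} (hζ : IsPrimitiveRoot ζ N)
    (hz : z ^ (q ^ orderOf (q : ZMod N) - 1) = ζ)
    (hζm : ζ ^ q ^ m = ζ) (hzm : z ^ q ^ m = z) : N ∣ m := by
  have hζ0 : ζ ≠ 0 := hζ.ne_zero hN.ne'
  have hq0 : 0 < q := by omega
  have hd := (orderOf_natCast_pos_and_le hN hqN).1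
  have hz0 : z ≠ 0 := by
    rintro rfl
    rw [zero_pow (Nat.sub_pos_of_lt (Nat.one_lt_pow hd.ne' hq)).ne'] at hz
    exact hζ0 hz.symm
  rw [pow_pow_eq_self_iff hq0 hζ0] at hζm
  rw [pow_pow_eq_self_iff hq0 hz0] at hzm
  obtain ⟨l, rfl⟩ := (orderOf_natCast_dvd_iff hq0 m).2 (hζ.dvd_of_pow_eq_one _ hζm)
  refine Dvd.dvd.mul_left ?_ _
  have hM := Nat.geomSum_eq (Nat.one_lt_pow hd.ne' hq) l
  set D := q ^ orderOf (q : ZMod N) with hD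
  have hdvd : D - 1 ∣ D ^ l - 1 := by simpa using Nat.sub_dvd_pow_sub_pow D 1 l
  have h1 : D ^ l - 1 = (D - 1) * ∑ i ∈ Finset.range l, D ^ i := by
    rw [hM, Nat.mul_div_cancel' hdvd]
  rw [pow_mul, ← hD, h1, pow_mul, hz] at hzm
  have h2 := hζ.dvd_of_pow_eq_one _ hzm
  rw [← ZMod.natCast_eq_zero_iff] at h2 ⊢
  have hD1 : (D : ZMod N) = 1 := by rw [hD, Nat.cast_pow, pow_orderOf_eq_one]
  simpa [hD1] using h2

/-- Choice of the parameter for which Frobenius acts with full order. -/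
theorem exists_frobenius_parameter (N C₀ : ℕ) (hN : 0 < N) :
    ∃ q₀ : ℕ, ∀ {O F : Type} [CommRing O] [IsLocalRing O] [Finite (IsLocalRing.ResidueField O)]
      [Field F] [IsAlgClosed F] (p : ℕ) [Fact p.Prime] [CharP F p] (ψ : O →+* F),
      RingHom.ker ψ = IsLocalRing.maximalIdeal O → ¬ p ∣ N → q₀ ≤ p →
      ∀ g : Polynomial F, g ≠ 0 → g.natDegree ≤ C₀ →
        (Nat.card (IsLocalRing.ResidueField O)).Coprime N ∧
        (∃ n, Nat.card (IsLocalRing.ResidueField O) = p ^ n ∧ 0 < n) ∧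
        ∃ (s : O) (ζ : F), g.eval (ψ s) ≠ 0 ∧ IsPrimitiveRoot ζ N ∧
          (ψ s - ζ) ^ ((Nat.card (IsLocalRing.ResidueField O) ^
            orderOf (Nat.card (IsLocalRing.ResidueField O) : ZMod N) - 1) / N) = ζ := by
  classical
  have h := fun d : Fin N => Stepanov.exists_lt_card_residueSymbol N (d + 1) C₀ hN d.1.succ_pos
  choose Q hQ using h
  refine ⟨Finset.univ.sup Q, ?_⟩
  intro O F _ _ _ _ _ p _ _ ψ hψ hpN hp g hg hgC
  have : Fintype (IsLocalRing.ResidueField O) := Fintype.ofFinite _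
  let φ : IsLocalRing.ResidueField O →+* F :=
    Ideal.Quotient.lift (IsLocalRing.maximalIdeal O) ψ fun a ha => by rwa [← hψ] at ha
  have hφ : ∀ s, φ (IsLocalRing.residue O s) = ψ s := fun s => Ideal.Quotient.lift_mk _ _ _
  have : CharP (IsLocalRing.ResidueField O) p := (φ.charP_iff φ.injective p).2 ‹_›
  obtain ⟨n, -, hn⟩ := FiniteField.card (IsLocalRing.ResidueField O) p
  have hcard : Nat.card (IsLocalRing.ResidueField O) = p ^ (n : ℕ) := by
    rw [Nat.card_eq_fintype_card, hn]
  set q := Nat.card (IsLocalRing.ResidueField O) with hq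
  have hpN' : p.Coprime N := ((Fact.out : p.Prime).coprime_iff_not_dvd).2 hpN
  have hqN : q.Coprime N := by rw [hcard]; exact Nat.Coprime.pow_left _ hpN'
  have hq1 : 1 < q := Finite.one_lt_card
  refine ⟨hqN, ⟨n, hcard, n.pos⟩, ?_⟩
  have : NeZero (N : F) := ⟨fun h => hpN ((CharP.cast_eq_zero_iff F p N).1 h)⟩
  obtain ⟨ζ, hζ⟩ := HasEnoughRootsOfUnity.exists_primitiveRoot F N
  have hζ0 : ζ ≠ 0 := hζ.ne_zero hN.ne'
  obtain ⟨hd0, hdN⟩ := orderOf_natCast_pos_and_le hN hqN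
  set d := orderOf (q : ZMod N) with hd
  have hiff : ∀ j, ζ ^ q ^ j = ζ ↔ d ∣ j := fun j => by
    rw [pow_pow_eq_self_iff (by omega) hζ0, orderOf_natCast_dvd_iff (by omega)]
    exact ⟨hζ.dvd_of_pow_eq_one _, fun h => (hζ.pow_eq_one_iff_dvd _).2 h⟩
  let R : Finset F := Finset.univ.image φ
  have hR : ∀ s ∈ R, s ^ q = s := fun s hs => by
    obtain ⟨a, -, rfl⟩ := Finset.mem_image.1 hs
    rw [← map_pow, hq, Nat.card_eq_fintype_card, FiniteField.pow_card]
  have hRc : q ≤ R.card := by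
    rw [Finset.card_image_of_injective _ φ.injective, Finset.card_univ, hq,
      Nat.card_eq_fintype_card]
  have hdd : d - 1 + 1 = d := Nat.sub_add_cancel hd0
  have hQle : Q ⟨d - 1, by omega⟩ ≤ q :=
    (Finset.le_sup (Finset.mem_univ _)).trans (hp.trans (by
      rw [hcard]; exact Nat.le_self_pow n.pos.ne' p))
  have key := hQ ⟨d - 1, by omega⟩ F p n q hcard hQle
  simp only [hdd] at key
  have key' := key ((orderOf_natCast_dvd_iff (by omega) d).1 dvd_rfl) R hR hRc ζ ζ
    ((hiff d).2 dvd_rfl) (fun j hj0 hjd hj => (Nat.not_dvd_of_pos_of_lt hj0 hjd) ((hiff j).1 hj))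
    hζ.pow_eq_one
  obtain ⟨s, hs, hsg⟩ : ∃ s ∈ R.filter (fun s => (s - ζ) ^ ((q ^ d - 1) / N) = ζ), g.eval s ≠ 0 := by
    by_contra! h
    refine absurd (Finset.card_le_card (t := g.roots.toFinset) fun s hs => ?_)
      (not_le.2 (((Multiset.toFinset_card_le _).trans (card_roots' g)).trans_lt
        (hgC.trans_lt key')))
    exact Multiset.mem_toFinset.2 ((mem_roots hg).2 (h s hs))
  rw [Finset.mem_filter] at hs
  obtain ⟨a, -, rfl⟩ := Finset.mem_image.1 hs.1
  obtain ⟨s₀, rfl⟩ := IsLocalRing.residue_surjective a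
  rw [hφ] at hsg hs
  exact ⟨s₀, ζ, hsg, hζ, hs.2⟩

theorem apply_pow_natCard_residueField {O F : Type*} [CommRing O] [IsLocalRing O]
    [Finite (IsLocalRing.ResidueField O)] [Field F] (ψ : O →+* F)
    (hψ : RingHom.ker ψ = IsLocalRing.maximalIdeal O) (b : O) :
    ψ b ^ Nat.card (IsLocalRing.ResidueField O) = ψ b := by
  have : Fintype (IsLocalRing.ResidueField O) := Fintype.ofFinite _
  rw [← sub_eq_zero, ← map_pow, ← map_sub, ← RingHom.mem_ker, hψ, ← IsLocalRing.residue_eq_zero_iff,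
    map_sub, map_pow, Nat.card_eq_fintype_card, FiniteField.pow_card, sub_self]

theorem exists_roots_of_place {A k E : Type} [CommRing A] [Field k] [Field E] [Algebra A k]
    [Algebra k E] [Algebra A E] [IsScalarTower A k E] [IsDomain A] [IsIntegrallyClosed A]
    [IsFractionRing A k] [FiniteDimensional k E] [IsGalois k E]
    {N : ℕ} (hN : 0 < N) {P : Polynomial (Polynomial A)} {I : Type}
    {σ : I → (E ≃ₐ[k] E)} {e f : I → ℕ} {ρ : I → E}
    (D : ∀ i, RamificationDatum A A (σ i) N (e i) (f i) (ρ i) P)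
    (hI : ∀ (σ' : E ≃ₐ[k] E) (e' f' : ℕ) (ρ' : E), 0 < e' → 0 < f' → e' * f' ∣ N →
      N ∣ orderOf σ' → ρ' ^ e' = 1 → σ' ρ' = ρ' →
      ∃ i, σ i = σ' ∧ e i = e' ∧ f i = f' ∧ ρ i = ρ')
    (hsplit : ((X ^ N - 1 : Polynomial A).map (algebraMap A E)).Splits) {a : A}
    (hsplit' : (((X ^ N - C a) ^ N - C ((-1) ^ N) : Polynomial A).map (algebraMap A E)).Splits)
    {O Ω L F : Type} [CommRing O] [IsDomain O]
    [IsDiscreteValuationRing O] [IsAdicComplete (IsLocalRing.maximalIdeal O) O]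
    [Finite (IsLocalRing.ResidueField O)]
    [Field Ω] [Algebra O Ω] [IsFractionRing O Ω] [Field L] [Algebra Ω L]
    [FiniteDimensional Ω L] [IsGalois Ω L] [Algebra O L] [IsScalarTower O Ω L]
    (hcard : Nat.card (L ≃ₐ[Ω] L) ∣ N) [Field F] [IsAlgClosed F] (p n : ℕ) [Fact p.Prime]
    [CharP F p] (hp : Nat.card (IsLocalRing.ResidueField O) = p ^ n) (hpN : ¬ p ∣ N)
    (ψ : O →+* F) (hψ : RingHom.ker ψ = IsLocalRing.maximalIdeal O) (θ : A →+* O)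
    {ζ : F} (hζ : IsPrimitiveRoot ζ N)
    (hcop : (Nat.card (IsLocalRing.ResidueField O)).Coprime N)
    (hpow : (ψ (θ a) - ζ) ^ ((Nat.card (IsLocalRing.ResidueField O) ^
      orderOf (Nat.card (IsLocalRing.ResidueField O) : ZMod N) - 1) / N) = ζ)
    (hgood : ∀ x : integralClosure A E →+* F, (∀ b, x (algebraMap A _ b) = ψ (θ b)) →
      (∀ z w : integralClosure A E, z ^ N = 1 → w ^ N = 1 → x z = x w → z = w) ∧
        ∀ i, (D i).IsGood x) :
    ∃ (t : O) (β : Fin N → L), Function.Injective β ∧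
      (∀ i, (P.map (eval₂RingHom θ t)).eval₂ (algebraMap O L) (β i) = 0) ∧
      ∀ (δ : L ≃ₐ[Ω] L) i, δ (β i) = β i → δ = 1 := by
  obtain ⟨ϖ, hϖ⟩ := (IsPrincipalIdealRing.principal (IsLocalRing.maximalIdeal O)).principal
  have hunit : IsUnit ((Nat.card (L ≃ₐ[Ω] L) : ℕ) : O) := by
    by_contra h
    have h1 : ((Nat.card (L ≃ₐ[Ω] L) : ℕ) : O) ∈ IsLocalRing.maximalIdeal O := h
    rw [← hψ, RingHom.mem_ker, map_natCast, CharP.cast_eq_zero_iff F p] at h1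
    exact hpN (h1.trans hcard)
  obtain ⟨e', f', ρF, hef, hρe, hρq, htame⟩ := exists_roots_of_tame_field hunit hϖ ψ hψ
  have hpos : 0 < Nat.card (L ≃ₐ[Ω] L) := Nat.card_pos
  have he0 : 0 < e' := Nat.pos_of_ne_zero fun h => by rw [h, zero_mul] at hef; omega
  have hf0 : 0 < f' := Nat.pos_of_ne_zero fun h => by rw [h, mul_zero] at hef; omega
  have hinjA : Function.Injective (algebraMap A (integralClosure A E)) := by
    have : Function.Injective (algebraMap A E) := by
      rw [IsScalarTower.algebraMap_eq A k E]
      exact (algebraMap k E).injective.comp (IsFractionRing.injective A k)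
    exact fun a b h => this (congrArg Subtype.val h)
  obtain ⟨x, hx⟩ := exists_extension_of_isIntegral hinjA (ψ.comp θ)
  obtain ⟨hroots, hD⟩ := hgood x hx
  obtain ⟨φ, hφ⟩ := exists_forall_pow_eq (k := k) p n x fun b => by
    rw [← hp, hx]; exact apply_pow_natCard_residueField ψ hψ _
  rw [← hp] at hφ
  have hlift : ∀ z : F, z ^ N = 1 → ∃ w : integralClosure A E, w ^ N = 1 ∧ x w = z := by
    intro z hz
    obtain ⟨w, hw, hwz⟩ := exists_isRoot_of_eval₂_eq_zero (X ^ N - 1 : Polynomial A)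
      (monic_X_pow_sub_C 1 hN.ne') hsplit x (z := z) (by simp [hz])
    exact ⟨w, by simpa [sub_eq_zero] using hw, hwz⟩
  have hord : N ∣ orderOf φ := by
    obtain ⟨z, hz⟩ := IsAlgClosed.exists_pow_nat_eq (ψ (θ a) - ζ) hN
    obtain ⟨w, -, hw⟩ := exists_isRoot_of_eval₂_eq_zero
      ((X ^ N - C a) ^ N - C ((-1) ^ N) : Polynomial A)
      (by
        refine ((monic_X_pow_sub_C a hN.ne').pow N).sub_of_left ?_
        refine degree_C_le.trans_lt ?_
        rw [degree_pow, degree_X_pow_sub_C hN, nsmul_eq_mul]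
        exact_mod_cast Nat.mul_pos hN hN) hsplit' x (z := z) (by
          simp only [eval₂_sub, eval₂_pow, eval₂_X, eval₂_C, hz, RingHom.comp_apply, hx]
          rw [sub_sub_cancel_left, neg_pow, hζ.pow_eq_one]
          simp)
    obtain ⟨ξ, -, hξ⟩ := hlift ζ hζ.pow_eq_one
    have hfix : ∀ w : integralClosure A E,
        x w ^ Nat.card (IsLocalRing.ResidueField O) ^ orderOf φ = x w := fun w => by
      rw [pow_pow_eq_apply_pow hφ]
      exact congrArg x (Subtype.ext (by simp [pow_orderOf_eq_one]))
    refine dvd_of_pow_pow_eq hN Finite.one_lt_card hcop hζ (z := z) ?_ (hξ ▸ hfix ξ) (hw ▸ hfix w)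
    have hdvd := (orderOf_natCast_dvd_iff (N := N) (q := Nat.card (IsLocalRing.ResidueField O))
      Nat.card_pos _).1 dvd_rfl
    rw [← Nat.mul_div_cancel' hdvd, pow_mul, hz]
    exact hpow
  obtain ⟨ρB, hρN, hρx⟩ := hlift ρF (by
    obtain ⟨c, hc⟩ := (Dvd.intro _ hef : e' ∣ _).trans hcard
    rw [hc, pow_mul, hρe, one_pow])
  have hφρ : φ (ρB : E) = ρB := by
    have hN' : (⟨φ ρB, isIntegral_apply φ ρB.2⟩ : integralClosure A E) ^ N = 1 :=
      Subtype.ext (by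
        change φ (ρB : E) ^ N = 1
        rw [← map_pow]
        have : (ρB : E) ^ N = 1 := congrArg Subtype.val hρN
        rw [this, map_one])
    exact congrArg Subtype.val (hroots _ ρB hN' hρN (by rw [← hφ, hρx, hρq]))
  have hρe' : (ρB : E) ^ e' = 1 := by
    have h1 : (ρB ^ e') ^ N = 1 := by rw [← pow_mul, mul_comm, pow_mul, hρN, one_pow]
    exact congrArg Subtype.val (hroots (ρB ^ e') 1 h1 (one_pow N)
      (by rw [map_pow, hρx, hρe, map_one]))
  obtain ⟨i, rfl, rfl, rfl, hi⟩ := hI φ e' f' ρB he0 hf0 (hef ▸ hcard) hord hρe' hφρ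
  have hρint : IsIntegral A (ρ i) := hi ▸ ρB.2
  have hρx' : x ⟨ρ i, hρint⟩ = ρF := by
    rw [← hρx]; exact congrArg x (Subtype.ext hi)
  obtain ⟨t, β, hβ, hroot, hfix⟩ := exists_roots_of_isGood (Ω := Ω) (L := L) (D i) hρint θ ψ hψ x hx
    hφ (hD i) (ϖ := ϖ) (by rw [hρx']; exact htame)
  let ε : Fin N ≃ Fin (D i).m × Fin (e i) :=
    (finCongr (D i).m_mul.symm).trans finProdFinEquiv.symm
  exact ⟨t, β ∘ ε, hβ.comp ε.injective, fun j => hroot _, fun δ j => hfix δ _⟩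

theorem exists_splitting_extension (A : Type) [CommRing A] [IsDomain A] [CharZero A]
    {p q : Polynomial A} (hp : p.Monic) (hq : q.Monic) :
    ∃ (E : Type) (_ : Field E) (_ : Algebra (FractionRing A) E) (_ : Algebra A E)
      (_ : IsScalarTower A (FractionRing A) E), FiniteDimensional (FractionRing A) E ∧
      IsGalois (FractionRing A) E ∧ (p.map (algebraMap A E)).Splits ∧
      (q.map (algebraMap A E)).Splits := by
  let f := p.map (algebraMap A (FractionRing A)) * q.map (algebraMap A (FractionRing A))
  have hf : f ≠ 0 := mul_ne_zero (hp.map _).ne_zero (hq.map _).ne_zero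
  have hs := SplittingField.splits f
  rw [Polynomial.map_mul, splits_mul ((hp.map _).map _).ne_zero ((hq.map _).map _).ne_zero,
    map_map, map_map, ← IsScalarTower.algebraMap_eq] at hs
  exact ⟨f.SplittingField, inferInstance, inferInstance, inferInstance, inferInstance,
    inferInstance, IsGalois.mk, hs.1, hs.2⟩

/-- A polynomial over `S[s, t]` with prescribed specializations whose specializations at places
of almost all residue characteristics realize all Galois extensions of small degree. -/
theorem exists_integral_family (S : Type) [CommRing S] [IsDomain S] [IsIntegrallyClosed S]
    [CharZero S] {N : ℕ} (hN : 0 < N) (Q : Fin 3 → Polynomial (Polynomial S))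
    (hQ : ∀ m, (Q m).Monic) (hQN : ∀ m, (Q m).natDegree = N) :
    ∃ (P : Polynomial (Polynomial (Polynomial S))) (c δ : Polynomial S) (q₀ : ℕ),
      c ≠ 0 ∧ P.Monic ∧ P.natDegree = N ∧
      (∃ n : Fin 3 → ℕ, ∀ m, P.map (evalRingHom (n m : Polynomial S)) = (Q m).scaleRoots c) ∧
      δ ≠ 0 ∧ ∀ {O Ω L : Type} [CommRing O] [IsDomain O]
        [IsDiscreteValuationRing O] [IsAdicComplete (IsLocalRing.maximalIdeal O) O]
        [Finite (IsLocalRing.ResidueField O)]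
        [Field Ω] [Algebra O Ω] [IsFractionRing O Ω] [Field L] [Algebra Ω L]
        [FiniteDimensional Ω L] [IsGalois Ω L] [Algebra O L] [IsScalarTower O Ω L] (p : ℕ)
        [Fact p.Prime] [CharP (IsLocalRing.ResidueField O) p] (θ : S →+* O),
        Nat.card (L ≃ₐ[Ω] L) ∣ N → ¬ p ∣ N → q₀ ≤ p →
        δ.map ((IsLocalRing.residue O).comp θ) ≠ 0 →
        ∃ (s t : O) (β : Fin N → L), Function.Injective β ∧
          (∀ i, (P.map (eval₂RingHom (eval₂RingHom θ s) t)).eval₂ (algebraMap O L) (β i) = 0) ∧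
          ∀ (δ : L ≃ₐ[Ω] L) i, δ (β i) = β i → δ = 1 := by
  obtain ⟨E, _, _, _, _, _, _, hs1, hs2⟩ := exists_splitting_extension (Polynomial S)
    (p := X ^ N - 1) (q := (X ^ N - C X) ^ N - C ((-1) ^ N)) (monic_X_pow_sub_C 1 hN.ne')
    (((monic_X_pow_sub_C X hN.ne').pow N).sub_of_left (by
      refine degree_C_le.trans_lt ?_
      rw [degree_pow, degree_X_pow_sub_C hN, nsmul_eq_mul]
      exact_mod_cast Nat.mul_pos hN hN))
  let I := {i : (E ≃ₐ[FractionRing (Polynomial S)] E) × ℕ × ℕ × E // 0 < i.2.1 ∧ 0 < i.2.2.1 ∧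
    i.2.1 * i.2.2.1 ∣ N ∧ N ∣ orderOf i.1 ∧ i.2.2.2 ^ i.2.1 = 1 ∧ i.1 i.2.2.2 = i.2.2.2}
  have : Finite I := by
    have hroots : {z : E | z ^ N = 1}.Finite := by
      refine (Polynomial.finite_setOfPred_isRoot (p := (X ^ N - 1 : Polynomial E))
        (monic_X_pow_sub_C 1 hN.ne').ne_zero).subset fun z hz => ?_
      change z ^ N = 1 at hz
      simp [hz]
    refine Set.Finite.subset (s := (Set.univ : Set (E ≃ₐ[FractionRing (Polynomial S)] E)) ×ˢ
      (Set.Iic N ×ˢ (Set.Iic N ×ˢ {z : E | z ^ N = 1})))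
      (Set.finite_univ.prod ((Set.finite_Iic N).prod ((Set.finite_Iic N).prod hroots))) ?_
    rintro ⟨σ, e, f, ρ⟩ ⟨he, hf, hef, -, hρ, -⟩
    refine ⟨Set.mem_univ _, Nat.le_of_dvd hN ((Dvd.intro _ rfl).trans hef),
      Nat.le_of_dvd hN ((Dvd.intro_left _ rfl).trans hef), ?_⟩
    obtain ⟨c, hc⟩ := (Dvd.intro _ rfl : e ∣ e * f).trans hef
    change ρ ^ N = 1
    rw [hc, pow_mul]
    exact (congrArg (· ^ c) hρ).trans (one_pow c)
  obtain ⟨P, c, hc, hP, hPN, hPQ, hD⟩ := exists_integral_polynomial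
    (k := FractionRing (Polynomial S)) (E := E) N Q hQ hQN
    (fun i : I => i.1.1) (fun i => i.1.2.1) (fun i => i.1.2.2.1) (fun i => i.1.2.2.2)
    (fun i => i.2.1) (fun i => i.2.2.1) (fun i => i.2.2.2.1) (fun i => i.2.2.2.2.1)
    (fun i => i.2.2.2.2.2.1) (fun i => i.2.2.2.2.2.2)
  let D := fun i => (hD i).some
  obtain ⟨δ, hδ, hgood⟩ := exists_ne_zero_forall_isGood D hN
  obtain ⟨q₀, hq₀⟩ := exists_frobenius_parameter N δ.natDegree hN
  refine ⟨P, c, δ, q₀, hc, hP, hPN, hPQ, hδ, ?_⟩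
  intro O Ω L _ _ _ _ _ _ _ _ _ _ _ _ _ _ p _ _ θ hcard hpN hp hδp
  let F := AlgebraicClosure (IsLocalRing.ResidueField O)
  let ψ : O →+* F := (algebraMap (IsLocalRing.ResidueField O) F).comp (IsLocalRing.residue O)
  have hψ : RingHom.ker ψ = IsLocalRing.maximalIdeal O := by
    rw [RingHom.ker_comp_of_injective _ (FaithfulSMul.algebraMap_injective _ F), IsLocalRing.ker_residue]
  have : CharP F p := charP_of_injective_algebraMap (FaithfulSMul.algebraMap_injective (IsLocalRing.ResidueField O) F) p
  have hδF : δ.map (ψ.comp θ) ≠ 0 := by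
    rw [RingHom.comp_assoc, ← map_map]
    exact (Polynomial.map_ne_zero_iff (FaithfulSMul.algebraMap_injective _ F)).2 hδp
  obtain ⟨hcop, ⟨n, hn, -⟩, s, ζ, hs, hζ, hpow⟩ := hq₀ p ψ hψ hpN hp _ hδF natDegree_map_le
  obtain ⟨t, β, hβ⟩ := exists_roots_of_place hN D
    (fun σ e f ρ he hf hef hσ hρ hσρ =>
      ⟨⟨(σ, e, f, ρ), he, hf, hef, hσ, hρ, hσρ⟩, rfl, rfl, rfl, rfl⟩) hs1 hs2
    hcard p n hn hpN ψ hψ (eval₂RingHom θ s) hζ hcop (by simpa using hpow) fun x hx =>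
      hgood x (by
        rw [hx]
        simpa [eval_map, hom_eval₂] using hs)
  exact ⟨s, t, β, hβ⟩

theorem exists_splitting_field {R : Type} [CommRing R] [IsDomain R] [CharZero R] {ι : Type}
    [Fintype ι] {P : Polynomial R} (hP : P.Monic) (hι : Fintype.card ι = P.natDegree) :
    ∃ (E : Type) (_ : Field E) (_ : Algebra (FractionRing R) E) (_ : Algebra R E)
      (_ : IsScalarTower R (FractionRing R) E) (r : ι → E),
      FiniteDimensional (FractionRing R) E ∧ IsGalois (FractionRing R) E ∧
      P.map (algebraMap R E) = ∏ i, (X - C (r i)) ∧ (∀ i, IsIntegral R (r i)) ∧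
      Algebra.adjoin (FractionRing R) (Set.range r) = ⊤ := by
  let p := P.map (algebraMap R (FractionRing R))
  let E := p.SplittingField
  have hsplit : (P.map (algebraMap R E)).Splits := by
    have := SplittingField.splits p
    rwa [map_map, ← IsScalarTower.algebraMap_eq] at this
  obtain ⟨ι', _, r', hr'⟩ := exists_eq_prod_X_sub_C (hP.map (algebraMap R E)) hsplit
  have hcard : Fintype.card ι' = Fintype.card ι := by
    have := congrArg natDegree hr'
    rw [natDegree_finsetProd_X_sub_C_eq_card, hP.natDegree_map] at this
    rw [hι, this, Finset.card_univ]
  let ε := Fintype.equivOfCardEq hcard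
  let r : ι → E := fun i => r' (ε.symm i)
  have hr : P.map (algebraMap R E) = ∏ i, (X - C (r i)) := by
    rw [hr']
    exact (Equiv.prod_comp ε.symm fun i => X - C (r' i)).symm
  have hroot : ∀ i, P.eval₂ (algebraMap R E) (r i) = 0 := fun i => by
    rw [← eval_map, hr, eval_prod]
    exact Finset.prod_eq_zero (Finset.mem_univ i) (by simp)
  refine ⟨E, inferInstance, inferInstance, inferInstance, inferInstance, r, inferInstance,
    IsGalois.mk, hr, fun i => ⟨P, hP, hroot i⟩, ?_⟩
  rw [← top_le_iff, ← SplittingField.adjoin_rootSet p]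
  refine Algebra.adjoin_mono fun z hz => ?_
  have hz' := (mem_rootSet.1 hz).2
  rw [aeval_def, eval₂_map, ← IsScalarTower.algebraMap_eq, ← eval_map, hr, eval_prod,
    Finset.prod_eq_zero_iff] at hz'
  obtain ⟨i, -, hi⟩ := hz'
  rw [eval_sub, eval_X, eval_C, sub_eq_zero] at hi
  exact ⟨i, hi.symm⟩

/-- The splitting field over `K(s, t)` of a polynomial with suitable specializations. -/
theorem exists_splitting_symmetric {S K : Type} [CommRing S] [Field K] [Algebra S K] [CharZero K]
    (hSK : Function.Injective (algebraMap S K)) {N : ℕ} (hN : 3 ≤ N) {ι : Type} [Fintype ι]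
    (hι : Fintype.card ι = N) {P : Polynomial (Polynomial (Polynomial S))} (hP : P.Monic)
    (hPN : P.natDegree = N) {c : Polynomial S} (hc : c ≠ 0) (n : Fin 3 → ℕ)
    (hPn : ∀ m, P.map (evalRingHom (n m : Polynomial S)) = (fibre N X m).scaleRoots c) :
    ∃ (E : Type) (_ : Field E) (_ : Algebra (FractionRing (Polynomial (Polynomial K))) E)
      (_ : Algebra (Polynomial (Polynomial K)) E) (_ : IsScalarTower (Polynomial (Polynomial K))
        (FractionRing (Polynomial (Polynomial K))) E) (r : ι → E),
      FiniteDimensional (FractionRing (Polynomial (Polynomial K))) E ∧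
      IsGalois (FractionRing (Polynomial (Polynomial K))) E ∧
      (P.map (mapRingHom (mapRingHom (algebraMap S K)))).map
        (algebraMap (Polynomial (Polynomial K)) E) = ∏ i, (X - C (r i)) ∧
      (∀ i, IsIntegral (Polynomial (Polynomial K)) (r i)) ∧
      Algebra.adjoin (FractionRing (Polynomial (Polynomial K))) (Set.range r) = ⊤ ∧
      Function.Injective r ∧
      ∀ π : Equiv.Perm ι, ∃ g : E ≃ₐ[FractionRing (Polynomial (Polynomial K))] E,
        ∀ i, g (r i) = r (π i) := by
  let R := Polynomial (Polynomial K)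
  let F₀ := FractionRing R
  let PR : Polynomial R := P.map (mapRingHom (mapRingHom (algebraMap S K)))
  have hPR : PR.Monic := hP.map _
  obtain ⟨E, _, _, _, _, r, _, _, hr, hint, hadj⟩ := exists_splitting_field (ι := ι) hPR (by
    rw [hP.natDegree_map, hPN, hι])
  let k := FractionRing (Polynomial K)
  have hk : Function.Injective (algebraMap (Polynomial K) k) := IsFractionRing.injective _ _
  obtain ⟨h1, h2⟩ := injective_and_forall_perm_of_fibres (k := k) (F₀ := F₀) (E := E) (R := R)
    hι hN (s := algebraMap (Polynomial K) k X)
    (c := algebraMap (Polynomial K) k (c.map (algebraMap S K)))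
    ((map_ne_zero_iff _ hk).2 ((Polynomial.map_ne_zero_iff hSK).2 hc))
    (fun j h => by
      rw [← map_natCast (algebraMap (Polynomial K) k), ← map_pow] at h
      have := congrArg natDegree (hk h)
      rw [natDegree_X, ← Nat.cast_pow, natDegree_natCast] at this
      exact zero_ne_one this)
    (fun n hn => irreducible_X_pow_sub_C_X K k hn)
    (fun m => (algebraMap (Polynomial K) k).comp (evalRingHom (n m : Polynomial K))) r hint PR hr
    (fun m => by
      have h3 : PR.map (evalRingHom (n m : Polynomial K)) =
          (P.map (evalRingHom (n m : Polynomial S))).map (mapRingHom (algebraMap S K)) := by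
        rw [map_map, map_map]
        congr 1
        ext <;> simp
      rw [← map_map, h3, hPn, map_scaleRoots _ _ _ ?_, map_scaleRoots _ _ _ ?_, map_fibre,
        map_fibre]
      · simp
      · rw [map_fibre, (monic_fibre hN _ _).leadingCoeff, map_one]; exact one_ne_zero
      · rw [(monic_fibre hN _ _).leadingCoeff, map_one]; exact one_ne_zero)
  exact ⟨E, _, _, _, ‹_›, r, ‹_›, ‹_›, hr, hint, hadj, h1, h2⟩

/-- A group acting on the generators of a field extension with full symmetric Galois group acts on
the extension. -/
theorem exists_monoidHom_of_forall_perm {F₀ E ι G : Type*} [Field F₀] [Field E] [Algebra F₀ E]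
    {r : ι → E} (hadj : Algebra.adjoin F₀ (Set.range r) = ⊤)
    (hfull : ∀ π : Equiv.Perm ι, ∃ g : E ≃ₐ[F₀] E, ∀ i, g (r i) = r (π i)) [Group G]
    [MulAction G ι] : ∃ j : G →* (E ≃ₐ[F₀] E), ∀ g i, j g (r i) = r (g • i) := by
  choose a ha using fun g : G => hfull (MulAction.toPerm g)
  have hext : ∀ u v : E ≃ₐ[F₀] E, (∀ i, u (r i) = v (r i)) → u = v := by
    intro u v h
    have : (u : E →ₐ[F₀] E) = v := AlgHom.ext_of_adjoin_eq_top hadj (by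
      rintro _ ⟨i, rfl⟩
      exact h i)
    exact AlgEquiv.ext fun z => DFunLike.congr_fun this z
  refine ⟨MonoidHom.mk' a fun g h => hext _ _ fun i => ?_, ha⟩
  rw [AlgEquiv.mul_apply, ha, ha, ha]
  simp [mul_smul]

/-- A finite extension of `K(s, t)` is finitely generated. -/
theorem fg_top_of_finiteDimensional {K R F₀ F : Type*} [Field K] [CommRing R] [Field F₀] [Field F]
    [Algebra K R] [Algebra R F₀] [IsFractionRing R F₀] [Algebra K F₀] [IsScalarTower K R F₀]
    [Algebra F₀ F] [FiniteDimensional F₀ F] [Algebra K F] [IsScalarTower K F₀ F]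
    [Algebra.FiniteType K R] : (⊤ : IntermediateField K F).FG := by
  have : Algebra.EssFiniteType R F₀ := Algebra.EssFiniteType.of_isLocalization _ (nonZeroDivisors R)
  have : Algebra.EssFiniteType K F₀ := Algebra.EssFiniteType.comp K R F₀
  have : Algebra.EssFiniteType K F := Algebra.EssFiniteType.comp K F₀ F
  exact IntermediateField.fg_top K F

/-- A finite extension of `K(s, t)` has transcendence degree two. -/
theorem exists_algebraicIndependent_pair {K F₀ F : Type*} [Field K] [Field F₀] [Field F]
    [Algebra (Polynomial (Polynomial K)) F₀] [IsFractionRing (Polynomial (Polynomial K)) F₀]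
    [Algebra K F₀] [IsScalarTower K (Polynomial (Polynomial K)) F₀] [Algebra F₀ F]
    [FiniteDimensional F₀ F] [Algebra K F] [IsScalarTower K F₀ F] :
    ∃ x y : F, AlgebraicIndependent K ![x, y] ∧
      Algebra.IsAlgebraic (IntermediateField.adjoin K {x, y}) F := by
  let _ : Algebra (Polynomial (Polynomial K)) F :=
    ((algebraMap F₀ F).comp (algebraMap _ F₀)).toAlgebra
  have : IsScalarTower (Polynomial (Polynomial K)) F₀ F := .of_algebraMap_eq fun _ => rfl
  have : IsScalarTower K (Polynomial (Polynomial K)) F := .of_algebraMap_eq fun a => by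
    rw [IsScalarTower.algebraMap_apply K F₀ F, IsScalarTower.algebraMap_apply K (Polynomial (Polynomial K)) F₀]; rfl
  have hinj : Function.Injective (algebraMap (Polynomial (Polynomial K)) F) :=
    (algebraMap F₀ F).injective.comp (IsFractionRing.injective _ F₀)
  let φ : Polynomial (Polynomial K) →ₐ[K] F := IsScalarTower.toAlgHom K _ F
  refine ⟨φ (C X), φ X, ?_, ?_⟩
  · have : MvPolynomial.aeval ![φ (C X), φ X] =
        φ.comp (Polynomial.Bivariate.equivMvPolynomial K).symm.toAlgHom := by
      ext i
      fin_cases i <;> simp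
    rw [algebraicIndependent_iff_injective_aeval, this]
    exact hinj.comp (Polynomial.Bivariate.equivMvPolynomial K).symm.injective
  · let M := IntermediateField.adjoin K {φ (C X), φ X}
    have hmem : ∀ p, φ p ∈ M.toSubalgebra := by
      intro p
      induction p using Polynomial.induction_on' with
      | add p q hp hq => rw [map_add]; exact add_mem hp hq
      | monomial n a =>
        rw [← C_mul_X_pow_eq_monomial, map_mul, map_pow]
        refine mul_mem ?_ (pow_mem (IntermediateField.subset_adjoin K _ (by simp)) n)
        induction a using Polynomial.induction_on' with
        | add p q hp hq => rw [C_add, map_add]; exact add_mem hp hq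
        | monomial n a =>
          rw [← C_mul_X_pow_eq_monomial, C_mul, C_pow, map_mul, map_pow]
          exact mul_mem (M.toSubalgebra.algebraMap_mem' a |> fun h => by
            have : φ (C (C a)) = algebraMap K F a := φ.commutes a
            rwa [this]) (pow_mem (IntermediateField.subset_adjoin K _ (by simp)) n)
    let ψ : Polynomial (Polynomial K) →ₐ[K] M := φ.codRestrict M.toSubalgebra hmem
    let _ : Algebra (Polynomial (Polynomial K)) M := ψ.toRingHom.toAlgebra
    have : IsScalarTower (Polynomial (Polynomial K)) M F := .of_algebraMap_eq fun _ => rfl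
    have halg : Algebra.IsAlgebraic (Polynomial (Polynomial K)) F :=
      (IsFractionRing.comap_isAlgebraic_iff (K := F₀)).2 inferInstance
    exact ⟨fun z => (halg.isAlgebraic z).extendScalars fun a b h =>
      hinj (congrArg Subtype.val h)⟩

/-- A polynomial with as many roots as its degree permits has no further roots. -/
theorem mem_range_of_isRoot {L ι : Type*} [Field L] [Fintype ι] {p : Polynomial L} (hp : p ≠ 0)
    (hcard : p.natDegree = Fintype.card ι) {β : ι → L} (hβ : Function.Injective β)
    (hroot : ∀ i, p.IsRoot (β i)) {z : L} (hz : p.IsRoot z) : z ∈ Set.range β := by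
  classical
  have hsub : Finset.univ.image β ⊆ p.roots.toFinset := fun x hx => by
    obtain ⟨i, -, rfl⟩ := Finset.mem_image.1 hx
    rw [Multiset.mem_toFinset, mem_roots hp]
    exact hroot i
  have heq := Finset.eq_of_subset_of_card_le hsub (by
    rw [Finset.card_image_of_injective _ hβ, Finset.card_univ, ← hcard]
    exact (Multiset.toFinset_card_le _).trans (card_roots' p))
  have : z ∈ Finset.univ.image β := by
    rw [heq, Multiset.mem_toFinset, mem_roots hp]
    exact hz
  obtain ⟨i, -, hi⟩ := Finset.mem_image.1 this
  exact ⟨i, hi⟩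

/-- An integral point of a family of polynomials provides a specialization of a subextension of its
splitting field. -/
theorem isSpecialization_of_integral_point {S K E O Ω L ι G : Type} [CommRing S] [Field K]
    [CharZero K] [Algebra S K] [Field E] [Algebra (FractionRing (Polynomial (Polynomial K))) E]
    [Algebra (Polynomial (Polynomial K)) E] [IsScalarTower (Polynomial (Polynomial K))
      (FractionRing (Polynomial (Polynomial K))) E] [Algebra K E]
    [IsScalarTower K (FractionRing (Polynomial (Polynomial K))) E]
    [FiniteDimensional (FractionRing (Polynomial (Polynomial K))) E]
    [IsGalois (FractionRing (Polynomial (Polynomial K))) E]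
    [CommRing O] [Field Ω] [Algebra O Ω] [Field L] [Algebra Ω L] [Algebra O L]
    [IsScalarTower O Ω L] [FiniteDimensional Ω L] [IsGalois Ω L] [Algebra K Ω]
    {P : Polynomial (Polynomial (Polynomial S))} (hP : P.Monic) {N : ℕ} (hPN : P.natDegree = N)
    [Fintype ι] [Nonempty ι] (hι : Fintype.card ι = N) {r : ι → E}
    (hPr : (P.map (mapRingHom (mapRingHom (algebraMap S K)))).map
      (algebraMap (Polynomial (Polynomial K)) E) = ∏ i, (X - C (r i)))
    (hr : ∀ i, IsIntegral (Polynomial (Polynomial K)) (r i))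
    (hadj : Algebra.adjoin (FractionRing (Polynomial (Polynomial K))) (Set.range r) = ⊤)
    (hfull : ∀ π : Equiv.Perm ι, ∃ g : E ≃ₐ[FractionRing (Polynomial (Polynomial K))] E,
      ∀ i, g (r i) = r (π i))
    [Group G] [MulAction G ι] (hG : ∀ (g : G) (i : ι), g • i = i → g = 1)
    (j : G →* (E ≃ₐ[FractionRing (Polynomial (Polynomial K))] E))
    (hj : ∀ g i, j g (r i) = r (g • i))
    (f : (L ≃ₐ[Ω] L) →* G) (hf : Function.Injective f) (θ : S →+* O)
    (hθ : ∀ a, algebraMap O Ω (θ a) = algebraMap K Ω (algebraMap S K a)) (s t : O)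
    (β : Fin N → L) (hβ : Function.Injective β)
    (hroot : ∀ i, (P.map (eval₂RingHom (eval₂RingHom θ s) t)).eval₂ (algebraMap O L) (β i) = 0)
    (hD : ∀ (δ : L ≃ₐ[Ω] L) i, δ (β i) = β i → δ = 1) :
    IsSpecialization K (IntermediateField.fixedField j.range) E Ω L := by
  let a1 : Algebra (Polynomial (Polynomial K)) Ω := (eval₂RingHom (eval₂RingHom (algebraMap K Ω)
    (algebraMap O Ω s)) (algebraMap O Ω t)).toAlgebra
  have ha : algebraMap (Polynomial (Polynomial K)) Ω = eval₂RingHom (eval₂RingHom (algebraMap K Ω)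
    (algebraMap O Ω s)) (algebraMap O Ω t) := rfl
  have t1 : IsScalarTower K (Polynomial (Polynomial K)) Ω := .of_algebraMap_eq fun a => by
    rw [ha]
    simp [Polynomial.algebraMap_apply]
  have hcomp : (algebraMap (Polynomial (Polynomial K)) Ω).comp
      (mapRingHom (mapRingHom (algebraMap S K))) =
      (algebraMap O Ω).comp (eval₂RingHom (eval₂RingHom θ s) t) := by
    rw [ha]
    ext <;> simp [hθ]
  have hcomp' : ((algebraMap Ω L).comp (algebraMap (Polynomial (Polynomial K)) Ω)).comp
      (mapRingHom (mapRingHom (algebraMap S K))) =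
      (algebraMap O L).comp (eval₂RingHom (eval₂RingHom θ s) t) := by
    rw [RingHom.comp_assoc, hcomp, ← RingHom.comp_assoc, ← IsScalarTower.algebraMap_eq]
  have : CharZero Ω := charZero_of_injective_algebraMap (algebraMap K Ω).injective
  have : CharZero L := charZero_of_injective_algebraMap (algebraMap Ω L).injective
  let e : ι ≃ Fin N := Fintype.equivFinOfCardEq hι
  let p : Polynomial Ω := P.map ((algebraMap O Ω).comp (eval₂RingHom (eval₂RingHom θ s) t))
  have hp : p.Monic := hP.map _
  have hpL : p.map (algebraMap Ω L) =
      P.map ((algebraMap O L).comp (eval₂RingHom (eval₂RingHom θ s) t)) := by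
    rw [Polynomial.map_map, ← RingHom.comp_assoc, ← IsScalarTower.algebraMap_eq]
  have hpr (i : ι) : (p.map (algebraMap Ω L)).IsRoot (β (e i)) := by
    rw [hpL, IsRoot.def, ← hroot (e i), eval_map, eval₂_map]
  refine isSpecialization_of_point (R := Polynomial (Polynomial K)) r hr hadj
    (P.map (mapRingHom (mapRingHom (algebraMap S K)))) hPr hfull (β ∘ e) (hβ.comp e.injective)
    (fun i => ?_) (fun δ i => hD δ (e i)) (fun δ i => ?_) hG j hj f hf
  · rw [eval₂_map, hcomp', Function.comp_apply, ← hroot (e i), eval₂_map]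
  · refine mem_range_of_isRoot (hp.map (algebraMap Ω L)).ne_zero ?_ (hβ.comp e.injective) hpr ?_
    · rw [hp.natDegree_map, hP.natDegree_map, hPN, hι]
    · have := congrArg δ (hpr i).eq_zero
      rw [eval_map_algebraMap] at this
      rw [IsRoot.def, eval_map_algebraMap, Function.comp_apply, aeval_algHom_apply]
      exact this.trans (map_zero δ)

/-- A nonzero algebraic integer lies in only finitely many primes. -/
theorem exists_finset_not_mem {A : Type*} [CommRing A] [IsDedekindDomain A] {a : A} (ha : a ≠ 0) :
    ∃ T : Finset (HeightOneSpectrum A), ∀ v ∉ T, a ∉ v.asIdeal := by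
  have h := Ideal.finite_factors (I := Ideal.span {a}) (by simpa using ha)
  refine ⟨h.toFinset, fun v hv ha => hv ?_⟩
  rw [Set.Finite.mem_toFinset]
  exact Ideal.dvd_span_singleton.2 ha

/-- The permutation action of a group on three copies of itself. -/
abbrev actionOnCopies (G : Type) [Group G] : MulAction G (G × Fin 3) where
  smul g x := (g * x.1, x.2)
  one_smul x := Prod.ext (one_mul x.1) rfl
  mul_smul g h x := Prod.ext (mul_assoc g h x.1) rfl

end Specialization

open Specialization Polynomial

/-- Corollary 4.4(1): there is a finite Galois extension `E/F` with group `G`, `F` of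
transcendence degree `2` over the number field `K`, such that for every finite extension
`K'/K` there is a finite set `T'` of primes of `K'` with: for every prime `v' ∉ T'` of `K'`,
every finite Galois extension of the completion `K'_{v'}` with Galois group embedding into
`G` is a specialization of `E/F` over `K'_{v'}`. -/
theorem local_dimension_le_two_over_all_finite_extensions (K : Type) [Field K]
    [NumberField K] (G : Type) [Group G] [Finite G] :
    ∃ (F : Type) (_ : Field F) (_ : Algebra K F),
      (⊤ : IntermediateField K F).FG ∧
      (∃ x y : F, AlgebraicIndependent K ![x, y] ∧
        Algebra.IsAlgebraic (IntermediateField.adjoin K {x, y}) F) ∧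
      ∃ (E : Type) (_ : Field E) (_ : Algebra F E),
        FiniteDimensional F E ∧ IsGalois F E ∧ Nonempty ((E ≃ₐ[F] E) ≃* G) ∧
        ∀ (K' : Type) (_ : Field K') (_ : Algebra K K') (_ : NumberField K'),
          FiniteDimensional K K' →
          ∃ T' : Finset (HeightOneSpectrum (𝓞 K')),
            ∀ v' : HeightOneSpectrum (𝓞 K'), v' ∉ T' →
              ∀ (L : Type) (_ : Field L) (_ : Algebra (v'.adicCompletion K') L),
                FiniteDimensional (v'.adicCompletion K') L →
                IsGalois (v'.adicCompletion K') L →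
                (∃ f : (L ≃ₐ[v'.adicCompletion K'] L) →* G, Function.Injective f) →
                letI : Algebra K (v'.adicCompletion K') :=
                  ((algebraMap K' (v'.adicCompletion K')).comp (algebraMap K K')).toAlgebra
                IsSpecialization K F E (v'.adicCompletion K') L := by
  let _ : Fintype G := Fintype.ofFinite G
  let _ : MulAction G (G × Fin 3) := actionOnCopies G
  have hfree (g : G) (i : G × Fin 3) (h : g • i = i) : g = 1 := mul_eq_right.1 (congrArg Prod.fst h)
  have hG0 : 0 < Nat.card G := Nat.card_pos
  let N := Nat.card G * 3
  have hN : 3 ≤ N := Nat.le_mul_of_pos_left 3 hG0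
  have hι : Fintype.card (G × Fin 3) = N := by
    rw [Fintype.card_prod, Fintype.card_fin, Fintype.card_eq_nat_card]
  obtain ⟨P, c, δ, q₀, hc, hP, hPN, ⟨n, hn⟩, hδ, hlocal⟩ := exists_integral_family (𝓞 K)
    (Nat.lt_of_lt_of_le three_pos hN) (fibre N X) (monic_fibre hN X) (natDegree_fibre hN X)
  obtain ⟨E, _, _, _, _, r, _, _, hPr, hr, hadj, hrinj, hfull⟩ := exists_splitting_symmetric
    (FaithfulSMul.algebraMap_injective (𝓞 K) K) hN hι hP hPN hc n hn
  obtain ⟨j, hj⟩ := exists_monoidHom_of_forall_perm (G := G) hadj hfull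
  have hjinj : Function.Injective j := (injective_iff_map_eq_one j).2 fun g hg =>
    hfree g (1, 0) (hrinj (by rw [← hj, hg]; rfl))
  let F₀ := FractionRing (Polynomial (Polynomial K))
  let _ : Algebra K E := ((algebraMap F₀ E).comp (algebraMap K F₀)).toAlgebra
  have : IsScalarTower K F₀ E := .of_algebraMap_eq fun _ => rfl
  let F : IntermediateField F₀ E := IntermediateField.fixedField j.range
  refine ⟨F, inferInstance, inferInstance,
    fg_top_of_finiteDimensional (R := Polynomial (Polynomial K)) (F₀ := F₀),
    exists_algebraicIndependent_pair (F₀ := F₀), E, inferInstance, inferInstance, inferInstance,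
    inferInstance,
    ⟨(IntermediateField.subgroupEquivAlgEquiv j.range).symm.trans
      (MonoidHom.ofInjective hjinj).symm⟩, fun K' _ _ _ _ => ?_⟩
  obtain ⟨k, hk⟩ : ∃ k, δ.coeff k ≠ 0 := by
    by_contra! h
    exact hδ (Polynomial.ext h)
  have ha : ((q₀.factorial * N : ℕ) : 𝓞 K') * algebraMap (𝓞 K) (𝓞 K') (δ.coeff k) ≠ 0 := by
    refine mul_ne_zero (Nat.cast_ne_zero.2 (Nat.mul_ne_zero q₀.factorial_ne_zero (by omega))) ?_
    rwa [Ne, FaithfulSMul.algebraMap_eq_zero_iff]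
  obtain ⟨T, hT⟩ := exists_finset_not_mem ha
  refine ⟨T, fun v hv L _ _ _ _ ⟨f, hf⟩ => ?_⟩
  have hv := hT v hv
  let Ω := v.adicCompletion K'
  let O := v.adicCompletionIntegers K'
  have : Finite (𝓞 K' ⧸ v.asIdeal) := inferInstance
  obtain ⟨p, hp⟩ := CharP.exists (IsLocalRing.ResidueField O)
  have : Fact p.Prime := ⟨CharP.char_is_prime (IsLocalRing.ResidueField O) p⟩
  have hpv : (p : 𝓞 K') ∈ v.asIdeal := by
    rw [← algebraMap_mem_maximalIdeal_iff (K := K') v, map_natCast,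
      ← IsLocalRing.residue_eq_zero_iff, map_natCast, CharP.cast_eq_zero]
  have hpa : ¬ p ∣ q₀.factorial * N := fun h =>
    hv (Ideal.mul_mem_right _ _ (Ideal.mem_of_dvd _ (Nat.cast_dvd_cast h) hpv))
  have hqp : q₀ ≤ p := by
    by_contra! h
    exact hpa (((Nat.dvd_factorial (Fact.out : p.Prime).pos h.le)).mul_right N)
  let _ : Algebra O L := ((algebraMap Ω L).comp (algebraMap O Ω)).toAlgebra
  have : IsScalarTower O Ω L := .of_algebraMap_eq fun _ => rfl
  let θ : 𝓞 K →+* O := (algebraMap (𝓞 K') O).comp (algebraMap (𝓞 K) (𝓞 K'))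
  obtain ⟨s, t, β, hβ, hroot, hD⟩ := hlocal (Ω := Ω) (L := L) p θ
    ((Subgroup.card_dvd_of_injective f hf).mul_right 3) (fun h => hpa (h.mul_left _)) hqp
    fun h => by
      have := congrArg (fun q => coeff q k) h
      simp only [coeff_map, coeff_zero] at this
      rw [RingHom.comp_apply, IsLocalRing.residue_eq_zero_iff, RingHom.comp_apply,
        algebraMap_mem_maximalIdeal_iff] at this
      exact hv (Ideal.mul_mem_left _ _ this)
  let _ : Algebra K Ω := ((algebraMap K' Ω).comp (algebraMap K K')).toAlgebra
  exact isSpecialization_of_integral_point hP hPN hι hPr hr hadj hfull hfree j hj f hf θ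
    (fun a => rfl) s t β hβ hroot hD
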